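/- Let Γ and Γ* be non-elementary hyperbolic groups and let π be a probability measure on Γ̄ = Γ × Γ* with finite first moment whose marginals μ on Γ and μ* on Γ* are non-elementary. For ν_{μ*}-almost every η ∈ ∂Γ*, the conditional measure ν_π^η is exact dimensional on (∂Γ × ∂Γ*, q̄): for ν_π^η-almost every ξ̄, lim_{r→0} log ν_π^η(B̄(ξ̄,r))/log r = (h(π) − h(μ*))/l(Γ,μ); in particular, for ν_{μ*}-almost every η, the Hausdorff dimension of ν_π^η equals (h(π) − h(μ*))/l(Γ,μ). -/

import Mathlib

open MeasureTheory Filter Topology Metric Set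
open scoped ENNReal Classical

noncomputable section

namespace HMDim

/-! ### Gromov products and hyperbolicity -/

/-- The Gromov product `(x|y)_o = (d(x,o)+d(o,y)-d(x,y))/2`. -/
def gp {X : Type*} [MetricSpace X] (o x y : X) : ℝ :=
  (dist x o + dist o y - dist x y) / 2

/-- `X` is `δ`-hyperbolic. -/
def IsHyperbolicWith (X : Type*) [MetricSpace X] (δ : ℝ) : Prop :=
  ∀ x y z w : X, min (gp w x z) (gp w z y) - δ ≤ gp w x y

/-- `X` is hyperbolic: `δ`-hyperbolic for some `δ ≥ 0`. -/
def IsHyperbolic (X : Type*) [MetricSpace X] : Prop :=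
  ∃ δ : ℝ, 0 ≤ δ ∧ IsHyperbolicWith X δ

/-- `X` is `C`-roughly geodesic for some `C ≥ 0`: any two points are joined by a
`C`-rough geodesic. -/
def IsRoughGeodesicSpace (X : Type*) [MetricSpace X] : Prop :=
  ∃ C : ℝ, 0 ≤ C ∧ ∀ x y : X, ∃ (b : ℝ) (γ : ℝ → X), 0 ≤ b ∧ γ 0 = x ∧ γ b = y ∧
    ∀ s ∈ Set.Icc (0:ℝ) b, ∀ t ∈ Set.Icc (0:ℝ) b, abs (dist (γ s) (γ t) - |s - t|) ≤ C

/-- Bounded growth at some scale: there are `0 < r < R` and `N` such that every ball of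
radius `R` is covered by at most `N` balls of radius `r`. -/
def HasBoundedGrowthAtSomeScale (X : Type*) [MetricSpace X] : Prop :=
  ∃ (r R : ℝ) (N : ℕ), 0 < r ∧ r < R ∧
    ∀ x : X, ∃ s : Finset X, s.card ≤ N ∧ Metric.ball x R ⊆ ⋃ y ∈ s, Metric.ball y r

/-! ### The Gromov boundary -/

/-- A sequence is divergent if it is Cauchy for the Gromov-product quasi-metric, i.e.
`(u n | u m)_o → ∞`. -/
def IsDivergent {X : Type*} [MetricSpace X] (o : X) (u : ℕ → X) : Prop :=
  Tendsto (fun pr : ℕ × ℕ => gp o (u pr.1) (u pr.2)) atTop atTop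

/-- The type of divergent sequences. -/
def DivSeq (X : Type*) [MetricSpace X] (o : X) : Type _ := {u : ℕ → X // IsDivergent o u}

/-- Two divergent sequences are equivalent when `(u n | v m)_o → ∞`. -/
def bndRel {X : Type*} [MetricSpace X] (o : X) (u v : DivSeq X o) : Prop :=
  Tendsto (fun pr : ℕ × ℕ => gp o (u.1 pr.1) (v.1 pr.2)) atTop atTop

/-- The Gromov boundary: equivalence classes of divergent sequences. -/
def Boundary (X : Type*) [MetricSpace X] (o : X) : Type _ := Quot (bndRel o)

/-- The boundary point of a divergent sequence. -/
def mkB {X : Type*} [MetricSpace X] (o : X) (u : DivSeq X o) : Boundary X o :=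
  Quot.mk _ u

/-- The extended Gromov product of two boundary points: the infimum over pairs of
representatives of the liminf of Gromov products. -/
def gpB {X : Type*} [MetricSpace X] (o : X) (ξ η : Boundary X o) : ℝ :=
  sInf {t : ℝ | ∃ u v : DivSeq X o, mkB o u = ξ ∧ mkB o v = η ∧
    t = Filter.liminf (fun pr : ℕ × ℕ => gp o (u.1 pr.1) (v.1 pr.2)) atTop}

/-- The quasi-metric `q(ξ,η) = exp(-(ξ|η)_o)` on the boundary (`0` on the diagonal). -/
def qB {X : Type*} [MetricSpace X] (o : X) (ξ η : Boundary X o) : ℝ :=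
  if ξ = η then 0 else Real.exp (-(gpB o ξ η))

/-- The extended Gromov product of an interior point with a boundary point. -/
def gpXB {X : Type*} [MetricSpace X] (o : X) (x : X) (ξ : Boundary X o) : ℝ :=
  sInf {t : ℝ | ∃ u : DivSeq X o, mkB o u = ξ ∧
    t = Filter.liminf (fun m : ℕ => gp o x (u.1 m)) atTop}

/-- Quasi-metric between an interior point and a boundary point. -/
def qXB {X : Type*} [MetricSpace X] (o : X) (x : X) (ξ : Boundary X o) : ℝ :=
  Real.exp (-(gpXB o x ξ))

/-- The open ball of a quasi-metric. -/
def qball {A : Type*} (q : A → A → ℝ) (ξ : A) (r : ℝ) : Set A := {η | q ξ η < r}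

/-- The max quasi-metric `q̄` on the product of two boundaries. -/
def qbb {X Xs : Type*} [MetricSpace X] [MetricSpace Xs] (o : X) (os : Xs)
    (ξ η : Boundary X o × Boundary Xs os) : ℝ :=
  max (qB o ξ.1 η.1) (qB os ξ.2 η.2)

/-- Boundaries are measurable spaces, with the σ-algebra generated by quasi-metric balls. -/
instance (X : Type*) [MetricSpace X] (o : X) : MeasurableSpace (Boundary X o) :=
  MeasurableSpace.generateFrom {s | ∃ ξ r, s = qball (qB o) ξ r}

/-! ### The boundary action of isometries -/

lemma gp_isometry_le {X : Type*} [MetricSpace X] (o : X) (g : X ≃ᵢ X) (x y : X) :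
    gp o x y - dist o (g o) ≤ gp o (g x) (g y) := by
  have e1 : dist (g x) (g o) = dist x o := g.dist_eq x o
  have e2 : dist (g o) (g y) = dist o y := g.dist_eq o y
  have e3 : dist (g x) (g y) = dist x y := g.dist_eq x y
  have e4 : dist (g o) o = dist o (g o) := dist_comm _ _
  have t1 : dist (g x) (g o) ≤ dist (g x) o + dist o (g o) := dist_triangle _ _ _
  have t2 : dist (g o) (g y) ≤ dist (g o) o + dist o (g y) := dist_triangle _ _ _
  simp only [gp]
  linarith [t1, t2, e1, e2, e3, e4]

lemma isDivergent_comp {X : Type*} [MetricSpace X] (o : X) (g : X ≃ᵢ X) {u : ℕ → X}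
    (h : IsDivergent o u) : IsDivergent o fun n => g (u n) := by
  have h' := tendsto_atTop_add_const_right atTop (-(dist o (g o)))
    (h : Tendsto (fun pr : ℕ × ℕ => gp o (u pr.1) (u pr.2)) atTop atTop)
  refine tendsto_atTop_mono (fun pr => ?_) h'
  have := gp_isometry_le o g (u pr.1) (u pr.2)
  simpa [sub_eq_add_neg] using this

lemma bndRel_comp {X : Type*} [MetricSpace X] (o : X) (g : X ≃ᵢ X) {u v : DivSeq X o}
    (h : bndRel o u v) :
    bndRel o ⟨fun n => g (u.1 n), isDivergent_comp o g u.2⟩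
      ⟨fun n => g (v.1 n), isDivergent_comp o g v.2⟩ := by
  have h' := tendsto_atTop_add_const_right atTop (-(dist o (g o)))
    (h : Tendsto (fun pr : ℕ × ℕ => gp o (u.1 pr.1) (v.1 pr.2)) atTop atTop)
  refine tendsto_atTop_mono (fun pr => ?_) h'
  have := gp_isometry_le o g (u.1 pr.1) (v.1 pr.2)
  simpa [sub_eq_add_neg] using this

/-- The induced action of an isometry on the Gromov boundary. -/
def bAct {X : Type*} [MetricSpace X] (o : X) (g : X ≃ᵢ X) :
    Boundary X o → Boundary X o :=
  Quot.map (fun u : DivSeq X o =>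
      (⟨fun n => g (u.1 n), isDivergent_comp o g u.2⟩ : DivSeq X o))
    (fun _ _ h => bndRel_comp o g h)

/-! ### Random walks on countable groups -/

/-- Convolution of two measures (as `ℝ≥0∞`-valued functions) on a group. -/
def conv {G : Type*} [Group G] (p q : G → ℝ≥0∞) : G → ℝ≥0∞ :=
  fun x => ∑' y : G, p y * q (y⁻¹ * x)

/-- The `n`-fold convolution power `π_n` of `p`. -/
def piN {G : Type*} [Group G] (p : G → ℝ≥0∞) : ℕ → G → ℝ≥0∞
  | 0 => fun x => if x = 1 then 1 else 0
  | n + 1 => conv (piN p n) p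

/-- The Shannon entropy `H(π_n)` of the `n`-th convolution power. -/
def entropySeq {G : Type*} [Group G] (p : G → ℝ≥0∞) (n : ℕ) : ℝ :=
  ∑' x : G, Real.negMulLog ((piN p n x).toReal)

/-- The first moment of `π_n` with respect to a displacement function `f`. -/
def momentSeq {G : Type*} [Group G] (p : G → ℝ≥0∞) (f : G → ℝ) (n : ℕ) : ℝ :=
  ∑' x : G, (piN p n x).toReal * f x

/-- `h` is the asymptotic entropy of the `p`-random walk:
`h = lim (1/n) H(π_n)`. -/
def HasEntropy {G : Type*} [Group G] (p : G → ℝ≥0∞) (h : ℝ) : Prop :=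
  Tendsto (fun n : ℕ => entropySeq p n / n) atTop (nhds h)

/-- `l` is the drift (rate of escape) of the `p`-random walk with respect to the
displacement `f`: `l = lim (1/n) Σ_x f(x) π_n(x)`. -/
def HasDrift {G : Type*} [Group G] (p : G → ℝ≥0∞) (f : G → ℝ) (l : ℝ) : Prop :=
  Tendsto (fun n : ℕ => momentSeq p f n / n) atTop (nhds l)

/-- `p` is a probability distribution. -/
def IsProb {G : Type*} (p : G → ℝ≥0∞) : Prop := ∑' x : G, p x = 1

/-- Finite first moment with respect to a displacement function `f`. -/
def FiniteFirstMoment {G : Type*} (p : G → ℝ≥0∞) (f : G → ℝ) : Prop :=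
  ∑' x : G, p x * ENNReal.ofReal (f x) ≠ ∞

/-- The pushforward of a distribution `p` by a map `f` (e.g. a marginal). -/
def marginalStar {G A : Type*} (p : G → ℝ≥0∞) (f : G → A) : A → ℝ≥0∞ :=
  fun a => ∑' x : G, if f x = a then p x else 0

/-- A subgroup is non-elementary (in the relevant sense) if it contains a free
subgroup of rank 2. -/
def IsNonElementarySubgroup {G : Type*} [Group G] (H : Subgroup G) : Prop :=
  ∃ φ : FreeGroup (Fin 2) →* G, Function.Injective φ ∧ φ.range ≤ H

/-- A measure `p` on a group is non-elementary if the subgroup generated by its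
support contains a free subgroup of rank 2. -/
def IsNonElemMeasure {G : Type*} [Group G] (p : G → ℝ≥0∞) : Prop :=
  IsNonElementarySubgroup (Subgroup.closure {x : G | p x ≠ 0})

/-- A group containing a free subgroup of rank 2 (a non-elementary group). -/
def HasFreeSubgroup (G : Type*) [Group G] : Prop :=
  ∃ φ : FreeGroup (Fin 2) →* G, Function.Injective φ

/-! ### Path space -/

/-- The position `w_n = x_1 ⋯ x_n` of the random walk with increments `ω`. -/
def walk {G : Type*} [Group G] (ω : ℕ → G) (n : ℕ) : G := ((List.range n).map ω).prod

/-- The cylinder set `[w̄_0, …, w̄_n]` of trajectories whose positions agree with those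
of `ω` up to time `n`. -/
def cyl {G : Type*} [Group G] (ω : ℕ → G) (n : ℕ) : Set (ℕ → G) :=
  {ω' | ∀ i ≤ n, walk ω' i = walk ω i}

/-- `P` is the distribution of the increments of the `p`-random walk: the product
measure `p^{⊗ℕ}` on the path space. -/
def IsRWMeasure {G : Type*} [Group G] [MeasurableSpace G] (p : G → ℝ≥0∞)
    (P : Measure (ℕ → G)) : Prop :=
  IsProbabilityMeasure P ∧
    ∀ (n : ℕ) (g : ℕ → G), P {ω | ∀ i < n, ω i = g i} = ∏ i ∈ Finset.range n, p (g i)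

/-- `ν` is the harmonic measure on the boundary of `X` for the random walk with path
measure `P` and orbit map `z`: the image of `P` under the a.s.-defined boundary map. -/
def IsHarmonic {Ω X : Type*} [MeasurableSpace Ω] [MetricSpace X] (o : X)
    (P : Measure Ω) (z : Ω → ℕ → X) (ν : Measure (Boundary X o)) : Prop :=
  ∃ bnd : Ω → Boundary X o, Measurable bnd ∧ ν = P.map bnd ∧
    ∀ᵐ ω ∂P, ∃ h : IsDivergent o (z ω), bnd ω = mkB o ⟨z ω, h⟩

/-- `ν` is the harmonic measure on the product of the boundaries of `X` and `Xs` for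
the random walk with path measure `P` and orbit maps `z`, `zs`. -/
def IsJointHarmonic {Ω X Xs : Type*} [MeasurableSpace Ω] [MetricSpace X] [MetricSpace Xs]
    (o : X) (os : Xs) (P : Measure Ω) (z : Ω → ℕ → X) (zs : Ω → ℕ → Xs)
    (ν : Measure (Boundary X o × Boundary Xs os)) : Prop :=
  ∃ bnd : Ω → Boundary X o × Boundary Xs os, Measurable bnd ∧ ν = P.map bnd ∧
    ∀ᵐ ω ∂P, ∃ (h1 : IsDivergent o (z ω)) (h2 : IsDivergent os (zs ω)),
      bnd ω = (mkB o ⟨z ω, h1⟩, mkB os ⟨zs ω, h2⟩)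

/-- `cond` is a disintegration (system of conditional measures) of `P` with respect to
the map `f`, over the pushforward `νB = f_* P`. -/
def IsDisintegration {A B : Type*} [MeasurableSpace A] [MeasurableSpace B]
    (P : Measure A) (f : A → B) (νB : Measure B) (cond : B → Measure A) : Prop :=
  νB = P.map f ∧ (∀ᵐ b ∂νB, IsProbabilityMeasure (cond b)) ∧
    (∀ᵐ b ∂νB, cond b (f ⁻¹' {b}) = 1) ∧
    ∀ s : Set A, MeasurableSet s → P s = ∫⁻ b, cond b s ∂νB

/-! ### Hausdorff dimension for quasi-metrics -/

/-- Diameter of a set for a quasi-metric. -/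
def qdiam {A : Type*} (q : A → A → ℝ) (E : Set A) : ℝ≥0∞ :=
  ⨆ x ∈ E, ⨆ y ∈ E, ENNReal.ofReal (q x y)

/-- Hausdorff pre-measure (content) at scale `Δ`. -/
def qHContent {A : Type*} (q : A → A → ℝ) (α Δ : ℝ) (E : Set A) : ℝ≥0∞ :=
  ⨅ (c : ℕ → Set A) (_ : E ⊆ ⋃ i, c i) (_ : ∀ i, qdiam q (c i) ≤ ENNReal.ofReal Δ),
    ∑' i, qdiam q (c i) ^ α

/-- The `α`-dimensional Hausdorff measure of a set for a quasi-metric. -/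
def qHMeasure {A : Type*} (q : A → A → ℝ) (α : ℝ) (E : Set A) : ℝ≥0∞ :=
  ⨆ (Δ : ℝ) (_ : 0 < Δ), qHContent q α Δ E

/-- The Hausdorff dimension of a set for a quasi-metric. -/
def qdimSet {A : Type*} (q : A → A → ℝ) (E : Set A) : ℝ :=
  sSup {α : ℝ | 0 ≤ α ∧ 0 < qHMeasure q α E}

/-- The upper Hausdorff dimension of a measure. -/
def qdimUpper {A : Type*} [MeasurableSpace A] (q : A → A → ℝ) (ν : Measure A) : ℝ :=
  sInf {d : ℝ | ∃ E : Set A, MeasurableSet E ∧ ν Eᶜ = 0 ∧ d = qdimSet q E}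

/-- The lower Hausdorff dimension of a measure. -/
def qdimLower {A : Type*} [MeasurableSpace A] (q : A → A → ℝ) (ν : Measure A) : ℝ :=
  sInf {d : ℝ | ∃ E : Set A, MeasurableSet E ∧ 0 < ν E ∧ d = qdimSet q E}

/-- The Hausdorff dimension of `ν` exists and equals `D`. -/
def HasDim {A : Type*} [MeasurableSpace A] (q : A → A → ℝ) (ν : Measure A) (D : ℝ) : Prop :=
  qdimUpper q ν = D ∧ qdimLower q ν = D

/-- `ν` is exact dimensional with dimension `D` for the quasi-metric `q`:
`lim_{r→0} log ν(B(ξ,r))/log r = D` for `ν`-a.e. `ξ`. -/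
def ExactDim {A : Type*} [MeasurableSpace A] (q : A → A → ℝ) (ν : Measure A) (D : ℝ) : Prop :=
  ∀ᵐ ξ ∂ν, Tendsto (fun r : ℝ => Real.log (ν (qball q ξ r)).toReal / Real.log r)
    (nhdsWithin 0 (Set.Ioi 0)) (nhds D)

/-! ### Differential entropy -/

/-- The differential entropy
`h(∂X*, μ*) = Σ_g μ*(g) ∫ log (d gν/dν) d(gν)` of a measure on the isometry group with
respect to a boundary measure. -/
def diffEntropy {Xs : Type*} [MetricSpace Xs] (os : Xs) (pstar : (Xs ≃ᵢ Xs) → ℝ≥0∞)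
    (νs : Measure (Boundary Xs os)) : ℝ :=
  ∑' g : (Xs ≃ᵢ Xs), (pstar g).toReal *
    ∫ η, Real.log ((Measure.rnDeriv (νs.map (bAct os g)) νs η).toReal)
      ∂(νs.map (bAct os g))

/-! ### Word metrics and hyperbolic groups -/

/-- The word length of `g` with respect to a (symmetrized) generating set `S`. -/
def wordLength {G : Type*} [Group G] (S : Set G) (g : G) : ℕ :=
  sInf {n : ℕ | ∃ f : Fin n → G, (∀ i, f i ∈ S ∨ (f i)⁻¹ ∈ S) ∧ g = (List.ofFn f).prod}

/-- The metric of `G` is quasi-isometric to a word metric of a finite generating set. -/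
def IsQIToWordMetric (G : Type*) [Group G] [MetricSpace G] : Prop :=
  ∃ S : Finset G, Subgroup.closure (S : Set G) = ⊤ ∧
    ∃ Λ c : ℝ, 1 ≤ Λ ∧ 0 ≤ c ∧ ∀ g : G,
      (wordLength (S : Set G) g : ℝ) / Λ - c ≤ dist (1 : G) g ∧
      dist (1 : G) g ≤ Λ * (wordLength (S : Set G) g) + c

/-- The metric of `G` is left invariant. -/
def LeftInvariantMetric (G : Type*) [Group G] [MetricSpace G] : Prop :=
  ∀ g x y : G, dist (g * x) (g * y) = dist x y

/-- `G`, with its metric, is a hyperbolic group: the metric is left invariant,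
hyperbolic and quasi-isometric to a word metric. -/
def IsHypGroupMetric (G : Type*) [Group G] [MetricSpace G] : Prop :=
  LeftInvariantMetric G ∧ IsHyperbolic G ∧ IsQIToWordMetric G

/-! ### Groups of isometries of a product -/

/-- First component of an element of a subgroup of `Isom X × Isom X*`. -/
def proj1 {X Xs : Type*} [MetricSpace X] [MetricSpace Xs]
    {Γb : Subgroup ((X ≃ᵢ X) × (Xs ≃ᵢ Xs))} (γ : Γb) : X ≃ᵢ X :=
  (γ : (X ≃ᵢ X) × (Xs ≃ᵢ Xs)).1

/-- Second component of an element of a subgroup of `Isom X × Isom X*`. -/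
def proj2 {X Xs : Type*} [MetricSpace X] [MetricSpace Xs]
    {Γb : Subgroup ((X ≃ᵢ X) × (Xs ≃ᵢ Xs))} (γ : Γb) : Xs ≃ᵢ Xs :=
  (γ : (X ≃ᵢ X) × (Xs ≃ᵢ Xs)).2

/-- Displacement `d̄(ō, γ·ō)` of the base point `ō = (o,o*)` (the metric of the product
is the max metric). -/
def disp {X Xs : Type*} [MetricSpace X] [MetricSpace Xs]
    {Γb : Subgroup ((X ≃ᵢ X) × (Xs ≃ᵢ Xs))} (o : X) (os : Xs) (γ : Γb) : ℝ :=
  dist (o, os) (proj1 γ o, proj2 γ os)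

/-- Finite exponential growth relative to a displacement function `f`:
`#{x : f(x) < r} ≤ c e^{c r}`. -/
def FinExpGrowth {G : Type*} (f : G → ℝ) : Prop :=
  ∃ c : ℝ, 0 < c ∧ ∀ r : ℝ, 0 < r →
    {x : G | f x < r}.Finite ∧ ({x : G | f x < r}.ncard : ℝ) ≤ c * Real.exp (c * r)

/-! ### The events of Lemmas `A` and `E_n(η)` -/

/-- The event `A_{ε,n} = ∩_{t ≥ n} {z̄_∞ exists and q̄(z̄_t, z̄_∞) ≤ e^{-(l*-ε)n}}`. -/
def Aev {X Xs : Type*} [MetricSpace X] [MetricSpace Xs]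
    (Γb : Subgroup ((X ≃ᵢ X) × (Xs ≃ᵢ Xs))) (o : X) (os : Xs) (ε lst : ℝ) (n : ℕ) :
    Set (ℕ → Γb) :=
  {ω | ∃ (h1 : IsDivergent o (fun t => proj1 (walk ω t) o))
        (h2 : IsDivergent os (fun t => proj2 (walk ω t) os)),
      ∀ t, n ≤ t →
        max (qXB o (proj1 (walk ω t) o) (mkB o ⟨_, h1⟩))
            (qXB os (proj2 (walk ω t) os) (mkB os ⟨_, h2⟩))
          ≤ Real.exp (-((lst - ε) * n))}

/-- The event
`E_{ε,n}(η) = {P^η([w̄_0,…,w̄_n] ∩ A_{ε,n}) ≤ e^{n(h*+ε)} P([w̄_0,…,w̄_n] ∩ A_{ε,n})}`. -/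
def Eev {X Xs : Type*} [MetricSpace X] [MetricSpace Xs]
    (Γb : Subgroup ((X ≃ᵢ X) × (Xs ≃ᵢ Xs))) [MeasurableSpace Γb] (o : X) (os : Xs)
    (P : Measure (ℕ → Γb)) (condP : Boundary Xs os → Measure (ℕ → Γb))
    (hst ε lst : ℝ) (η : Boundary Xs os) (n : ℕ) : Set (ℕ → Γb) :=
  {ω | condP η (cyl ω n ∩ Aev Γb o os ε lst n) ≤
        ENNReal.ofReal (Real.exp (n * (hst + ε))) * P (cyl ω n ∩ Aev Γb o os ε lst n)}

/-! ### Special measures -/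

/-- The measure `π^ρ = ρ μ×μ + (1-ρ) μ_diag` on `Γ × Γ`. -/
def pRho {Γ : Type*} (p : Γ → ℝ≥0∞) (ρ : ℝ) : Γ × Γ → ℝ≥0∞ :=
  fun g => ENNReal.ofReal ρ * (p g.1 * p g.2) +
    ENNReal.ofReal (1 - ρ) * (if g.1 = g.2 then p g.1 else 0)

/-- The uniform distribution on the symmetrized free basis of `F_{m+1}`. -/
def symFreeBasisUniform (m : ℕ) : FreeGroup (Fin (m + 1)) → ℝ≥0∞ :=
  fun g => if ∃ i : Fin (m + 1), g = FreeGroup.of i ∨ g = (FreeGroup.of i)⁻¹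
    then ENNReal.ofReal (1 / (2 * (m + 1))) else 0

/-- The homomorphism `F_{m+1} → F_m` sending `x_i ↦ y_i` for `i ≤ m` and `x_{m+1} ↦ 1`. -/
def projHom (m : ℕ) : FreeGroup (Fin (m + 1)) →* FreeGroup (Fin m) :=
  FreeGroup.lift (fun i => if h : (i : ℕ) < m then FreeGroup.of (⟨i, h⟩ : Fin m) else 1)

set_option linter.unusedSectionVars false
set_option linter.style.haveILetI false

/-! ### Hyperbolic geometry -/

section Geo
variable {X : Type*} [MetricSpace X]

lemma gp_comm (o x y : X) : gp o x y = gp o y x := by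
  simp only [gp, dist_comm x y, dist_comm x o, dist_comm o y]; ring

lemma gp_nonneg (o x y : X) : 0 ≤ gp o x y := by
  have := dist_triangle x o y
  simp only [gp]; linarith

/-- All representatives have eventually Gromov product above `s`. -/
def near (o : X) (s : ℝ) (ξ η : Boundary X o) : Prop :=
  ∀ u v : DivSeq X o, mkB o u = ξ → mkB o v = η →
    ∀ᶠ pr : ℕ × ℕ in atTop, s < gp o (u.1 pr.1) (v.1 pr.2)

/-- Interior/boundary version of `near`. -/
def nearX (o : X) (s : ℝ) (x : X) (ξ : Boundary X o) : Prop :=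
  ∀ u : DivSeq X o, mkB o u = ξ → ∀ᶠ n : ℕ in atTop, s < gp o x (u.1 n)

lemma exists_rep (o : X) (ξ : Boundary X o) : ∃ u : DivSeq X o, mkB o u = ξ :=
  Quot.exists_rep ξ

lemma ev_pair {p : ℕ × ℕ → Prop} : (∀ᶠ pr : ℕ × ℕ in atTop, p pr) ↔
    ∃ N, ∀ n m, N ≤ n → N ≤ m → p (n, m) := by
  rw [eventually_atTop]
  constructor
  · rintro ⟨⟨a, b⟩, h⟩
    exact ⟨max a b, fun n m hn hm => h (n, m)
      ⟨(le_max_left _ _).trans hn, (le_max_right _ _).trans hm⟩⟩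
  · rintro ⟨N, h⟩
    exact ⟨(N, N), fun pr hpr => h pr.1 pr.2 hpr.1 hpr.2⟩

variable {o : X} {δ : ℝ}

lemma bndRel_equiv (hδ : IsHyperbolicWith X δ) : Equivalence (bndRel (X := X) o) := by
  refine ⟨fun u => u.2, fun {u v} h => ?_, fun {u v w} h1 h2 => ?_⟩
  · rw [bndRel, Filter.tendsto_atTop] at h ⊢
    intro b
    obtain ⟨N, hN⟩ := ev_pair.1 (h b)
    exact ev_pair.2 ⟨N, fun n m hn hm => by rw [gp_comm]; exact hN m n hm hn⟩
  · rw [bndRel, Filter.tendsto_atTop] at h1 h2 ⊢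
    intro b
    obtain ⟨N, hN⟩ := ev_pair.1 (h1 (b + δ))
    obtain ⟨N', hN'⟩ := ev_pair.1 (h2 (b + δ))
    refine ev_pair.2 ⟨max N N', fun n m hn hm => ?_⟩
    have a1 := hN n (max N N') ((le_max_left _ _).trans hn) (le_max_left _ _)
    have a2 := hN' (max N N') m (le_max_right _ _) ((le_max_right _ _).trans hm)
    have := hδ (u.1 n) (w.1 m) (v.1 (max N N')) o
    have := le_min a1 a2
    simp only at *
    linarith

lemma mkB_eq_iff (hδ : IsHyperbolicWith X δ) (u v : DivSeq X o) :
    mkB o u = mkB o v ↔ bndRel o u v := by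
  constructor
  · intro h
    have := Quot.eqvGen_exact h
    exact (Equivalence.eqvGen_iff (bndRel_equiv hδ)).1 this
  · exact fun h => Quot.sound h

lemma mkB_eq_of_eventuallyEq {u v : DivSeq X o} (n : ℕ)
    (h : ∀ k, n ≤ k → u.1 k = v.1 k) : mkB o u = mkB o v := by
  apply Quot.sound
  have := u.2
  rw [IsDivergent] at this
  rw [bndRel]
  refine this.congr' ?_
  refine ev_pair.2 ⟨n, fun a b ha hb => ?_⟩
  simp only [h b hb]

lemma near_self (hδ : IsHyperbolicWith X δ) (s : ℝ) (ξ : Boundary X o) : near o s ξ ξ := by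
  intro u v hu hv
  have : bndRel o u v := (mkB_eq_iff hδ u v).1 (hu.trans hv.symm)
  exact this.eventually_gt_atTop s

lemma near.symm {s : ℝ} {ξ η : Boundary X o} (h : near o s ξ η) : near o s η ξ := by
  intro u v hu hv
  obtain ⟨N, hN⟩ := ev_pair.1 (h v u hv hu)
  exact ev_pair.2 ⟨N, fun n m hn hm => by rw [gp_comm]; exact hN m n hm hn⟩

lemma near.trans (hδ : IsHyperbolicWith X δ) {s : ℝ} {ξ η ζ : Boundary X o}
    (h1 : near o s ξ η) (h2 : near o s η ζ) : near o (s - δ) ξ ζ := by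
  intro u w hu hw
  obtain ⟨v, hv⟩ := exists_rep o η
  obtain ⟨N, hN⟩ := ev_pair.1 (h1 u v hu hv)
  obtain ⟨N', hN'⟩ := ev_pair.1 (h2 v w hv hw)
  refine ev_pair.2 ⟨max N N', fun n m hn hm => ?_⟩
  have a1 := hN n (max N N') ((le_max_left _ _).trans hn) (le_max_left _ _)
  have a2 := hN' (max N N') m (le_max_right _ _) ((le_max_right _ _).trans hm)
  have := hδ (u.1 n) (w.1 m) (v.1 (max N N')) o
  have := lt_min a1 a2
  simp only at *
  linarith

lemma near.mono {s t : ℝ} {ξ η : Boundary X o} (h : near o s ξ η) (hst : t ≤ s) :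
    near o t ξ η := fun u v hu hv => (h u v hu hv).mono fun _ h => hst.trans_lt h

lemma nearX.mono {s t : ℝ} {x : X} {ξ : Boundary X o} (h : nearX o s x ξ) (hst : t ≤ s) :
    nearX o t x ξ := fun u hu => (h u hu).mono fun _ h => hst.trans_lt h

lemma nearX.toNear (hδ : IsHyperbolicWith X δ) {s : ℝ} {x : X} {ξ η : Boundary X o}
    (h1 : nearX o s x ξ) (h2 : nearX o s x η) : near o (s - δ) ξ η := by
  intro u v hu hv
  obtain ⟨N, hN⟩ := eventually_atTop.1 (h1 u hu)
  obtain ⟨N', hN'⟩ := eventually_atTop.1 (h2 v hv)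
  refine ev_pair.2 ⟨max N N', fun n m hn hm => ?_⟩
  have a1 := hN n ((le_max_left _ _).trans hn)
  have a2 := hN' m ((le_max_right _ _).trans hm)
  have := hδ (u.1 n) (v.1 m) x o
  rw [gp_comm o (u.1 n) x] at this
  have := lt_min a1 a2
  simp only at *
  linarith

lemma nearX.trans (hδ : IsHyperbolicWith X δ) {s : ℝ} {x : X} {ξ η : Boundary X o}
    (h1 : nearX o s x ξ) (h2 : near o s ξ η) : nearX o (s - δ) x η := by
  intro v hv
  obtain ⟨u, hu⟩ := exists_rep o ξ
  obtain ⟨N, hN⟩ := eventually_atTop.1 (h1 u hu)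
  obtain ⟨N', hN'⟩ := ev_pair.1 (h2 u v hu hv)
  refine eventually_atTop.2 ⟨max N N', fun m hm => ?_⟩
  have a1 := hN (max N N') (le_max_left _ _)
  have a2 := hN' (max N N') m (le_max_right _ _) ((le_max_right _ _).trans hm)
  have := hδ x (v.1 m) (u.1 (max N N')) o
  have := lt_min a1 a2
  simp only at *
  linarith

lemma nearX.gp_lt (hδ : IsHyperbolicWith X δ) {s : ℝ} {x x' : X} {ξ : Boundary X o}
    (h1 : nearX o s x ξ) (h2 : nearX o s x' ξ) : s - δ < gp o x x' := by
  obtain ⟨u, hu⟩ := exists_rep o ξ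
  obtain ⟨n, hn, hn'⟩ := ((h1 u hu).and (h2 u hu)).exists
  have := hδ x x' (u.1 n) o
  rw [gp_comm o (u.1 n) x'] at this
  have := lt_min hn hn'
  linarith

lemma nearX_of_frequently (hδ : IsHyperbolicWith X δ) {s : ℝ} {x : X} (u : DivSeq X o)
    (h : ∃ᶠ n in atTop, s < gp o x (u.1 n)) : nearX o (s - δ) x (mkB o u) := by
  intro v hv
  have hr : bndRel o u v := (mkB_eq_iff hδ u v).1 hv.symm
  obtain ⟨N, hN⟩ := ev_pair.1 (hr.eventually_gt_atTop s)
  obtain ⟨n, hn, hns⟩ := frequently_atTop.1 h N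
  refine eventually_atTop.2 ⟨N, fun m hm => ?_⟩
  have a2 := hN n m hn hm
  have := hδ x (v.1 m) (u.1 n) o
  have := lt_min hns a2
  simp only at *
  linarith

lemma near_of_qB_lt (hδ : IsHyperbolicWith X δ) {s : ℝ} {ξ η : Boundary X o}
    (h : qB o ξ η < Real.exp (-s)) : near o s ξ η := by
  by_cases e : ξ = η
  · subst e; exact near_self hδ s ξ
  rw [qB, if_neg e, Real.exp_lt_exp, neg_lt_neg_iff] at h
  intro u v hu hv
  have hb : BddBelow {t : ℝ | ∃ u v : DivSeq X o, mkB o u = ξ ∧ mkB o v = η ∧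
      t = Filter.liminf (fun pr : ℕ × ℕ => gp o (u.1 pr.1) (v.1 pr.2)) atTop} := by
    refine ⟨0, ?_⟩
    rintro t ⟨u, v, hu, hv, rfl⟩
    apply Real.sSup_nonneg'
    exact ⟨0, Eventually.of_forall fun _ => gp_nonneg _ _ _, le_rfl⟩
  have h1 : s < Filter.liminf (fun pr : ℕ × ℕ => gp o (u.1 pr.1) (v.1 pr.2)) atTop :=
    h.trans_le (csInf_le hb ⟨u, v, hu, hv, rfl⟩)
  exact eventually_lt_of_lt_liminf h1
    (isBoundedUnder_of ⟨0, fun _ => gp_nonneg _ _ _⟩)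

lemma qB_le_of_near (hδ : IsHyperbolicWith X δ) {s : ℝ} {ξ η : Boundary X o}
    (h : near o s ξ η) : qB o ξ η ≤ Real.exp (-s) := by
  by_cases e : ξ = η
  · rw [qB, if_pos e]; positivity
  rw [qB, if_neg e, Real.exp_le_exp, neg_le_neg_iff]
  obtain ⟨u, hu⟩ := exists_rep o ξ
  obtain ⟨v, hv⟩ := exists_rep o η
  refine le_csInf ⟨_, u, v, hu, hv, rfl⟩ ?_
  rintro t ⟨u, v, hu, hv, rfl⟩
  have hn : ¬ bndRel o u v := fun hr => e (by rw [← hu, ← hv]; exact Quot.sound hr)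
  refine le_liminf_of_le ?_ ((h u v hu hv).mono fun _ h => h.le)
  rw [bndRel, Filter.tendsto_atTop] at hn
  push Not at hn
  obtain ⟨b, hb⟩ := hn
  exact IsCoboundedUnder.of_frequently_le (a := b) (hb.mono fun _ h => h.le)

lemma qB_self (ξ : Boundary X o) : qB o ξ ξ = 0 := if_pos rfl

lemma qB_nonneg (ξ η : Boundary X o) : 0 ≤ qB o ξ η := by
  rw [qB]; split_ifs <;> positivity

lemma qB_eq_zero {ξ η : Boundary X o} (h : qB o ξ η ≤ 0) : ξ = η := by
  rw [qB] at h
  split_ifs at h with e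
  · exact e
  · exact absurd h (not_le.2 (Real.exp_pos _))

lemma chain_gp (hδ : IsHyperbolicWith X δ) (hδ0 : 0 ≤ δ) (z : ℕ → X) (a b : ℝ) (ha : δ ≤ a)
    (N : ℕ) (M : ℕ)
    (h : ∀ i, N ≤ i → i < M → a * i - b ≤ gp o (z i) (z (i + 1))) (k : ℕ) :
    ∀ j, N ≤ j → j + 1 + k ≤ M → a * j - b - δ ≤ gp o (z j) (z (j + 1 + k)) := by
  induction k with
  | zero => intro j hj hM; have := h j hj (by omega); simp only [add_zero]; linarith
  | succ k ih =>
    intro j hj hM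
    have h1 := h j hj (by omega)
    have h2 := ih (j + 1) (by omega) (by omega)
    have h3 := hδ (z j) (z (j + 1 + (k + 1))) (z (j + 1)) o
    rw [show j + 1 + (k + 1) = j + 1 + 1 + k by ring] at h3 ⊢
    push_cast at h2
    have : a * j - b ≤ min (gp o (z j) (z (j + 1))) (gp o (z (j + 1)) (z (j + 1 + 1 + k))) :=
      le_min h1 (by linarith)
    linarith

/-- Core/shadow lemma. -/
lemma exists_shadow (hδ : IsHyperbolicWith X δ) (hδ0 : 0 ≤ δ) (o : X) (s : ℝ) (x : X) :
    ∃ Kx Ox : Set (Boundary X o), MeasurableSet Kx ∧ MeasurableSet Ox ∧ Kx ⊆ Ox ∧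
      (∀ ξ, nearX o s x ξ → ξ ∈ Kx) ∧
      (∀ ξ ∈ Kx, qball (qB o) ξ (Real.exp (-s)) ⊆ Ox ∧
        Ox ⊆ qball (qB o) ξ (Real.exp (-(s - (3 * δ + 3))))) ∧
      (∀ ξ ∈ Ox, nearX o (s - (3 * δ + 3)) x ξ) := by
  by_cases hx : ∃ c, nearX o s x c
  swap
  · refine ⟨∅, ∅, MeasurableSet.empty, MeasurableSet.empty, subset_rfl, ?_, ?_, ?_⟩
    · exact fun ξ hξ => hx ⟨ξ, hξ⟩
    · simp
    · simp
  obtain ⟨c, hc⟩ := hx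
  refine ⟨qball (qB o) c (Real.exp (-(s - δ - 1))), qball (qB o) c (Real.exp (-(s - 2 * δ - 2))),
    MeasurableSpace.measurableSet_generateFrom ⟨_, _, rfl⟩,
    MeasurableSpace.measurableSet_generateFrom ⟨_, _, rfl⟩, ?_, ?_, ?_, ?_⟩
  · intro ξ hξ
    exact lt_of_lt_of_le hξ (Real.exp_le_exp.2 (by linarith))
  · intro ξ hξ
    have := qB_le_of_near hδ (hc.toNear hδ hξ)
    exact this.trans_lt (Real.exp_lt_exp.2 (by linarith))
  · intro ξ hξ
    have h0 := near_of_qB_lt hδ hξ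
    constructor
    · intro ζ hζ
      have h1 := near_of_qB_lt hδ hζ
      have h2 := qB_le_of_near hδ (h0.trans hδ (h1.mono (by linarith)))
      exact h2.trans_lt (Real.exp_lt_exp.2 (by linarith))
    · intro ζ hζ
      have h1 := near_of_qB_lt hδ hζ
      have h2 := qB_le_of_near hδ ((h0.symm.mono (by linarith)).trans hδ h1)
      exact h2.trans_lt (Real.exp_lt_exp.2 (by linarith))
  · intro ξ hξ
    have h1 := near_of_qB_lt hδ hξ
    exact ((hc.mono (by linarith)).trans hδ h1).mono (by linarith)

lemma measurableSet_qball (ξ : Boundary X o) (r : ℝ) : MeasurableSet (qball (qB o) ξ r) :=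
  MeasurableSpace.measurableSet_generateFrom ⟨_, _, rfl⟩

lemma measurableSet_single (ξ : Boundary X o) : MeasurableSet ({ξ} : Set (Boundary X o)) := by
  have : ({ξ} : Set (Boundary X o)) = ⋂ n : ℕ, qball (qB o) ξ (1 / ((n : ℝ) + 1)) := by
    ext η
    simp only [mem_singleton_iff, mem_iInter, qball, mem_setOf_eq]
    constructor
    · rintro rfl n; rw [qB_self]; positivity
    · intro h
      have : qB o ξ η ≤ 0 := ge_of_tendsto' tendsto_one_div_add_atTop_nhds_zero_nat fun n => (h n).le
      exact (qB_eq_zero this).symm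
  rw [this]
  exact MeasurableSet.iInter fun n => measurableSet_qball _ _

end Geo

/-! ### Hausdorff dimension from exact dimensionality -/

section Dim
variable {A : Type*} (q : A → A → ℝ)

lemma qdiam_empty : qdiam q ∅ = 0 := by simp [qdiam]

lemma le_qdiam {E : Set A} {x y : A} (hx : x ∈ E) (hy : y ∈ E) :
    ENNReal.ofReal (q x y) ≤ qdiam q E :=
  le_iSup₂_of_le x hx (le_iSup₂_of_le y hy le_rfl)

lemma qdiam_le {E : Set A} {d : ℝ≥0∞} (h : ∀ x ∈ E, ∀ y ∈ E, ENNReal.ofReal (q x y) ≤ d) :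
    qdiam q E ≤ d := iSup₂_le fun x hx => iSup₂_le fun y hy => h x hx y hy

lemma qHContent_le {α Δ : ℝ} {E : Set A} (c : ℕ → Set A) (h1 : E ⊆ ⋃ i, c i)
    (h2 : ∀ i, qdiam q (c i) ≤ ENNReal.ofReal Δ) :
    qHContent q α Δ E ≤ ∑' i, qdiam q (c i) ^ α :=
  iInf_le_of_le c (iInf_le_of_le h1 (iInf_le _ h2))

lemma qHContent_mono {α Δ : ℝ} {E F : Set A} (h : E ⊆ F) :
    qHContent q α Δ E ≤ qHContent q α Δ F :=
  le_iInf fun c => le_iInf fun h1 => le_iInf fun h2 => qHContent_le q c (h.trans h1) h2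

lemma qHContent_le_finset {ι : Type*} {α Δ : ℝ} (hα : 0 < α) {E : Set A} (F : Finset ι)
    (c : ι → Set A) (h1 : E ⊆ ⋃ x ∈ F, c x)
    (h2 : ∀ x ∈ F, qdiam q (c x) ≤ ENNReal.ofReal Δ) :
    qHContent q α Δ E ≤ ∑ x ∈ F, qdiam q (c x) ^ α := by
  let c' : ℕ → Set A := fun i =>
    if h : i < F.card then c (F.equivFin.symm ⟨i, h⟩) else ∅
  have hc : ∀ i (h : i < F.card), c' i = c (F.equivFin.symm ⟨i, h⟩) := fun i h => dif_pos h
  refine (qHContent_le q c' ?_ ?_).trans ?_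
  · intro y hy
    obtain ⟨x, hx, hyx⟩ := mem_iUnion₂.1 (h1 hy)
    refine mem_iUnion.2 ⟨F.equivFin ⟨x, hx⟩, ?_⟩
    rw [hc _ (F.equivFin ⟨x, hx⟩).2]
    simpa using hyx
  · intro i
    by_cases h : i < F.card
    · rw [hc i h]; exact h2 _ (F.equivFin.symm ⟨i, h⟩).2
    · simp only [c', dif_neg h, qdiam_empty]; exact zero_le
  · rw [tsum_eq_sum (s := Finset.range F.card)]
    · rw [Finset.sum_range fun i => qdiam q (c' i) ^ α, ← F.sum_coe_sort,
        ← F.equivFin.symm.sum_comp]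
      refine le_of_eq (Finset.sum_congr rfl fun i _ => ?_)
      rw [hc i i.2]
    · intro i hi
      have : ¬ i < F.card := by simpa using hi
      simp only [c', dif_neg this, qdiam_empty]
      exact ENNReal.zero_rpow_of_pos hα

lemma qHContent_iUnion_zero {α Δ : ℝ} (E : ℕ → Set A) (h : ∀ n, qHContent q α Δ (E n) = 0) :
    qHContent q α Δ (⋃ n, E n) = 0 := by
  refine le_antisymm ?_ zero_le
  refine le_of_forall_gt fun ε hε => ?_
  obtain ⟨e, he0, he⟩ := ENNReal.exists_pos_sum_of_countable hε.ne' ℕ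
  have : ∀ n, ∃ c : ℕ → Set A, E n ⊆ ⋃ i, c i ∧ (∀ i, qdiam q (c i) ≤ ENNReal.ofReal Δ) ∧
      ∑' i, qdiam q (c i) ^ α < e n := by
    intro n
    have h0 : qHContent q α Δ (E n) < e n := by rw [h n]; exact_mod_cast he0 n
    simp only [qHContent, iInf_lt_iff] at h0
    obtain ⟨c, h1, h2, h3⟩ := h0
    exact ⟨c, h1, h2, h3⟩
  choose c h1 h2 h3 using this
  refine (qHContent_le q (fun k => c k.unpair.1 k.unpair.2) ?_ (fun k => h2 _ _)).trans_lt ?_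
  · intro y hy
    obtain ⟨n, hn⟩ := mem_iUnion.1 hy
    obtain ⟨i, hi⟩ := mem_iUnion.1 (h1 n hn)
    exact mem_iUnion.2 ⟨Nat.pair n i, by simpa using hi⟩
  · have := Nat.pairEquiv.symm.tsum_eq (fun p : ℕ × ℕ => qdiam q (c p.1 p.2) ^ α)
    simp only [Nat.pairEquiv_symm_apply] at this
    rw [this, ENNReal.tsum_prod (f := fun a b => qdiam q (c a b) ^ α)]
    refine lt_of_le_of_lt (ENNReal.tsum_le_tsum fun n => (h3 n).le) he

/-- Box-counting bound. -/
lemma qHMeasure_zero_of_cover {E : Set A} {C1 C2 a b : ℝ} (hb : 0 < b)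
    (hC2 : 0 < C2)
    (h : ∀ᶠ n : ℕ in atTop, ∃ (F : Finset A) (c : A → Set A), E ⊆ ⋃ x ∈ F, c x ∧
      (F.card : ℝ) ≤ C1 * Real.exp (a * n) ∧
      ∀ x ∈ F, qdiam q (c x) ≤ ENNReal.ofReal (C2 * Real.exp (-b * n)))
    {α : ℝ} (hα : 0 < α) (hαa : a < α * b) (Δ : ℝ) (hΔ : 0 < Δ) : qHContent q α Δ E = 0 := by
  have hlim : Tendsto (fun n : ℕ => C1 * C2 ^ α * Real.exp ((a - α * b) * n)) atTop (𝓝 0) := by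
    have : Tendsto (fun n : ℕ => Real.exp ((a - α * b) * n)) atTop (𝓝 0) := by
      apply Real.tendsto_exp_atBot.comp
      exact (tendsto_natCast_atTop_atTop).const_mul_atTop_of_neg (by linarith)
    simpa using this.const_mul (C1 * C2 ^ α)
  have hlim' := ENNReal.tendsto_ofReal hlim
  rw [ENNReal.ofReal_zero] at hlim'
  have hsmall : ∀ᶠ n : ℕ in atTop, C2 * Real.exp (-b * n) ≤ Δ := by
    have : Tendsto (fun n : ℕ => C2 * Real.exp (-b * n)) atTop (𝓝 0) := by
      have : Tendsto (fun n : ℕ => Real.exp (-b * n)) atTop (𝓝 0) := by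
        apply Real.tendsto_exp_atBot.comp
        exact (tendsto_natCast_atTop_atTop).const_mul_atTop_of_neg (by linarith)
      simpa using this.const_mul C2
    exact (this.eventually_lt_const hΔ).mono fun _ h => h.le
  refine le_antisymm (ge_of_tendsto hlim' ?_) zero_le
  filter_upwards [h, hsmall] with n hn hs
  obtain ⟨F, c, h1, h2, h3⟩ := hn
  refine (qHContent_le_finset q hα F c h1
    fun x hx => (h3 x hx).trans (ENNReal.ofReal_le_ofReal hs)).trans ?_
  have : ∀ x ∈ F, qdiam q (c x) ^ α ≤ ENNReal.ofReal ((C2 * Real.exp (-b * n)) ^ α) := by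
    intro x hx
    rw [← ENNReal.ofReal_rpow_of_pos (by positivity)]
    exact ENNReal.rpow_le_rpow (h3 x hx) hα.le
  refine (Finset.sum_le_sum this).trans ?_
  rw [Finset.sum_const, nsmul_eq_mul, ← ENNReal.ofReal_natCast, ← ENNReal.ofReal_mul (by positivity)]
  apply ENNReal.ofReal_le_ofReal
  rw [Real.mul_rpow hC2.le (by positivity), ← Real.exp_mul]
  calc (F.card : ℝ) * (C2 ^ α * Real.exp (-b * n * α))
      ≤ (C1 * Real.exp (a * n)) * (C2 ^ α * Real.exp (-b * n * α)) := by gcongr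
    _ = C1 * C2 ^ α * (Real.exp (a * n) * Real.exp (-b * n * α)) := by ring
    _ = _ := by rw [← Real.exp_add]; ring_nf

lemma qdimSet_nonneg (E : Set A) : 0 ≤ qdimSet q E :=
  Real.sSup_nonneg fun _ h => h.1

variable [MeasurableSpace A]

/-- The mass distribution principle. -/
lemma mass_distribution (m : Measure A) {D : ℝ}
    (hex : ∀ᵐ ξ ∂m, Tendsto (fun r : ℝ => Real.log (m (qball q ξ r)).toReal / Real.log r)
      (nhdsWithin 0 (Set.Ioi 0)) (nhds D)) [IsFiniteMeasure m]
    {E : Set A} (hE : 0 < m E) {α : ℝ} (hα : 0 ≤ α) (hαD : α < D) : 0 < qHMeasure q α E := by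
  have key : ∃ Δ : ℝ, 0 < Δ ∧ 0 < qHContent q α Δ E := by
    rcases hα.eq_or_lt with rfl | hα
    · refine ⟨1, one_pos, ?_⟩
      refine lt_of_lt_of_le one_pos (le_iInf fun c => le_iInf fun _ => le_iInf fun _ => ?_)
      refine le_trans ?_ (ENNReal.le_tsum 0)
      simp
    let E' : ℕ → Set A := fun k => {ξ | ξ ∈ E ∧ ∀ r : ℝ, 0 < r → r < 1 / ((k : ℝ) + 1) →
      m (qball q ξ r) ≤ ENNReal.ofReal (r ^ α)}
    have hE' : ∃ k, 0 < m (E' k) := by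
      by_contra hcon
      push Not at hcon
      have h0 : m (⋃ k, E' k) = 0 := measure_iUnion_null fun k => le_antisymm (hcon k) zero_le
      have : E ≤ᵐ[m] (⋃ k, E' k : Set A) := by
        filter_upwards [hex] with ξ hξ hξE
        have h1 := hξ.eventually_const_lt hαD
        have h2 : ∀ᶠ r : ℝ in 𝓝[>] 0, r < 1 :=
          (eventually_lt_nhds one_pos).filter_mono nhdsWithin_le_nhds
        obtain ⟨u, hu0, hu⟩ := (mem_nhdsGT_iff_exists_Ioo_subset).1 (h1.and h2)
        obtain ⟨k, hk⟩ := exists_nat_one_div_lt (mem_Ioi.1 hu0)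
        refine mem_iUnion.2 ⟨k, hξE, fun r hr0 hrk => ?_⟩
        obtain ⟨hlt, hr1⟩ := hu ⟨hr0, hrk.trans hk⟩
        have hlog : Real.log r < 0 := Real.log_neg hr0 hr1
        rcases eq_or_ne (m (qball q ξ r)) 0 with hz | hz
        · rw [hz]; exact zero_le
        have hpos : 0 < (m (qball q ξ r)).toReal :=
          ENNReal.toReal_pos hz (measure_ne_top _ _)
        rw [lt_div_iff_of_neg hlog] at hlt
        rw [← ENNReal.ofReal_toReal (measure_ne_top m (qball q ξ r))]
        apply ENNReal.ofReal_le_ofReal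
        rw [← Real.log_le_log_iff hpos (by positivity), Real.log_rpow hr0]
        exact hlt.le
      exact hE.ne' (le_antisymm ((measure_mono_ae this).trans h0.le) zero_le)
    obtain ⟨k, hk⟩ := hE'
    set Δ : ℝ := 1 / ((k : ℝ) + 1) / 4 with hΔ
    have hk1 : (0 : ℝ) < 1 / ((k : ℝ) + 1) := by positivity
    refine ⟨Δ, by positivity, ?_⟩
    have hlow : m (E' k) / ENNReal.ofReal (2 ^ α) ≤ qHContent q α Δ E := by
      refine le_iInf fun c => le_iInf fun h1 => le_iInf fun h2 => ?_
      rw [ENNReal.div_le_iff (by simp; positivity) (by simp), ← ENNReal.tsum_mul_right]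
      have hsub : E' k ⊆ ⋃ i, (c i ∩ E' k) := by
        intro y hy
        obtain ⟨i, hi⟩ := mem_iUnion.1 (h1 hy.1)
        exact mem_iUnion.2 ⟨i, hi, hy⟩
      refine (measure_mono hsub).trans ((measure_iUnion_le _).trans
        (ENNReal.tsum_le_tsum fun i => ?_))
      rcases (c i ∩ E' k).eq_empty_or_nonempty with he | ⟨ξ, hξc, hξE⟩
      · rw [he]; simp
      set d := (qdiam q (c i)).toReal with hd
      have hfin : qdiam q (c i) ≠ ∞ := ((h2 i).trans_lt ENNReal.ofReal_lt_top).ne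
      have hdd : qdiam q (c i) = ENNReal.ofReal d := (ENNReal.ofReal_toReal hfin).symm
      have hdΔ : d ≤ Δ := by
        have := h2 i
        rw [hdd] at this
        exact (ENNReal.ofReal_le_ofReal_iff (by positivity)).1 this
      have hd0 : 0 ≤ d := ENNReal.toReal_nonneg
      have hsub2 : ∀ r : ℝ, d < r → c i ⊆ qball q ξ r := by
        intro r hr y hy
        have := le_qdiam q hξc hy
        rw [hdd, ENNReal.ofReal_le_ofReal_iff hd0] at this
        exact this.trans_lt hr
      rcases hd0.eq_or_lt with h0 | h0
      · have hlim : Tendsto (fun r : ℝ => ENNReal.ofReal (r ^ α)) (𝓝[>] 0) (𝓝 0) := by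
          have h3 : Tendsto (fun r : ℝ => r ^ α) (𝓝[>] 0) (𝓝 0) := by
            have := (Real.continuousAt_rpow_const 0 α (Or.inr hα.le)).tendsto
            rw [Real.zero_rpow hα.ne'] at this
            exact this.mono_left nhdsWithin_le_nhds
          simpa using ENNReal.tendsto_ofReal h3
        refine le_trans (ge_of_tendsto hlim ?_) zero_le
        filter_upwards [Ioo_mem_nhdsGT hk1] with r hr
        exact (measure_mono (inter_subset_left.trans (hsub2 r (h0 ▸ hr.1)))).trans
          (hξE.2 r hr.1 hr.2)
      · refine (measure_mono (inter_subset_left.trans (hsub2 (2 * d) (by linarith)))).trans ?_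
        refine (hξE.2 (2 * d) (by linarith) (by rw [hΔ] at hdΔ; linarith)).trans ?_
        rw [hdd, ENNReal.ofReal_rpow_of_pos h0, ← ENNReal.ofReal_mul (by positivity),
          Real.mul_rpow (by norm_num) hd0, mul_comm]
    exact lt_of_lt_of_le (ENNReal.div_pos hk.ne' (by simp)) hlow
  obtain ⟨Δ, h1, h2⟩ := key
  exact lt_of_lt_of_le h2 (le_iSup₂_of_le Δ h1 le_rfl)

/-- Covering of the set where balls have large mass. -/
lemma cover_of_mass (m : Measure A) [IsProbabilityMeasure m]
    (hball : ∀ x r, MeasurableSet (qball q x r)) (hself : ∀ x, q x x = 0)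
    {C : ℝ} (hC : 1 ≤ C)
    (hq : ∀ x y z r, 0 < r → q x z < r → q y z < r → q x y ≤ C * r)
    (E : Set A) (r t : ℝ) (hr : 0 < r) (ht : 0 < t)
    (hE : ∀ x ∈ E, ENNReal.ofReal t ≤ m (qball q x r)) :
    ∃ (F : Finset A) (c : A → Set A), E ⊆ ⋃ x ∈ F, c x ∧ (F.card : ℝ) ≤ 1 / t ∧
      ∀ x ∈ F, qdiam q (c x) ≤ ENNReal.ofReal (2 * C ^ 2 * r) := by
  have hcard : ∀ F : Finset A, (∀ x ∈ F, x ∈ E) →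
      (F : Set A).PairwiseDisjoint (fun x => qball q x r) → (F.card : ℝ) ≤ 1 / t := by
    intro F hF hd
    have h1 : (F.card : ℝ≥0∞) * ENNReal.ofReal t ≤ 1 := by
      calc (F.card : ℝ≥0∞) * ENNReal.ofReal t = ∑ x ∈ F, ENNReal.ofReal t := by simp
        _ ≤ ∑ x ∈ F, m (qball q x r) := Finset.sum_le_sum fun x hx => hE x (hF x hx)
        _ = m (⋃ x ∈ F, qball q x r) :=
            (measure_biUnion_finset hd fun x _ => hball x r).symm
        _ ≤ 1 := prob_le_one
    rw [← ENNReal.ofReal_natCast, ← ENNReal.ofReal_mul (by positivity),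
      ENNReal.ofReal_le_one] at h1
    rwa [le_div_iff₀ ht]
  let S : Set ℕ := {k | ∃ F : Finset A, (∀ x ∈ F, x ∈ E) ∧
      (F : Set A).PairwiseDisjoint (fun x => qball q x r) ∧ F.card = k}
  have hS : S.Nonempty := ⟨0, ∅, by simp, by simp, rfl⟩
  have hSb : BddAbove S := by
    refine ⟨⌈1 / t⌉₊, ?_⟩
    rintro k ⟨F, h1, h2, rfl⟩
    exact_mod_cast (hcard F h1 h2).trans (Nat.le_ceil _)
  obtain ⟨F, h1, h2, h3⟩ := Nat.sSup_mem hS hSb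
  refine ⟨F, fun x => {y | q y x ≤ C * r}, ?_, hcard F h1 h2, ?_⟩
  · intro y hy
    by_contra hcon
    have hcon' : ∀ x ∈ F, ¬ q y x ≤ C * r := by
      intro x hx h; exact hcon (mem_iUnion₂.2 ⟨x, hx, h⟩)
    have hyF : y ∉ F := fun h => hcon' y h (by rw [hself]; positivity)
    have : (insert y F).card ∈ S := by
      refine ⟨insert y F, ?_, ?_, rfl⟩
      · intro x hx
        rcases Finset.mem_insert.1 hx with rfl | hx
        · exact hy
        · exact h1 x hx
      · rw [Finset.coe_insert]
        refine h2.insert_of_notMem hyF fun x hx => ?_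
        rw [Set.disjoint_left]
        intro z hz1 hz2
        exact hcon' x hx (hq y x z r hr hz1 hz2)
    have h4 := le_csSup hSb this
    rw [Finset.card_insert_of_notMem hyF, h3] at h4
    omega
  · intro x hx
    refine qdiam_le q fun y hy z hz => ENNReal.ofReal_le_ofReal ?_
    have hCr : C * r < 2 * C * r := by nlinarith
    have := hq y z x (2 * C * r) (by positivity) (lt_of_le_of_lt hy hCr) (lt_of_le_of_lt hz hCr)
    nlinarith

theorem hasDim_of_exactDim (m : Measure A) [IsProbabilityMeasure m] {D : ℝ}
    (hball : ∀ x r, MeasurableSet (qball q x r)) (hself : ∀ x, q x x = 0)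
    {C : ℝ} (hC : 1 ≤ C)
    (hq : ∀ x y z r, 0 < r → q x z < r → q y z < r → q x y ≤ C * r)
    (hfd : ∃ α0 : ℝ, ∀ α, α0 < α → qHMeasure q α univ = 0)
    (hpos : ∀ᵐ ξ ∂m, ∀ r : ℝ, 0 < r → 0 < m (qball q ξ r))
    (hex : ExactDim q m D) : HasDim q m D := by
  obtain ⟨α0, hα0⟩ := hfd
  have hmonoH : ∀ (α : ℝ) (E F : Set A), E ⊆ F → qHMeasure q α E ≤ qHMeasure q α F :=
    fun α E F h => iSup₂_mono fun _ _ => qHContent_mono q h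
  have hbdd : ∀ E : Set A, BddAbove {α : ℝ | 0 ≤ α ∧ 0 < qHMeasure q α E} := by
    intro E
    refine ⟨α0, fun α hα => ?_⟩
    by_contra h
    have := hmonoH α E univ (subset_univ _)
    rw [hα0 α (not_le.1 h)] at this
    exact absurd hα.2 (not_lt.2 this)
  have hD0 : 0 ≤ D := by
    obtain ⟨ξ, hξ⟩ := hex.exists
    refine ge_of_tendsto hξ ?_
    have h2 : ∀ᶠ r : ℝ in 𝓝[>] 0, r < 1 :=
      (eventually_lt_nhds one_pos).filter_mono nhdsWithin_le_nhds
    filter_upwards [h2, self_mem_nhdsWithin] with r hr1 hr0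
    refine div_nonneg_of_nonpos (Real.log_nonpos ENNReal.toReal_nonneg ?_)
      (Real.log_nonpos (le_of_lt hr0) hr1.le)
    exact ENNReal.toReal_le_of_le_ofReal zero_le_one (by simpa using prob_le_one)
  have hlower : ∀ E : Set A, 0 < m E → D ≤ qdimSet q E := by
    intro E hE
    refine le_of_forall_lt fun α hα => ?_
    rcases lt_or_ge α 0 with h | h
    · exact h.trans_le (qdimSet_nonneg q E)
    · obtain ⟨β, h1, h2⟩ := exists_between hα
      exact h1.trans_le (le_csSup (hbdd E) ⟨h.trans h1.le, mass_distribution q m hex hE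
        (h.trans h1.le) h2⟩)
  obtain ⟨E0, hE0sub, hE0m, hE0⟩ : ∃ E0 : Set A,
      (∀ ξ ∈ E0, (∀ r : ℝ, 0 < r → 0 < m (qball q ξ r)) ∧
        Tendsto (fun r : ℝ => Real.log (m (qball q ξ r)).toReal / Real.log r)
          (nhdsWithin 0 (Set.Ioi 0)) (nhds D)) ∧ MeasurableSet E0 ∧ m E0ᶜ = 0 := by
    obtain ⟨Z, h1, h2, h3⟩ := exists_measurable_superset_of_null (hpos.and hex)
    refine ⟨Zᶜ, fun ξ hξ => ?_, h2.compl, by rwa [compl_compl]⟩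
    by_contra hcon
    exact hξ (h1 hcon)
  have hupper : qdimSet q E0 ≤ D := by
    refine Real.sSup_le (fun α hα => ?_) hD0
    by_contra hcon
    push Not at hcon
    refine hα.2.ne' ?_
    have hαpos : 0 < α := hD0.trans_lt hcon
    obtain ⟨β, hDβ, hβα⟩ := exists_between hcon
    let E' : ℕ → Set A := fun k => {ξ | ∀ n : ℕ, k ≤ n →
      ENNReal.ofReal (Real.exp (-(β * n))) ≤ m (qball q ξ (Real.exp (-n)))}
    have hsub : E0 ⊆ ⋃ k, E' k := by
      intro ξ hξ
      obtain ⟨hp, ht⟩ := hE0sub ξ hξ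
      have hexp : Tendsto (fun n : ℕ => Real.exp (-(n : ℝ))) atTop (𝓝[>] 0) := by
        refine tendsto_nhdsWithin_iff.2 ⟨?_, Eventually.of_forall fun n => Real.exp_pos _⟩
        exact Real.tendsto_exp_atBot.comp (tendsto_neg_atTop_atBot.comp tendsto_natCast_atTop_atTop)
      have h1 := (ht.comp hexp).eventually_lt_const hDβ
      obtain ⟨k, hk⟩ := eventually_atTop.1 (h1.and (eventually_gt_atTop 0))
      refine mem_iUnion.2 ⟨k, fun n hn => ?_⟩
      obtain ⟨hlt, hn0⟩ := hk n hn
      have hn0' : (0 : ℝ) < n := by exact_mod_cast hn0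
      simp only [Function.comp, Real.log_exp] at hlt
      rw [div_lt_iff_of_neg (by linarith)] at hlt
      have hpp : 0 < (m (qball q ξ (Real.exp (-n)))).toReal :=
        ENNReal.toReal_pos (hp _ (Real.exp_pos _)).ne' (measure_ne_top _ _)
      rw [← ENNReal.ofReal_toReal (measure_ne_top m (qball q ξ (Real.exp (-n))))]
      apply ENNReal.ofReal_le_ofReal
      rw [← Real.le_log_iff_exp_le hpp]
      linarith
    refine le_antisymm (iSup₂_le fun Δ hΔ => ?_) zero_le
    refine (qHContent_mono q hsub).trans (qHContent_iUnion_zero q _ fun k => ?_).le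
    refine qHMeasure_zero_of_cover q (C1 := 1) (C2 := 2 * C ^ 2) (a := β) (b := 1) one_pos
      (by positivity) ?_ hαpos (by linarith) Δ hΔ
    filter_upwards [eventually_ge_atTop k] with n hn
    obtain ⟨F, c, h1, h2, h3⟩ := cover_of_mass q m hball hself hC hq (E' k) (Real.exp (-n))
      (Real.exp (-(β * n))) (Real.exp_pos _) (Real.exp_pos _) (fun x hx => hx n hn)
    refine ⟨F, c, h1, ?_, ?_⟩
    · rw [one_mul]
      rwa [one_div, ← Real.exp_neg, neg_neg] at h2
    · simpa using h3
  have hmE0 : 0 < m E0 := by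
    have : m E0 = 1 := (prob_compl_eq_zero_iff hE0m).1 hE0
    rw [this]; exact one_pos
  have hE0D : qdimSet q E0 = D := le_antisymm hupper (hlower E0 hmE0)
  constructor
  · refine le_antisymm ?_ ?_
    · refine le_trans ?_ hupper
      refine csInf_le ⟨0, ?_⟩ ⟨E0, hE0m, hE0, rfl⟩
      rintro d ⟨E, -, -, rfl⟩
      exact qdimSet_nonneg q E
    · refine le_csInf ⟨_, E0, hE0m, hE0, rfl⟩ ?_
      rintro d ⟨E, hEm, hE, rfl⟩
      refine hlower E ?_
      have : m E = 1 := (prob_compl_eq_zero_iff hEm).1 hE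
      rw [this]; exact one_pos
  · refine le_antisymm ?_ ?_
    · refine le_trans ?_ hupper
      refine csInf_le ⟨0, ?_⟩ ⟨E0, hE0m, hmE0, rfl⟩
      rintro d ⟨E, -, -, rfl⟩
      exact qdimSet_nonneg q E
    · refine le_csInf ⟨_, E0, hE0m, hmE0, rfl⟩ ?_
      rintro d ⟨E, hEm, hE, rfl⟩
      exact hlower E hE

end Dim

/-! ### Counting and finite dimension -/

section Cnt
variable {G : Type*} [Group G]

/-- `L` is a word in the symmetrised set `S`. -/
def IsWord (S : Set G) (L : List G) : Prop := ∀ s ∈ L, s ∈ S ∨ s⁻¹ ∈ S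

lemma wordLength_le {S : Set G} {L : List G} (h : IsWord S L) : wordLength S L.prod ≤ L.length := by
  apply Nat.sInf_le
  exact ⟨fun i => L.get i, fun i => h _ (List.get_mem _ _), by rw [List.ofFn_get]⟩

lemma exists_word {S : Set G} (hS : Subgroup.closure S = ⊤) (g : G) :
    ∃ L : List G, IsWord S L ∧ L.prod = g ∧ L.length = wordLength S g := by
  have hne : {n : ℕ | ∃ f : Fin n → G, (∀ i, f i ∈ S ∨ (f i)⁻¹ ∈ S) ∧
      g = (List.ofFn f).prod}.Nonempty := by
    have hg : g ∈ Subgroup.closure S := by rw [hS]; trivial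
    open scoped Pointwise in
    have hg' : g ∈ Submonoid.closure (S ∪ S⁻¹) := by
      rw [← Subgroup.closure_toSubmonoid]; exact hg
    obtain ⟨L, hL, hp⟩ := Submonoid.exists_list_of_mem_closure hg'
    exact ⟨L.length, fun i => L.get i, fun i => hL _ (List.get_mem _ _), by
      rw [List.ofFn_get, hp]⟩
  obtain ⟨f, hf, hg⟩ := Nat.sInf_mem hne
  refine ⟨List.ofFn f, ?_, hg.symm, by rw [List.length_ofFn]; rfl⟩
  intro s hs
  rw [List.mem_ofFn] at hs
  obtain ⟨i, rfl⟩ := hs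
  exact hf i

lemma growth [MetricSpace G] (h : IsQIToWordMetric G) : ∃ A : ℝ, 0 ≤ A ∧ ∀ R : ℝ, 0 ≤ R →
    ∃ F : Finset G, (∀ x, dist 1 x ≤ R → x ∈ F) ∧ (F.card : ℝ) ≤ Real.exp (A * (R + 1)) := by
  classical
  obtain ⟨S, hS, Λ, c, hΛ, hc, hd⟩ := h
  open scoped Pointwise in
  let T : Finset G := insert 1 (S ∪ S⁻¹)
  have hT1 : (1 : G) ∈ T := Finset.mem_insert_self _ _
  have hTc : 1 ≤ T.card := Finset.card_pos.2 ⟨1, hT1⟩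
  have hlog : 0 ≤ Real.log T.card := Real.log_nonneg (by exact_mod_cast hTc)
  open scoped Pointwise in
  have hword : ∀ L : List G, IsWord (S : Set G) L → L.prod ∈ T ^ L.length := by
    intro L
    induction L with
    | nil => intro _; simp
    | cons a L ih =>
      intro hL
      rw [List.prod_cons, List.length_cons, pow_succ']
      refine Finset.mul_mem_mul ?_ (ih fun s hs => hL s (List.mem_cons_of_mem _ hs))
      have := hL a (List.mem_cons_self)
      simp only [T, Finset.mem_insert, Finset.mem_union, Finset.mem_inv']
      simp only [Finset.mem_coe] at this
      tauto
  refine ⟨Real.log T.card * Λ * (1 + c), by positivity, fun R hR => ?_⟩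
  open scoped Pointwise in
  refine ⟨T ^ ⌊Λ * (R + c)⌋₊, fun x hx => ?_, ?_⟩
  · obtain ⟨L, hL, rfl, hlen⟩ := exists_word hS x
    refine Finset.pow_subset_pow_right hT1 ?_ (hword L hL)
    rw [hlen]
    apply Nat.le_floor
    have := (hd L.prod).1
    have h1 : (wordLength (S : Set G) L.prod : ℝ) / Λ ≤ R + c := by linarith
    rw [div_le_iff₀ (by linarith)] at h1
    linarith
  · have h1 : ((T ^ ⌊Λ * (R + c)⌋₊).card : ℝ) ≤ (T.card : ℝ) ^ ⌊Λ * (R + c)⌋₊ := by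
      exact_mod_cast Finset.card_pow_le
    refine h1.trans ?_
    rw [← Real.rpow_natCast, Real.rpow_def_of_pos (by exact_mod_cast hTc)]
    apply Real.exp_le_exp.2
    have h2 : (⌊Λ * (R + c)⌋₊ : ℝ) ≤ Λ * (R + c) := Nat.floor_le (by positivity)
    have h3 : Λ * (R + c) ≤ Λ * (1 + c) * (R + 1) := by
      rw [mul_assoc]
      apply mul_le_mul_of_nonneg_left _ (by linarith)
      nlinarith
    calc Real.log T.card * ⌊Λ * (R + c)⌋₊ ≤ Real.log T.card * (Λ * (1 + c) * (R + 1)) :=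
          mul_le_mul_of_nonneg_left (h2.trans h3) hlog
      _ = _ := by ring

lemma gp_lower {X : Type*} [MetricSpace X] (o x y : X) : dist o x - dist x y ≤ gp o x y := by
  have := dist_triangle o y x
  rw [dist_comm y x] at this
  simp only [gp, dist_comm x o]; linarith

lemma divSeq_dist {X : Type*} [MetricSpace X] {o : X} (u : DivSeq X o) (R : ℝ) :
    ∃ N, ∀ n, N ≤ n → R < dist o (u.1 n) := by
  obtain ⟨N, hN⟩ := ev_pair.1 (u.2.eventually_gt_atTop R)
  refine ⟨N, fun n hn => ?_⟩
  have := hN n n hn hn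
  simp only [gp, dist_self, dist_comm (u.1 n) o] at this
  linarith

lemma exists_path [MetricSpace G] (hG : IsHypGroupMetric G) : ∃ a B b R: ℝ, 0 < a ∧ 0 ≤ B ∧
    0 ≤ R ∧ ∀ (n : ℕ) (g : G), R * (n + 1) < dist 1 g →
      ∃ x, dist 1 x ≤ B * (n + 1) ∧ a * n - b ≤ gp 1 x g := by
  obtain ⟨hinv, ⟨δ, hδ0, hδ⟩, S, hS, Λ, c, hΛ, hc, hd⟩ := hG
  obtain ⟨K, hK⟩ := exists_nat_gt (Λ * (δ + 1))
  have hK0 : (0 : ℝ) < K := lt_of_le_of_lt (by positivity) hK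
  have hKn : 0 < K := by exact_mod_cast hK0
  have hΛ0 : 0 < Λ := by linarith
  refine ⟨K / Λ, Λ * K + c, c + (Λ * K + c) + δ, Λ * K + c, by positivity, by positivity,
    by positivity, fun n g hg => ?_⟩
  obtain ⟨L, hL, rfl, hlen⟩ := exists_word hS g
  set k := L.length with hk
  have hkn : n * K < k := by
    have h1 := (hd L.prod).2
    rw [← hlen] at h1
    have h2 : Λ * ((n : ℝ) * K) + c < Λ * k + c := by
      have : (0 : ℝ) ≤ Λ * K + c * n := by positivity
      nlinarith
    have h3 : (n : ℝ) * K < k := by nlinarith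
    exact_mod_cast h3
  let z : ℕ → G := fun i => (L.take (i * K)).prod
  have hwt : ∀ i, IsWord (S : Set G) (L.take i) := fun i s hs => hL s (List.mem_of_mem_take hs)
  have hz1 : ∀ i, dist 1 (z i) ≤ Λ * (i * K) + c := by
    intro i
    refine (hd _).2.trans ?_
    have : (wordLength (S : Set G) (z i) : ℝ) ≤ i * K := by
      exact_mod_cast (wordLength_le (hwt (i * K))).trans (by simp)
    have := mul_le_mul_of_nonneg_left this hΛ0.le
    linarith
  have hz2 : ∀ i, i * K ≤ k → (i : ℝ) * K / Λ - c ≤ dist 1 (z i) := by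
    intro i hi
    refine le_trans ?_ (hd _).1
    obtain ⟨L', hL', hp', hl'⟩ := exists_word hS (z i)
    have h1 : wordLength (S : Set G) L.prod ≤ (L' ++ L.drop (i * K)).length := by
      have : L.prod = (L' ++ L.drop (i * K)).prod := by
        rw [List.prod_append, hp', List.prod_take_mul_prod_drop]
      rw [this]
      apply wordLength_le
      intro s hs
      rcases List.mem_append.1 hs with hs | hs
      · exact hL' s hs
      · exact hL s (List.mem_of_mem_drop hs)
    rw [List.length_append, List.length_drop, ← hlen, hl'] at h1
    have h2 : i * K ≤ wordLength (S : Set G) (z i) := by omega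
    have h3 : (i : ℝ) * K ≤ wordLength (S : Set G) (z i) := by exact_mod_cast h2
    have := div_le_div_of_nonneg_right h3 hΛ0.le
    linarith
  have hz3 : ∀ i, dist (z i) (z (i + 1)) ≤ Λ * K + c := by
    intro i
    have e : z (i + 1) = z i * ((L.drop (i * K)).take K).prod := by
      simp only [z]
      rw [← List.prod_append]
      congr 1
      rw [add_mul, one_mul, List.take_add]
    have : dist (z i) (z (i + 1)) = dist 1 ((L.drop (i * K)).take K).prod := by
      rw [e]
      conv_lhs => rw [← mul_one (z i), mul_assoc, hinv, one_mul]
    rw [this]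
    refine (hd _).2.trans ?_
    have : (wordLength (S : Set G) ((L.drop (i * K)).take K).prod : ℝ) ≤ K := by
      suffices hh : wordLength (S : Set G) ((L.drop (i * K)).take K).prod ≤ K by exact_mod_cast hh
      refine (wordLength_le ?_).trans (by simp)
      intro s hs
      exact hL s (List.mem_of_mem_drop (List.mem_of_mem_take hs))
    have := mul_le_mul_of_nonneg_left this hΛ0.le
    linarith
  obtain ⟨M, hM1, hM2⟩ : ∃ M, k ≤ M * K ∧ ∀ i, i < M → i * K < k := by
    have hex : ∃ M, k ≤ M * K := ⟨k, Nat.le_mul_of_pos_right _ hKn⟩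
    refine ⟨Nat.find hex, Nat.find_spec hex, fun i hi => ?_⟩
    have := Nat.find_min hex hi
    omega
  have hnM : n < M := by
    by_contra h
    have := Nat.mul_le_mul_right K (not_lt.1 h)
    omega
  refine ⟨z n, ?_, ?_⟩
  · refine (hz1 n).trans ?_
    have : (0 : ℝ) ≤ Λ * K + c * n := by positivity
    nlinarith
  · have hch := chain_gp (o := (1 : G)) hδ hδ0 z (K / Λ) (c + (Λ * K + c)) (by
      rw [le_div_iff₀ hΛ0]; nlinarith) 0 M (fun i _ hi => by
        have h1 := hz2 i (hM2 i hi).le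
        have h2 := hz3 i
        have h3 := gp_lower (1 : G) (z i) (z (i + 1))
        have e : (K : ℝ) / Λ * i = i * K / Λ := by ring
        rw [e]; linarith) (M - n - 1) n (Nat.zero_le _) (by omega)
    have e : z (n + 1 + (M - n - 1)) = L.prod := by
      have : n + 1 + (M - n - 1) = M := by omega
      simp only [z, this]
      rw [List.take_of_length_le hM1]
    rw [e] at hch
    linarith

lemma exists_cover [MetricSpace G] (hG : IsHypGroupMetric G) : ∃ a B b : ℝ, 0 < a ∧ 0 ≤ B ∧
    ∀ (n : ℕ) (ξ : Boundary G (1 : G)), ∃ x, dist 1 x ≤ B * (n + 1) ∧ nearX 1 (a * n - b) x ξ := by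
  obtain ⟨a, B, b, R, ha, hB, hR, h⟩ := exists_path hG
  obtain ⟨hinv, ⟨δ, hδ0, hδ⟩, hqi⟩ := hG
  obtain ⟨A, hA, hgr⟩ := growth hqi
  refine ⟨a, B, b + 1 + δ, ha, hB, fun n ξ => ?_⟩
  obtain ⟨u, rfl⟩ := exists_rep 1 ξ
  obtain ⟨N, hN⟩ := divSeq_dist u (R * (n + 1))
  obtain ⟨F, hF, -⟩ := hgr (B * (n + 1)) (by positivity)
  have hfr : ∃ x ∈ F, dist 1 x ≤ B * (n + 1) ∧ ∃ᶠ m in atTop, a * n - b - 1 < gp 1 x (u.1 m) := by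
    by_contra hcon
    push Not at hcon
    have : ∀ᶠ m in atTop, ∀ x ∈ F, dist 1 x ≤ B * (n + 1) → ¬ (a * n - b - 1 < gp 1 x (u.1 m)) := by
      rw [Filter.eventually_all_finset]
      intro x hx
      by_cases hd : dist 1 x ≤ B * (n + 1)
      · have := hcon x hx hd
        filter_upwards [this] with m hm _ using not_lt.2 hm
      · exact Eventually.of_forall fun m h => absurd h hd
    obtain ⟨m, hm1, hm2⟩ := (this.and (eventually_ge_atTop N)).exists
    obtain ⟨x, hx1, hx2⟩ := h n (u.1 m) (hN m hm2)
    exact hm1 x (hF x hx1) hx1 (by linarith)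
  obtain ⟨x, -, hx, hf⟩ := hfr
  exact ⟨x, hx, (nearX_of_frequently hδ u hf).mono (by linarith)⟩

theorem finite_dim {H : Type*} [Group H] [MetricSpace G] [MetricSpace H] (hG : IsHypGroupMetric G)
    (hH : IsHypGroupMetric H) :
    ∃ α0 : ℝ, ∀ α, α0 < α → qHMeasure (qbb (1 : G) (1 : H)) α univ = 0 := by
  obtain ⟨a, B, b, ha, hB, hc⟩ := exists_cover hG
  obtain ⟨a', B', b', ha', hB', hc'⟩ := exists_cover hH
  obtain ⟨hinv, ⟨δ, hδ0, hδ⟩, hqi⟩ := hG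
  obtain ⟨hinv', ⟨δ', hδ0', hδ'⟩, hqi'⟩ := hH
  obtain ⟨A, hA, hgr⟩ := growth hqi
  obtain ⟨A', hA', hgr'⟩ := growth hqi'
  set m := min a a' with hm
  have hm0 : 0 < m := lt_min ha ha'
  set Q := A * B + A' * B' with hQ
  have hQ0 : 0 ≤ Q := by positivity
  refine ⟨max 0 (Q / m), fun α hα => ?_⟩
  refine le_antisymm (iSup₂_le fun Δ hΔ => ?_) zero_le
  refine le_of_eq ?_
  have hα0 : 0 < α := (le_max_left _ _).trans_lt hα
  have hα1 : Q < α * m := by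
    have := (le_max_right _ _).trans_lt hα
    rwa [div_lt_iff₀ hm0] at this
  refine qHMeasure_zero_of_cover _ (C1 := Real.exp (A * (B + 1) + A' * (B' + 1)))
    (C2 := Real.exp (b + 2 * δ) + Real.exp (b' + 2 * δ')) (a := Q) (b := m) hm0 (by positivity) ?_
    hα0 hα1 Δ hΔ
  refine Eventually.of_forall fun n => ?_
  obtain ⟨F, hF, hFc⟩ := hgr (B * (n + 1)) (by positivity)
  obtain ⟨F', hF', hFc'⟩ := hgr' (B' * (n + 1)) (by positivity)
  let c : G × H → Set (Boundary G (1 : G) × Boundary H (1 : H)) := fun xy =>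
    {z | nearX 1 (a * n - b) xy.1 z.1 ∧ nearX 1 (a' * n - b') xy.2 z.2}
  by_cases hne : Nonempty (Boundary G (1 : G) × Boundary H (1 : H))
  swap
  · refine ⟨∅, fun _ => ∅, ?_, ?_, ?_⟩
    · intro z; exact absurd ⟨z⟩ hne
    · simp; positivity
    · simp
  let pt : G × H → Boundary G (1 : G) × Boundary H (1 : H) := fun xy =>
    if h : (c xy).Nonempty then h.some else Classical.arbitrary _
  refine ⟨(F ×ˢ F').image pt, fun z0 => {z | near 1 (a * n - b - δ) z.1 z0.1 ∧
    near 1 (a' * n - b' - δ') z.2 z0.2}, ?_, ?_, ?_⟩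
  · rintro z -
    obtain ⟨x, hx1, hx2⟩ := hc n z.1
    obtain ⟨y, hy1, hy2⟩ := hc' n z.2
    have hcne : (c (x, y)).Nonempty := ⟨z, hx2, hy2⟩
    have hpt : pt (x, y) ∈ c (x, y) := by
      simp only [pt, dif_pos hcne]; exact hcne.some_mem
    refine mem_iUnion₂.2 ⟨pt (x, y), Finset.mem_image_of_mem _
      (Finset.mem_product.2 ⟨hF x hx1, hF' y hy1⟩), ?_, ?_⟩
    · exact nearX.toNear hδ hx2 hpt.1
    · exact nearX.toNear hδ' hy2 hpt.2
  · have h1 : (((F ×ˢ F').image pt).card : ℝ) ≤ (F.card : ℝ) * F'.card := by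
      have := (Finset.card_image_le (s := F ×ˢ F') (f := pt))
      rw [Finset.card_product] at this
      exact_mod_cast this
    refine h1.trans ((mul_le_mul hFc hFc' (by positivity) (by positivity)).trans ?_)
    rw [← Real.exp_add, ← Real.exp_add, Real.exp_le_exp]
    rw [hQ]; nlinarith
  · intro z0 _
    apply qdiam_le
    rintro z ⟨h1, h2⟩ w ⟨h3, h4⟩
    apply ENNReal.ofReal_le_ofReal
    have hn0 : (0 : ℝ) ≤ n := Nat.cast_nonneg n
    have e1 := qB_le_of_near hδ (h1.trans hδ h3.symm)
    have e2 := qB_le_of_near hδ' (h2.trans hδ' h4.symm)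
    have hma : m * n ≤ a * n := mul_le_mul_of_nonneg_right (min_le_left _ _) hn0
    have hma' : m * n ≤ a' * n := mul_le_mul_of_nonneg_right (min_le_right _ _) hn0
    refine max_le (e1.trans ?_) (e2.trans ?_)
    · calc Real.exp (-(a * n - b - δ - δ)) ≤ Real.exp ((b + 2 * δ) + (-m * n)) := by
            apply Real.exp_le_exp.2; linarith
        _ = Real.exp (b + 2 * δ) * Real.exp (-m * n) := Real.exp_add _ _
        _ ≤ _ := by
            apply mul_le_mul_of_nonneg_right _ (Real.exp_pos _).le
            linarith [Real.exp_pos (b' + 2 * δ')]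
    · calc Real.exp (-(a' * n - b' - δ' - δ')) ≤ Real.exp ((b' + 2 * δ') + (-m * n)) := by
            apply Real.exp_le_exp.2; linarith
        _ = Real.exp (b' + 2 * δ') * Real.exp (-m * n) := Real.exp_add _ _
        _ ≤ _ := by
            apply mul_le_mul_of_nonneg_right _ (Real.exp_pos _).le
            linarith [Real.exp_pos (b + 2 * δ)]

end Cnt

/-! ### Random walk measures -/

section Walk
variable {G : Type*}

/-- Concatenation: the first `n` increments come from `ω`, the rest from `ω'`. -/
def cat (n : ℕ) (z : (ℕ → G) × (ℕ → G)) : ℕ → G := fun i => if i < n then z.1 i else z.2 (i - n)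

/-- Shift by `n`. -/
def sh (n : ℕ) (ω : ℕ → G) : ℕ → G := fun i => ω (n + i)

lemma sh_cat (n : ℕ) (z : (ℕ → G) × (ℕ → G)) : sh n (cat n z) = z.2 := by
  funext i
  simp [sh, cat]

lemma sh_sh (m n : ℕ) (ω : ℕ → G) : sh m (sh n ω) = sh (n + m) ω := by
  funext i; simp [sh, add_assoc]

lemma sh_zero (ω : ℕ → G) : sh 0 ω = ω := by funext i; simp [sh]

lemma sh_iterate (n : ℕ) (ω : ℕ → G) : (sh 1)^[n] ω = sh n ω := by
  induction n generalizing ω with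
  | zero => simp [sh_zero]
  | succ n ih => rw [Function.iterate_succ_apply, ih, sh_sh, add_comm]

variable [Group G]

lemma walk_succ (ω : ℕ → G) (n : ℕ) : walk ω (n + 1) = walk ω n * ω n := by
  simp [walk, List.range_succ]

lemma walk_zero (ω : ℕ → G) : walk ω 0 = 1 := by simp [walk]

lemma walk_one (ω : ℕ → G) : walk ω 1 = ω 0 := by simp [walk]

lemma walk_add (ω : ℕ → G) (m n : ℕ) : walk ω (m + n) = walk ω m * walk (sh m ω) n := by
  induction n with
  | zero => simp [walk_zero]
  | succ n ih => rw [← add_assoc, walk_succ, ih, walk_succ, mul_assoc]; rfl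

lemma walk_congr {ω ω' : ℕ → G} {n : ℕ} (h : ∀ i < n, ω i = ω' i) : walk ω n = walk ω' n := by
  induction n with
  | zero => simp [walk_zero]
  | succ n ih =>
    rw [walk_succ, walk_succ, ih fun i hi => h i (by omega), h n (Nat.lt_succ_self n)]

lemma walk_cat (n : ℕ) (z : (ℕ → G) × (ℕ → G)) : walk (cat n z) n = walk z.1 n :=
  walk_congr fun i hi => by simp [cat, hi]

lemma walk_cat_add (n m : ℕ) (z : (ℕ → G) × (ℕ → G)) :
    walk (cat n z) (n + m) = walk z.1 n * walk z.2 m := by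
  rw [walk_add, walk_cat, sh_cat]

lemma walk_map {H : Type*} [Group H] (φ : G →* H) (ω : ℕ → G) (n : ℕ) :
    walk (fun i => φ (ω i)) n = φ (walk ω n) := by
  induction n with
  | zero => simp [walk]
  | succ n ih => rw [walk_succ, walk_succ, map_mul, ih]

end Walk

section RW
variable {G : Type*} [Group G] [Countable G] [MeasurableSpace G] [DiscreteMeasurableSpace G]

/-- Initial cylinders. -/
def icyl (n : ℕ) (g : ℕ → G) : Set (ℕ → G) := {ω | ∀ i < n, ω i = g i}

lemma measurableSet_icyl (n : ℕ) (g : ℕ → G) : MeasurableSet (icyl n g) := by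
  have : icyl n g = ⋂ i : ℕ, ⋂ _ : i < n, (fun ω : ℕ → G => ω i) ⁻¹' {g i} := by
    ext ω; simp [icyl]
  rw [this]
  exact MeasurableSet.iInter fun i => MeasurableSet.iInter fun _ =>
    measurable_pi_apply i (MeasurableSet.of_discrete)

lemma generateFrom_icyl : (MeasurableSpace.pi : MeasurableSpace (ℕ → G)) =
    MeasurableSpace.generateFrom {s | ∃ n g, s = icyl n g} := by
  apply le_antisymm
  · refine iSup_le fun k => ?_
    rintro _ ⟨t, -, rfl⟩
    have : (fun ω : ℕ → G => ω k) ⁻¹' t =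
        ⋃ (v : Fin (k + 1) → G) (_ : v (Fin.last k) ∈ t),
          icyl (k + 1) (fun i => if h : i < k + 1 then v ⟨i, h⟩ else 1) := by
      ext ω
      simp only [mem_preimage, mem_iUnion, icyl]
      constructor
      · intro h
        refine ⟨fun i => ω i, by simpa using h, fun i hi => by simp [hi]⟩
      · rintro ⟨v, hv, h⟩
        have := h k (Nat.lt_succ_self k)
        rw [dif_pos (Nat.lt_succ_self k)] at this
        rw [this]; exact hv
    rw [this]
    refine MeasurableSet.iUnion fun v => MeasurableSet.iUnion fun _ => ?_
    exact MeasurableSpace.measurableSet_generateFrom ⟨_, _, rfl⟩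
  · refine MeasurableSpace.generateFrom_le ?_
    rintro _ ⟨n, g, rfl⟩
    exact measurableSet_icyl n g

lemma isPiSystem_icyl : IsPiSystem {s : Set (ℕ → G) | ∃ n g, s = icyl n g} := by
  rintro _ ⟨n, g, rfl⟩ _ ⟨m, g', rfl⟩ ⟨ω, h1, h2⟩
  refine ⟨max n m, ω, ?_⟩
  ext ω'
  constructor
  · rintro ⟨h3, h4⟩ i hi
    rcases lt_max_iff.1 hi with hi | hi
    · rw [h3 i hi, h1 i hi]
    · rw [h4 i hi, h2 i hi]
  · intro h
    exact ⟨fun i hi => (h i (lt_max_of_lt_left hi)).trans (h1 i hi),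
      fun i hi => (h i (lt_max_of_lt_right hi)).trans (h2 i hi)⟩

variable {p : G → ℝ≥0∞} {P Q : Measure (ℕ → G)}

lemma rw_ext (hP : IsRWMeasure p P) (hQ : IsRWMeasure p Q) : P = Q := by
  haveI := hP.1
  haveI := hQ.1
  refine ext_of_generate_finite _ generateFrom_icyl isPiSystem_icyl ?_ ?_
  · rintro _ ⟨n, g, rfl⟩
    exact (hP.2 n g).trans (hQ.2 n g).symm
  · simp

lemma rw_single (hP : IsRWMeasure p P) (g : G) : P {ω | ω 0 = g} = p g := by
  have := hP.2 1 (fun _ => g)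
  simpa using this

lemma measurable_coord_set (k : ℕ) (s : Set G) : MeasurableSet {ω : ℕ → G | ω k ∈ s} :=
  measurable_pi_apply k (MeasurableSet.of_discrete)

lemma rw_isProb (hP : IsRWMeasure p P) : IsProb p := by
  haveI := hP.1
  have h1 : P (⋃ g, {ω | ω 0 = g}) = ∑' g, P {ω | ω 0 = g} := by
    apply measure_iUnion
    · intro a b hab
      refine Set.disjoint_left.2 fun ω h1 h2 => hab ?_
      exact (show ω 0 = a from h1).symm.trans h2
    · intro g; exact measurable_coord_set 0 {g}
  have h2 : (⋃ g, {ω : ℕ → G | ω 0 = g}) = univ := by ext ω; simp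
  rw [h2, measure_univ] at h1
  rw [IsProb, h1]
  exact tsum_congr fun g => (rw_single hP g).symm

lemma rw_eq_infinitePi (hP : IsRWMeasure p P) : ∃ m : Measure G, IsProbabilityMeasure m ∧
    ∃ _ : IsProbabilityMeasure m, P = Measure.infinitePi (fun _ : ℕ => m) := by
  haveI := hP.1
  refine ⟨P.map (fun ω => ω 0), ?_⟩
  have hm : IsProbabilityMeasure (P.map (fun ω => ω 0)) :=
    Measure.isProbabilityMeasure_map (measurable_pi_apply 0).aemeasurable
  refine ⟨hm, hm, rw_ext hP ⟨inferInstance, fun n g => ?_⟩⟩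
  have : {ω : ℕ → G | ∀ i < n, ω i = g i} = Set.pi (Finset.range n : Set ℕ) (fun i => {g i}) := by
    ext ω; simp [Set.mem_pi]
  rw [this, Measure.infinitePi_pi _ (fun i _ => MeasurableSet.of_discrete)]
  refine Finset.prod_congr rfl fun i _ => ?_
  rw [Measure.map_apply (measurable_pi_apply 0) MeasurableSet.of_discrete]
  exact rw_single hP (g i)

lemma rw_slln (hP : IsRWMeasure p P) (F : G → ℝ)
    (hF : Integrable (fun ω : ℕ → G => F (ω 0)) P) :
    ∀ᵐ ω ∂P, Tendsto (fun n : ℕ => (∑ i ∈ Finset.range n, F (ω i)) / n) atTop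
      (𝓝 (∫ ω, F (ω 0) ∂P)) := by
  obtain ⟨m, _, hm, h⟩ := rw_eq_infinitePi hP
  have hFm : Measurable F := fun s _ => MeasurableSet.of_discrete
  have h1 : Pairwise (Function.onFun (fun f g : (ℕ → G) → ℝ => ProbabilityTheory.IndepFun f g P)
      (fun (i : ℕ) (ω : ℕ → G) => F (ω i))) := by
    intro i j hij
    have := (ProbabilityTheory.iIndepFun_infinitePi (P := fun _ : ℕ => m)
      (X := fun _ => F) (fun _ => hFm)).indepFun hij
    rw [← h] at this
    exact this
  have h2 : ∀ i : ℕ, ProbabilityTheory.IdentDistrib (fun ω : ℕ → G => F (ω i))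
      (fun ω : ℕ → G => F (ω 0)) P P := by
    intro i
    have : ProbabilityTheory.IdentDistrib (fun ω : ℕ → G => ω i) (fun ω : ℕ → G => ω 0) P P := by
      refine ⟨(measurable_pi_apply i).aemeasurable, (measurable_pi_apply 0).aemeasurable, ?_⟩
      have e : ∀ k : ℕ, P.map (fun ω : ℕ → G => ω k) = m := by
        intro k
        rw [h]
        exact Measure.infinitePi_map_eval (fun _ : ℕ => m) k
      exact (e i).trans (e 0).symm
    exact this.comp hFm
  exact ProbabilityTheory.strong_law_ae_real (fun (i : ℕ) (ω : ℕ → G) => F (ω i)) hF h1 h2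

lemma measurable_cat (n : ℕ) : Measurable (cat (G := G) n) := by
  refine measurable_pi_lambda _ fun i => ?_
  unfold cat
  split_ifs <;> fun_prop

lemma measurable_sh (n : ℕ) : Measurable (sh (G := G) n) :=
  measurable_pi_lambda _ fun _ => measurable_pi_apply _

lemma rw_cat (hP : IsRWMeasure p P) (n : ℕ) : (P.prod P).map (cat n) = P := by
  haveI := hP.1
  refine rw_ext ⟨Measure.isProbabilityMeasure_map (measurable_cat n).aemeasurable,
    fun N g => ?_⟩ hP
  change (P.prod P).map (cat n) (icyl N g) = _
  rw [Measure.map_apply (measurable_cat n) (measurableSet_icyl N g)]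
  have : cat n ⁻¹' (icyl N g) = icyl (min n N) g ×ˢ icyl (N - n) (fun i => g (n + i)) := by
    ext ⟨ω, ω'⟩
    simp only [icyl, mem_preimage, mem_prod]
    constructor
    · intro h
      refine ⟨fun i hi => ?_, fun i hi => ?_⟩
      · have := h i (lt_of_lt_of_le hi (min_le_right _ _))
        rwa [cat, if_pos (lt_of_lt_of_le hi (min_le_left _ _))] at this
      · have := h (n + i) (by omega)
        rwa [cat, if_neg (by omega), Nat.add_sub_cancel_left] at this
    · rintro ⟨h1, h2⟩ i hi
      change (if i < n then ω i else ω' (i - n)) = g i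
      split_ifs with hin
      · exact h1 i (lt_min hin hi)
      · have := h2 (i - n) (by omega)
        rwa [show n + (i - n) = i by omega] at this
  rw [this, Measure.prod_prod]
  change P {ω | ∀ i < _, ω i = _} * P {ω | ∀ i < _, ω i = _} = _
  rw [hP.2, hP.2]
  rcases le_total n N with h | h
  · rw [min_eq_left h]
    obtain ⟨k, rfl⟩ := Nat.exists_eq_add_of_le h
    rw [Nat.add_sub_cancel_left, Finset.prod_range_add]
  · rw [min_eq_right h, Nat.sub_eq_zero_of_le h]; simp

lemma rw_sh (hP : IsRWMeasure p P) (n : ℕ) : MeasurePreserving (sh n) P P := by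
  haveI := hP.1
  refine ⟨measurable_sh n, ?_⟩
  conv_lhs => rw [← rw_cat hP n]
  rw [Measure.map_map (measurable_sh n) (measurable_cat n)]
  have : sh n ∘ cat n = (Prod.snd : (ℕ → G) × (ℕ → G) → _) := funext fun z => sh_cat n z
  rw [this]
  exact measurePreserving_snd.map_eq

lemma rw_cat_apply (hP : IsRWMeasure p P) (n : ℕ) {s : Set (ℕ → G)} (hs : MeasurableSet s) :
    P s = (P.prod P) (cat n ⁻¹' s) := by
  conv_lhs => rw [← rw_cat hP n]
  rw [Measure.map_apply (measurable_cat n) hs]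

/-- Factoring through blocks. -/
lemma rw_block {H : Type*} [Group H] [Countable H] [MeasurableSpace H] [DiscreteMeasurableSpace H]
    (hP : IsRWMeasure p P) (K : ℕ) (ψ : (ℕ → G) → H) (hψ : Measurable ψ)
    (hc : ∀ z, ψ (cat K z) = ψ z.1) :
    IsRWMeasure (fun a => P {ω | ψ ω = a}) (P.map (fun ω i => ψ (sh (i * K) ω))) := by
  haveI := hP.1
  have hm : Measurable (fun (ω : ℕ → G) (i : ℕ) => ψ (sh (i * K) ω)) :=
    measurable_pi_lambda _ fun i => hψ.comp (measurable_sh _)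
  refine ⟨Measure.isProbabilityMeasure_map hm.aemeasurable, fun n g => ?_⟩
  change P.map _ (icyl n g) = _
  rw [Measure.map_apply hm (measurableSet_icyl n g)]
  induction n generalizing g with
  | zero => 
    have : (fun (ω : ℕ → G) (i : ℕ) => ψ (sh (i * K) ω)) ⁻¹' icyl 0 g = univ := by
      ext ω; simp [icyl]
    rw [this]; simp
  | succ n ih =>
    rw [rw_cat_apply hP K (hm (measurableSet_icyl (n + 1) g))]
    have : cat K ⁻¹' ((fun (ω : ℕ → G) (i : ℕ) => ψ (sh (i * K) ω)) ⁻¹' icyl (n + 1) g) =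
        {ω | ψ ω = g 0} ×ˢ ((fun (ω : ℕ → G) (i : ℕ) => ψ (sh (i * K) ω)) ⁻¹'
          icyl n (fun i => g (i + 1))) := by
      ext z
      simp only [icyl, mem_preimage, mem_prod]
      have key : ∀ i, ψ (sh ((i + 1) * K) (cat K z)) = ψ (sh (i * K) z.2) := by
        intro i
        rw [show (i + 1) * K = K + i * K by ring, ← sh_sh, sh_cat]
      have key0 : ψ (sh (0 * K) (cat K z)) = ψ z.1 := by rw [zero_mul, sh_zero, hc]
      constructor
      · intro h
        refine ⟨by rw [← h 0 (Nat.succ_pos n)]; exact key0.symm, fun i hi => ?_⟩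
        change ψ (sh (i * K) z.2) = _
        rw [← key]; exact h (i + 1) (by omega)
      · rintro ⟨h1, h2⟩ i hi
        change ψ (sh (i * K) (cat K z)) = g i
        rcases i with _ | i
        · rw [key0]; exact h1
        · rw [key]; exact h2 i (by omega)
    rw [this, Measure.prod_prod, ih, Finset.prod_range_succ']
    rw [mul_comm]

lemma measurable_walk (n : ℕ) : Measurable (fun ω : ℕ → G => walk ω n) := by
  induction n with
  | zero => simp only [walk_zero]; exact measurable_const
  | succ n ih =>
    simp only [walk_succ]
    have h2 : Measurable (fun z : G × G => z.1 * z.2) := by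
      intro s _; exact MeasurableSet.of_discrete
    exact h2.comp (ih.prodMk (measurable_pi_apply n))

lemma measurableSet_walk (n : ℕ) (g : G) : MeasurableSet {ω : ℕ → G | walk ω n = g} :=
  measurable_walk n (MeasurableSet.of_discrete (s := {g}))

lemma rw_walk (hP : IsRWMeasure p P) (n : ℕ) (g : G) : P {ω | walk ω n = g} = piN p n g := by
  haveI := hP.1
  induction n generalizing g with
  | zero =>
    simp only [walk_zero, piN]
    split_ifs with h
    · simp [h]
    · have : {ω : ℕ → G | (1 : G) = g} = ∅ := by ext; simp [eq_comm, h]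
      rw [this]; simp
  | succ n ih =>
    rw [rw_cat_apply hP n (measurableSet_walk _ _)]
    have : cat n ⁻¹' {ω : ℕ → G | walk ω (n + 1) = g} =
        ⋃ y : G, {ω | walk ω n = y} ×ˢ {ω | ω 0 = y⁻¹ * g} := by
      ext z
      simp only [mem_preimage, mem_iUnion, mem_prod]
      change walk (cat n z) (n + 1) = g ↔ ∃ y, walk z.1 n = y ∧ z.2 0 = y⁻¹ * g
      rw [walk_cat_add, walk_one]
      constructor
      · intro h; exact ⟨_, rfl, by rw [← h]; group⟩
      · rintro ⟨y, rfl, h⟩; rw [h]; group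
    rw [this, measure_iUnion]
    · simp only [piN, conv]
      refine tsum_congr fun y => ?_
      rw [Measure.prod_prod, ih, rw_single hP]
    · intro a b hab
      refine Set.disjoint_left.2 fun z h1 h2 => hab ?_
      exact (show walk z.1 n = a from h1.1).symm.trans h2.1
    · intro y
      exact (measurableSet_walk n y).prod (measurable_coord_set 0 {y⁻¹ * g})

lemma rw_lintegral_walk (hP : IsRWMeasure p P) (n : ℕ) (F : G → ℝ≥0∞) :
    ∫⁻ ω, F (walk ω n) ∂P = ∑' g, piN p n g * F g := by
  have hF : Measurable F := fun s _ => MeasurableSet.of_discrete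
  rw [← lintegral_map hF (measurable_walk n), lintegral_countable']
  refine tsum_congr fun g => ?_
  rw [Measure.map_apply (measurable_walk n) MeasurableSet.of_discrete, mul_comm]
  congr 1
  exact rw_walk hP n g

lemma rw_blocks (hP : IsRWMeasure p P) (K : ℕ) :
    IsRWMeasure (piN p K) (P.map (fun ω i => walk (sh (i * K) ω) K)) := by
  have := rw_block hP K (fun ω => walk ω K) (measurable_walk K) (fun z => walk_cat K z)
  have e : (fun a => P {ω | walk ω K = a}) = piN p K := funext fun a => rw_walk hP K a
  rwa [e] at this

lemma piN_tsum (hP : IsRWMeasure p P) (n : ℕ) : ∑' g, piN p n g = 1 :=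
  rw_isProb (rw_blocks hP n)

lemma piN_le_one (hP : IsRWMeasure p P) (n : ℕ) (g : G) : piN p n g ≤ 1 :=
  (ENNReal.le_tsum g).trans (piN_tsum hP n).le

lemma rw_map {H : Type*} [Group H] [Countable H] [MeasurableSpace H] [DiscreteMeasurableSpace H]
    (hP : IsRWMeasure p P) (φ : G → H) :
    IsRWMeasure (fun a => P {ω | φ (ω 0) = a}) (P.map (fun ω i => φ (ω i))) := by
  have hφ : Measurable φ := fun s _ => MeasurableSet.of_discrete
  have := rw_block hP 1 (fun ω => φ (ω 0)) (hφ.comp (measurable_pi_apply 0)) (fun z => by simp [cat])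
  simpa [sh] using this

end RW

/-! ### Subadditive ergodic theorem, lower bound -/

section King
variable {Ω : Type*} [MeasurableSpace Ω] {P : Measure Ω} [IsProbabilityMeasure P]

lemma sub_le_sum {T : Ω → Ω} {f : ℕ → Ω → ℝ≥0∞} (f0 : ∀ ω, f 0 ω = 0)
    (hsub : ∀ m n ω, f (m + n) ω ≤ f m ω + f n (T^[m] ω)) (n : ℕ) (ω : Ω) :
    f n ω ≤ ∑ k ∈ Finset.range n, f 1 (T^[k] ω) := by
  induction n with
  | zero => simp [f0]
  | succ n ih =>
    rw [Finset.sum_range_succ]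
    exact (hsub n 1 ω).trans (by gcongr)

lemma king_det {T : Ω → Ω} {f : ℕ → Ω → ℝ≥0∞} (f0 : ∀ ω, f 0 ω = 0)
    (hsub : ∀ m n ω, f (m + n) ω ≤ f m ω + f n (T^[m] ω)) (M : ℕ) (U : Set Ω) (c : ℝ≥0∞)
    (n : ℕ) : ∀ ω, (∀ k, T^[k] ω ∈ U → ∃ m, 1 ≤ m ∧ m ≤ M ∧ f m (T^[k] ω) ≤ m * c) →
      f n ω ≤ n * c + ∑ k ∈ Finset.range n, (Uᶜ.indicator (f 1) (T^[k] ω) +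
        if n ≤ k + M then f 1 (T^[k] ω) else 0) := by
  induction n using Nat.strong_induction_on with
  | _ n ih =>
    intro ω hω
    rcases Nat.eq_zero_or_pos n with rfl | hn
    · simp [f0]
    -- general step
    have step : ∀ m n', 1 ≤ m → n = m + n' → f m ω ≤ m * c + ∑ k ∈ Finset.range m,
        (Uᶜ.indicator (f 1) (T^[k] ω)) → f n ω ≤ n * c + ∑ k ∈ Finset.range n,
        (Uᶜ.indicator (f 1) (T^[k] ω) + if n ≤ k + M then f 1 (T^[k] ω) else 0) := by
      intro m n' hm hn' h
      have hih := ih n' (by omega) (T^[m] ω) (fun k hk => by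
        rw [← Function.iterate_add_apply] at hk ⊢; exact hω _ hk)
      subst hn'
      refine (hsub m n' ω).trans ((add_le_add h hih).trans ?_)
      rw [Finset.sum_range_add]
      have e1 : ∑ k ∈ Finset.range n', (Uᶜ.indicator (f 1) (T^[k] (T^[m] ω)) +
          if n' ≤ k + M then f 1 (T^[k] (T^[m] ω)) else 0) =
          ∑ k ∈ Finset.range n', (Uᶜ.indicator (f 1) (T^[m + k] ω) +
          if m + n' ≤ m + k + M then f 1 (T^[m + k] ω) else 0) := by
        refine Finset.sum_congr rfl fun k _ => ?_
        rw [← Function.iterate_add_apply, add_comm k m]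
        congr 1
        simp only [add_assoc, add_le_add_iff_left]
      rw [e1]
      have e2 : ∑ k ∈ Finset.range m, (Uᶜ.indicator (f 1) (T^[k] ω)) ≤
          ∑ k ∈ Finset.range m, (Uᶜ.indicator (f 1) (T^[k] ω) +
            if m + n' ≤ k + M then f 1 (T^[k] ω) else 0) :=
        Finset.sum_le_sum fun k _ => le_self_add
      push_cast
      calc _ ≤ (m * c + ∑ k ∈ Finset.range m, (Uᶜ.indicator (f 1) (T^[k] ω) +
            if m + n' ≤ k + M then f 1 (T^[k] ω) else 0)) + (n' * c + _) := by
              gcongr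
        _ = _ := by ring
    by_cases hU : ω ∈ U
    · obtain ⟨m, hm1, hmM, hm⟩ := hω 0 hU
      simp only [Function.iterate_zero, id] at hm
      rcases le_or_gt m n with h | h
      · obtain ⟨n', rfl⟩ := Nat.exists_eq_add_of_le h
        exact step m n' hm1 rfl (hm.trans le_self_add)
      · refine (sub_le_sum f0 hsub n ω).trans (le_trans ?_ le_add_self)
        refine Finset.sum_le_sum fun k _ => ?_
        rw [if_pos (by omega)]
        exact le_add_self
    · obtain ⟨n', rfl⟩ := Nat.exists_eq_add_of_le (show 1 ≤ n from hn)
      refine step 1 n' le_rfl rfl ?_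
      simp [Set.indicator_of_mem (show ω ∈ Uᶜ from hU)]

lemma lintegral_iter {T : Ω → Ω} (hT : MeasurePreserving T P P) (k : ℕ) {g : Ω → ℝ≥0∞}
    (hg : Measurable g) : ∫⁻ ω, g (T^[k] ω) ∂P = ∫⁻ ω, g ω ∂P :=
  (hT.iterate k).lintegral_comp hg

lemma kingman_lower {T : Ω → Ω} (hT : MeasurePreserving T P P) {f : ℕ → Ω → ℝ≥0∞}
    (hf : ∀ n, Measurable (f n)) (f0 : ∀ ω, f 0 ω = 0)
    (hsub : ∀ m n ω, f (m + n) ω ≤ f m ω + f n (T^[m] ω)) (h1 : ∫⁻ ω, f 1 ω ∂P ≠ ∞)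
    (L : ℝ≥0∞) (hL : ∀ n : ℕ, n * L ≤ ∫⁻ ω, f n ω ∂P) :
    L ≤ ∫⁻ ω, liminf (fun n : ℕ => f n ω / n) atTop ∂P := by
  set X : Ω → ℝ≥0∞ := fun ω => liminf (fun n : ℕ => f n ω / n) atTop with hX
  have hXm : Measurable X := Measurable.liminf fun n => (hf n).div_const _
  have hIntF : ∀ n : ℕ, ∫⁻ ω, f n ω ∂P ≤ n * ∫⁻ ω, f 1 ω ∂P := by
    intro n
    calc ∫⁻ ω, f n ω ∂P ≤ ∫⁻ ω, ∑ k ∈ Finset.range n, f 1 (T^[k] ω) ∂P :=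
          lintegral_mono fun ω => sub_le_sum f0 hsub n ω
      _ = ∑ k ∈ Finset.range n, ∫⁻ ω, f 1 (T^[k] ω) ∂P :=
          lintegral_finsetSum _ fun k _ => (hf 1).comp (hT.iterate k).measurable
      _ = n * ∫⁻ ω, f 1 ω ∂P := by
          simp [lintegral_iter hT _ (hf 1)]
  have hXint : ∫⁻ ω, X ω ∂P ≤ ∫⁻ ω, f 1 ω ∂P := by
    refine (lintegral_liminf_le fun n => (hf n).div_const _).trans ?_
    refine Filter.liminf_le_of_frequently_le' ?_
    refine Eventually.frequently ?_
    filter_upwards [eventually_gt_atTop 0] with n hn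
    simp only [div_eq_mul_inv]
    rw [lintegral_mul_const _ (hf n), ← div_eq_mul_inv]
    refine ENNReal.div_le_of_le_mul ?_
    rw [mul_comm]
    exact hIntF n
  have hXfin : ∫⁻ ω, X ω ∂P ≠ ∞ := ne_top_of_le_ne_top h1 hXint
  have hXT : ∀ᵐ ω ∂P, X ω ≤ X (T ω) := by
    filter_upwards [ae_lt_top (hf 1) h1] with ω hω
    -- X ω = liminf f (n+1) ω / (n+1)
    have e : X ω = liminf (fun n : ℕ => f (n + 1) ω / (n + 1 : ℕ)) atTop :=
      (Filter.liminf_nat_add (fun n : ℕ => f n ω / n) 1).symm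
    have hz : Tendsto (fun n : ℕ => f 1 ω / n) atTop (𝓝 0) := by
      exact ENNReal.Tendsto.const_div ENNReal.tendsto_nat_nhds_top (Or.inr hω.ne) |>.trans (by simp)
    have hle : X ω ≤ liminf (fun n : ℕ => f 1 ω / n + f n (T ω) / n) atTop := by
      rw [e]
      refine Filter.liminf_le_liminf ?_
      filter_upwards [eventually_gt_atTop 0] with n hn
      rw [← ENNReal.add_div]
      refine ENNReal.div_le_div ?_ (by exact_mod_cast Nat.le_succ n)
      have := hsub 1 n ω
      rw [add_comm 1 n] at this
      simpa using this
    refine hle.trans ?_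
    refine ENNReal.le_of_forall_pos_le_add fun ε hε _ => ?_
    have hεE : ∀ᶠ n : ℕ in atTop, f 1 ω / n ≤ ε := by
      filter_upwards [hz.eventually_lt_const (show (0 : ℝ≥0∞) < ε by exact_mod_cast hε)] with n hn
        using hn.le
    calc liminf (fun n : ℕ => f 1 ω / n + f n (T ω) / n) atTop
        ≤ liminf (fun n : ℕ => f n (T ω) / n + ε) atTop := by
          refine Filter.liminf_le_liminf ?_
          filter_upwards [hεE] with n hn
          rw [add_comm]; gcongr
      _ = X (T ω) + ε := by
          simp only [hX]
          exact liminf_add_const atTop (fun n : ℕ => f n (T ω) / n) (ε : ℝ≥0∞)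
            (by isBoundedDefault) (by isBoundedDefault)
  have hXinv : ∀ᵐ ω ∂P, X (T ω) = X ω := by
    have h2 : ∫⁻ ω, X (T ω) ∂P = ∫⁻ ω, X ω ∂P := hT.lintegral_comp hXm
    have := (ae_eq_of_ae_le_of_lintegral_le hXT hXfin (hXm.comp hT.measurable).aemeasurable h2.le)
    filter_upwards [this] with ω hω using hω.symm
  have hXall : ∀ᵐ ω ∂P, ∀ k, X (T^[k] ω) = X ω := by
    rw [ae_all_iff]
    intro k
    induction k with
    | zero => exact Eventually.of_forall fun _ => rfl
    | succ k ih =>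
      filter_upwards [ih, (hT.iterate k).quasiMeasurePreserving.ae hXinv] with ω h1 h2
      rw [Function.iterate_succ_apply', h2, h1]
  have hXlt : ∀ᵐ ω ∂P, X ω < ∞ := ae_lt_top hXm hXfin
  refine ENNReal.le_of_forall_pos_le_add fun ε hε _ => ?_
  set ε' : ℝ≥0∞ := ((ε / 2 : NNReal) : ℝ≥0∞) with hε'
  have hε'0 : 0 < ε' := by
    rw [hε']; exact_mod_cast half_pos hε
  let U : ℕ → Set Ω := fun M => {ω | ∃ m, 1 ≤ m ∧ m ≤ M ∧ f m ω ≤ m * (X ω + ε')}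
  have hUm : ∀ M, MeasurableSet (U M) := by
    intro M
    have : U M = ⋃ m : ℕ, ⋃ _ : 1 ≤ m ∧ m ≤ M, {ω | f m ω ≤ m * (X ω + ε')} := by
      ext ω; simp [U, and_assoc]
    rw [this]
    refine MeasurableSet.iUnion fun m => MeasurableSet.iUnion fun _ => ?_
    exact measurableSet_le (hf m) ((hXm.add_const _).const_mul _)
  have hlim : Tendsto (fun M => ∫⁻ ω, (U M)ᶜ.indicator (f 1) ω ∂P) atTop (𝓝 0) := by
    have := tendsto_lintegral_of_dominated_convergence (μ := P)
      (F := fun M ω => (U M)ᶜ.indicator (f 1) ω) (f := fun _ => 0) (f 1)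
      (fun M => (hf 1).indicator (hUm M).compl)
      (fun M => Eventually.of_forall fun ω => Set.indicator_le_self _ _ _) h1 ?_
    · simpa using this
    · filter_upwards [hXlt] with ω hω
      have hfr : ∃ᶠ n : ℕ in atTop, f n ω / n < X ω + ε' :=
        Filter.frequently_lt_of_liminf_lt (by isBoundedDefault)
          (ENNReal.lt_add_right hω.ne hε'0.ne')
      obtain ⟨m, hm, hm0⟩ := (hfr.and_eventually (eventually_gt_atTop 0)).exists
      apply tendsto_const_nhds.congr'
      filter_upwards [eventually_ge_atTop m] with M hM
      rw [Set.indicator_of_notMem]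
      simp only [mem_compl_iff, not_not]
      refine ⟨m, hm0, hM, ?_⟩
      rw [mul_comm]
      exact (ENNReal.div_le_iff (by exact_mod_cast hm0.ne') (ENNReal.natCast_ne_top m)).1 hm.le
  obtain ⟨M, hM⟩ := (hlim.eventually_lt_const hε'0).exists
  have hmain : ∀ n : ℕ, n * L ≤ n * (∫⁻ ω, X ω ∂P + ε' + ε') + M * ∫⁻ ω, f 1 ω ∂P := by
    intro n
    refine (hL n).trans ?_
    have hb : ∫⁻ ω, f n ω ∂P ≤ ∫⁻ ω, (n * (X ω + ε') + ∑ k ∈ Finset.range n,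
        ((U M)ᶜ.indicator (f 1) (T^[k] ω) + if n ≤ k + M then f 1 (T^[k] ω) else 0)) ∂P := by
      refine lintegral_mono_ae ?_
      filter_upwards [hXall] with ω hω
      refine king_det f0 hsub M (U M) (X ω + ε') n ω fun k hk => ?_
      obtain ⟨m, a, b, c⟩ := hk
      rw [hω k] at c
      exact ⟨m, a, b, c⟩
    have hmeas : ∀ k, Measurable fun ω => ((U M)ᶜ.indicator (f 1) (T^[k] ω)) := fun k =>
      ((hf 1).indicator (hUm M).compl).comp (hT.iterate k).measurable
    have hmeas2 : ∀ k, Measurable fun ω => (if n ≤ k + M then f 1 (T^[k] ω) else 0) := fun k => by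
      split_ifs
      · exact (hf 1).comp (hT.iterate k).measurable
      · exact measurable_const
    have hmeas3 : ∀ k, Measurable fun ω => ((U M)ᶜ.indicator (f 1) (T^[k] ω) +
        if n ≤ k + M then f 1 (T^[k] ω) else 0) := fun k => (hmeas k).add (hmeas2 k)
    refine hb.trans ?_
    rw [lintegral_add_left ((hXm.add_const _).const_mul _),
      lintegral_const_mul _ (hXm.add_const _), lintegral_add_left hXm,
      lintegral_finsetSum _ (fun k _ => hmeas3 k)]
    simp only [lintegral_const, measure_univ, mul_one]
    have hk : ∀ k ∈ Finset.range n, ∫⁻ ω, ((U M)ᶜ.indicator (f 1) (T^[k] ω) +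
        if n ≤ k + M then f 1 (T^[k] ω) else 0) ∂P ≤
        ε' + if n ≤ k + M then ∫⁻ ω, f 1 ω ∂P else 0 := by
      intro k _
      rw [lintegral_add_left (hmeas k)]
      refine add_le_add ?_ ?_
      · rw [lintegral_iter hT k ((hf 1).indicator (hUm M).compl)]; exact hM.le
      · split_ifs
        · rw [lintegral_iter hT k (hf 1)]
        · simp
    have hsum := Finset.sum_le_sum hk
    rw [Finset.sum_add_distrib, ← Finset.sum_filter] at hsum
    simp only [Finset.sum_const, Finset.card_range, nsmul_eq_mul] at hsum
    have hcard : ((Finset.range n).filter (fun k => n ≤ k + M)).card ≤ M := by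
      have : (Finset.range n).filter (fun k => n ≤ k + M) ⊆ Finset.Ico (n - M) n := by
        intro k hk
        simp only [Finset.mem_filter, Finset.mem_range, Finset.mem_Ico] at hk ⊢
        omega
      refine (Finset.card_le_card this).trans ?_
      simp; omega
    calc _ ≤ n * (∫⁻ ω, X ω ∂P + ε') + (n * ε' + M * ∫⁻ ω, f 1 ω ∂P) := by
          gcongr
          refine hsum.trans ?_
          gcongr
      _ = _ := by ring
  have hεε : ε' + ε' = ε := by
    rw [hε', ← ENNReal.coe_add, add_halves]
  have hfin : ∀ n : ℕ, 0 < n → L ≤ ∫⁻ ω, X ω ∂P + ε + (M * ∫⁻ ω, f 1 ω ∂P) / n := by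
    intro n hn
    have h2 := hmain n
    rw [add_assoc, hεε] at h2
    have hn0 : (n : ℝ≥0∞) ≠ 0 := by exact_mod_cast hn.ne'
    have hnt := ENNReal.natCast_ne_top n
    have h3 : L = n * L / n := by rw [mul_comm, ENNReal.mul_div_cancel_right hn0 hnt]
    rw [h3]
    refine (ENNReal.div_le_div_right h2 _).trans ?_
    rw [ENNReal.add_div, mul_comm, ENNReal.mul_div_cancel_right hn0 hnt]
  have hz : Tendsto (fun n : ℕ => ∫⁻ ω, X ω ∂P + ε + (M * ∫⁻ ω, f 1 ω ∂P) / n) atTop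
      (𝓝 (∫⁻ ω, X ω ∂P + ε + 0)) := by
    refine tendsto_const_nhds.add ?_
    exact ENNReal.Tendsto.const_div ENNReal.tendsto_nat_nhds_top (Or.inr (by finiteness)) |>.trans
      (by simp)
  rw [add_zero] at hz
  refine ge_of_tendsto hz ?_
  filter_upwards [eventually_gt_atTop 0] with n hn using hfin n hn

end King

/-! ### Subadditive functionals of the walk -/

section Erg
variable {G : Type*} [Group G] [Countable G] [MeasurableSpace G] [DiscreteMeasurableSpace G]
variable {p : G → ℝ≥0∞} {P : Measure (ℕ → G)}

lemma meas_disc {β : Type*} [MeasurableSpace β] (F : G → β) : Measurable F :=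
  fun _ _ => MeasurableSet.of_discrete

lemma F_blocks {F : ℕ → G → ℝ≥0∞} (F0 : F 0 1 = 0)
    (hsub : ∀ m n g h, F (m + n) (g * h) ≤ F m g + F n h) (K j : ℕ) (ω : ℕ → G) :
    F (j * K) (walk ω (j * K)) ≤ ∑ i ∈ Finset.range j, F K (walk (sh (i * K) ω) K) := by
  induction j with
  | zero => simp [walk_zero, F0]
  | succ j ih =>
    rw [Finset.sum_range_succ, add_mul, one_mul, walk_add]
    exact (hsub _ _ _ _).trans (by gcongr)

lemma block_integrable (hP : IsRWMeasure p P) (K : ℕ) (F : G → ℝ≥0∞)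
    (hfin : ∑' g, piN p K g * F g ≠ ∞) :
    ∀ᵐ ω ∂P, (∀ i, F (walk (sh (i * K) ω) K) ≠ ∞) ∧
      Tendsto (fun n : ℕ => (∑ i ∈ Finset.range n, (F (walk (sh (i * K) ω) K)).toReal) / n) atTop
        (𝓝 (∑' g, piN p K g * F g).toReal) := by
  have hB := rw_blocks hP K
  have hl : ∫⁻ ω, F (walk ω K) ∂P = ∑' g, piN p K g * F g := rw_lintegral_walk hP K F
  have hmB : Measurable (fun (ω : ℕ → G) (i : ℕ) => walk (sh (i * K) ω) K) :=
    measurable_pi_lambda _ fun i => (measurable_walk K).comp (measurable_sh _)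
  have hl2 : ∫⁻ ω, F (ω 0) ∂(P.map (fun ω i => walk (sh (i * K) ω) K)) =
      ∑' g, piN p K g * F g := by
    have hm0 : Measurable (fun ω : ℕ → G => F (ω 0)) :=
      (meas_disc F).comp (measurable_pi_apply 0)
    rw [lintegral_map hm0 hmB]
    simp only [zero_mul, sh_zero]
    exact hl
  have hmF : Measurable (fun ω : ℕ → G => F (ω 0)) := (meas_disc F).comp (measurable_pi_apply 0)
  have hs := rw_slln hB (fun g => (F g).toReal)
    (integrable_toReal_of_lintegral_ne_top hmF.aemeasurable (by rw [hl2]; exact hfin))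
  have hae : ∀ᵐ ω ∂(P.map (fun ω i => walk (sh (i * K) ω) K)), F (ω 0) < ∞ :=
    ae_lt_top hmF (by rw [hl2]; exact hfin)
  rw [integral_toReal hmF.aemeasurable hae, hl2] at hs
  have hs' := ae_of_ae_map hmB.aemeasurable hs
  have hw : ∀ᵐ ω ∂P, F (walk ω K) < ∞ :=
    ae_lt_top ((meas_disc F).comp (measurable_walk K)) (by
      change ∫⁻ ω, F (walk ω K) ∂P ≠ ∞
      rw [hl]; exact hfin)
  have hw' : ∀ᵐ ω ∂P, ∀ i, F (walk (sh (i * K) ω) K) ≠ ∞ := by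
    rw [ae_all_iff]
    intro i
    filter_upwards [(rw_sh hP (i * K)).quasiMeasurePreserving.ae hw] with ω h using h.ne
  filter_upwards [hs', hw'] with ω h1 h2
  exact ⟨h2, h1⟩

lemma walk_upper (hP : IsRWMeasure p P) {F : ℕ → G → ℝ≥0∞} (F0 : F 0 1 = 0)
    (hsub : ∀ m n g h, F (m + n) (g * h) ≤ F m g + F n h) {E : ℕ → ℝ} (hE0 : ∀ n, 0 ≤ E n)
    (hE : ∀ n, ∑' g, piN p n g * F n g = ENNReal.ofReal (E n)) {L : ℝ}
    (hL : Tendsto (fun n : ℕ => E n / n) atTop (𝓝 L)) {ε : ℝ} (hε : 0 < ε) :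
    ∃ K0 : ℕ, ∀ K, K0 ≤ K → ∀ᵐ ω ∂P, ∀ᶠ j : ℕ in atTop,
      F (j * K) (walk ω (j * K)) ≤ ENNReal.ofReal ((L + ε) * (j * K : ℕ)) := by
  obtain ⟨K0, hK0⟩ := eventually_atTop.1 ((hL.eventually_lt_const
    (show L < L + ε by linarith)).and (eventually_gt_atTop 0))
  refine ⟨K0, fun K hK => ?_⟩
  obtain ⟨hlt, hKpos⟩ := hK0 K hK
  have hKr : (0 : ℝ) < K := by exact_mod_cast hKpos
  rw [div_lt_iff₀ hKr] at hlt
  have hfin : ∑' g, piN p K g * F K g ≠ ∞ := by rw [hE]; exact ENNReal.ofReal_ne_top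
  filter_upwards [block_integrable hP K (F K) hfin] with ω ⟨h1, h2⟩
  rw [hE, ENNReal.toReal_ofReal (hE0 K)] at h2
  filter_upwards [h2.eventually_lt_const hlt, eventually_gt_atTop 0] with j hj hj0
  have hjr : (0 : ℝ) < j := by exact_mod_cast hj0
  refine (F_blocks F0 hsub K j ω).trans ?_
  rw [div_lt_iff₀ hjr] at hj
  have : ∑ i ∈ Finset.range j, F K (walk (sh (i * K) ω) K) =
      ENNReal.ofReal (∑ i ∈ Finset.range j, (F K (walk (sh (i * K) ω) K)).toReal) := by
    rw [ENNReal.ofReal_sum_of_nonneg fun _ _ => ENNReal.toReal_nonneg]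
    exact Finset.sum_congr rfl fun i _ => (ENNReal.ofReal_toReal (h1 i)).symm
  rw [this]
  apply ENNReal.ofReal_le_ofReal
  push_cast
  linarith

lemma walk_lower (hP : IsRWMeasure p P) {F : ℕ → G → ℝ≥0∞} (F0 : F 0 1 = 0)
    (hsub : ∀ m n g h, F (m + n) (g * h) ≤ F m g + F n h) {E : ℕ → ℝ} (hE0 : ∀ n, 0 ≤ E n)
    (hE : ∀ n, ∑' g, piN p n g * F n g = ENNReal.ofReal (E n)) {L : ℝ}
    (hL : Tendsto (fun n : ℕ => E n / n) atTop (𝓝 L)) :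
    ∀ᵐ ω ∂P, ∀ ε : ℝ, 0 < ε → ∀ᶠ n : ℕ in atTop,
      ENNReal.ofReal ((L - ε) * n) ≤ F n (walk ω n) := by
  haveI := hP.1
  have hL0 : 0 ≤ L := ge_of_tendsto' hL fun n => div_nonneg (hE0 n) (Nat.cast_nonneg n)
  set f : ℕ → (ℕ → G) → ℝ≥0∞ := fun n ω => F n (walk ω n) with hf
  have hfm : ∀ n, Measurable (f n) := fun n => (meas_disc (F n)).comp (measurable_walk n)
  have hfi : ∀ n, ∫⁻ ω, f n ω ∂P = ENNReal.ofReal (E n) := fun n =>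
    (rw_lintegral_walk hP n (F n)).trans (hE n)
  have f0 : ∀ ω, f 0 ω = 0 := fun ω => by simp [hf, walk_zero, F0]
  have hfsub : ∀ m n ω, f (m + n) ω ≤ f m ω + f n ((sh 1)^[m] ω) := by
    intro m n ω
    rw [sh_iterate]
    simp only [hf, walk_add]
    exact hsub _ _ _ _
  -- linear lower bound on expectations
  have hmul : ∀ j n : ℕ, E (j * n) ≤ j * E n := by
    intro j n
    have h1 : ∫⁻ ω, f (j * n) ω ∂P ≤ j * ∫⁻ ω, f n ω ∂P := by
      calc ∫⁻ ω, f (j * n) ω ∂P ≤ ∫⁻ ω, ∑ i ∈ Finset.range j, f n (sh (i * n) ω) ∂P :=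
            lintegral_mono fun ω => F_blocks F0 hsub n j ω
        _ = ∑ i ∈ Finset.range j, ∫⁻ ω, f n (sh (i * n) ω) ∂P :=
            lintegral_finsetSum _ fun i _ => (hfm n).comp (measurable_sh _)
        _ = ∑ i ∈ Finset.range j, ∫⁻ ω, f n ω ∂P :=
            Finset.sum_congr rfl fun i _ => (rw_sh hP (i * n)).lintegral_comp (hfm n)
        _ = _ := by simp
    rw [hfi, hfi, ← ENNReal.ofReal_natCast, ← ENNReal.ofReal_mul (Nat.cast_nonneg j)] at h1
    exact (ENNReal.ofReal_le_ofReal_iff (mul_nonneg (Nat.cast_nonneg j) (hE0 n))).1 h1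
  have hEL : ∀ n : ℕ, (n : ℝ) * L ≤ E n := by
    intro n
    rcases Nat.eq_zero_or_pos n with rfl | hn
    · simpa using hE0 0
    have hnr : (0 : ℝ) < n := by exact_mod_cast hn
    have ht : Tendsto (fun j : ℕ => j * n) atTop atTop :=
      Filter.tendsto_atTop_mono (fun j => Nat.le_mul_of_pos_right j hn) tendsto_id
    have := le_of_tendsto (hL.comp ht) (b := E n / n) (by
      filter_upwards [eventually_gt_atTop 0] with j hj
      have hjr : (0 : ℝ) < j := by exact_mod_cast hj
      simp only [Function.comp]
      push_cast
      rw [div_le_div_iff₀ (by positivity) hnr]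
      nlinarith [hmul j n])
    rw [le_div_iff₀ hnr] at this
    linarith
  have hT : MeasurePreserving (sh 1) P P := rw_sh hP 1
  have hk := kingman_lower hT hfm f0 hfsub (by rw [hfi]; exact ENNReal.ofReal_ne_top)
    (ENNReal.ofReal L) (fun n => by
      rw [hfi, ← ENNReal.ofReal_natCast, ← ENNReal.ofReal_mul (Nat.cast_nonneg n)]
      exact ENNReal.ofReal_le_ofReal (hEL n))
  set X : (ℕ → G) → ℝ≥0∞ := fun ω => liminf (fun n : ℕ => f n ω / n) atTop with hX
  have hXm : Measurable X := Measurable.liminf fun n => (hfm n).div_const _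
  have hXle : ∀ᵐ ω ∂P, X ω ≤ ENNReal.ofReal L := by
    have : ∀ k : ℕ, ∀ᵐ ω ∂P, X ω ≤ ENNReal.ofReal (L + 1 / (k + 1 : ℝ)) := by
      intro k
      obtain ⟨K0, hK0⟩ := walk_upper hP F0 hsub hE0 hE hL (show (0 : ℝ) < 1 / (k + 1 : ℝ) by
        positivity)
      filter_upwards [hK0 (K0 + 1) (Nat.le_succ _)] with ω hω
      refine Filter.liminf_le_of_frequently_le' ?_
      have ht : Tendsto (fun j : ℕ => j * (K0 + 1)) atTop atTop :=
        Filter.tendsto_atTop_mono (fun j => Nat.le_mul_of_pos_right j (Nat.succ_pos K0)) tendsto_id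
      refine ht.frequently (Eventually.frequently ?_)
      filter_upwards [hω, eventually_gt_atTop 0] with j hj hj0
      refine ENNReal.div_le_of_le_mul (hj.trans ?_)
      rw [ENNReal.ofReal_mul (by positivity), ENNReal.ofReal_natCast]
    rw [← ae_all_iff] at this
    filter_upwards [this] with ω hω
    have ht : Tendsto (fun k : ℕ => ENNReal.ofReal (L + 1 / (k + 1 : ℝ))) atTop
        (𝓝 (ENNReal.ofReal (L + 0))) :=
      (ENNReal.continuous_ofReal.tendsto _).comp
        (tendsto_const_nhds.add tendsto_one_div_add_atTop_nhds_zero_nat)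
    rw [add_zero] at ht
    exact ge_of_tendsto' ht hω
  have hXeq : X =ᵐ[P] fun _ => ENNReal.ofReal L := by
    refine ae_eq_of_ae_le_of_lintegral_le hXle ?_ aemeasurable_const ?_
    · refine ne_top_of_le_ne_top (b := ENNReal.ofReal L) ENNReal.ofReal_ne_top ?_
      calc ∫⁻ ω, X ω ∂P ≤ ∫⁻ _, ENNReal.ofReal L ∂P := lintegral_mono_ae hXle
        _ = _ := by simp
    · simpa using hk
  filter_upwards [hXeq] with ω hω ε hε
  rcases le_or_gt L ε with h | h
  · refine Eventually.of_forall fun n => ?_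
    rw [ENNReal.ofReal_of_nonpos (mul_nonpos_of_nonpos_of_nonneg (by linarith)
      (Nat.cast_nonneg n))]
    exact zero_le
  · have hlt : ENNReal.ofReal (L - ε) < X ω := by
      rw [hω]; exact (ENNReal.ofReal_lt_ofReal_iff (by linarith)).2 (by linarith)
    have := Filter.eventually_lt_of_lt_liminf hlt (by isBoundedDefault)
    filter_upwards [this, eventually_gt_atTop 0] with n hn hn0
    rw [ENNReal.ofReal_mul (by linarith), ENNReal.ofReal_natCast]
    exact ((ENNReal.le_div_iff_mul_le (Or.inl (by exact_mod_cast hn0.ne'))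
      (Or.inl (ENNReal.natCast_ne_top n))).1 hn.le)

end Erg

/-! ### Moments and entropies as expectations -/

section Fun
variable {G : Type*} [Group G] [Countable G] [MeasurableSpace G] [DiscreteMeasurableSpace G]
variable {p : G → ℝ≥0∞} {P : Measure (ℕ → G)}

/-- A length function. -/
def IsLen (d : G → ℝ) : Prop := (∀ g, 0 ≤ d g) ∧ d 1 = 0 ∧ ∀ g h, d (g * h) ≤ d g + d h

/-- Exponential growth bound. -/
def LenGrowth (d : G → ℝ) (A : ℝ) : Prop := 0 ≤ A ∧ ∀ R : ℝ, 0 ≤ R →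
    ∃ F : Finset G, (∀ x, d x ≤ R → x ∈ F) ∧ (F.card : ℝ) ≤ Real.exp (A * (R + 1))

lemma isLen_dist [MetricSpace G] (h : LeftInvariantMetric G) : IsLen (fun g : G => dist 1 g) := by
  refine ⟨fun g => dist_nonneg, dist_self _, fun g k => ?_⟩
  have h1 := h g 1 k
  rw [mul_one] at h1
  calc dist 1 (g * k) ≤ dist 1 g + dist g (g * k) := dist_triangle _ _ _
    _ = _ := by rw [h1]

lemma len_moment (hP : IsRWMeasure p P) {d : G → ℝ} (hd : IsLen d) (hm : FiniteFirstMoment p d)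
    (n : ℕ) : ∑' g, piN p n g * ENNReal.ofReal (d g) ≠ ∞ := by
  rw [← rw_lintegral_walk hP n]
  have hb : ∀ ω : ℕ → G, ENNReal.ofReal (d (walk ω n)) ≤
      ∑ i ∈ Finset.range n, ENNReal.ofReal (d (walk (sh i ω) 1)) := by
    intro ω
    have := F_blocks (F := fun _ g => ENNReal.ofReal (d g)) (by simp [hd.2.1])
      (fun m n g h => by
        rw [← ENNReal.ofReal_add (hd.1 _) (hd.1 _)]
        exact ENNReal.ofReal_le_ofReal (hd.2.2 g h)) 1 n ω
    simpa using this
  refine ((lintegral_mono hb).trans_lt ?_).ne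
  have hmeas : ∀ i, Measurable fun ω : ℕ → G => ENNReal.ofReal (d (walk (sh i ω) 1)) := fun i =>
    (meas_disc (fun g => ENNReal.ofReal (d g))).comp ((measurable_walk 1).comp (measurable_sh i))
  rw [lintegral_finsetSum _ fun i _ => hmeas i]
  refine ENNReal.sum_lt_top.2 fun i _ => ?_
  have h1 : ∫⁻ ω, ENNReal.ofReal (d (walk (sh i ω) 1)) ∂P =
      ∫⁻ ω, ENNReal.ofReal (d (walk ω 1)) ∂P :=
    (rw_sh hP i).lintegral_comp ((meas_disc (fun g => ENNReal.ofReal (d g))).comp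
      (measurable_walk 1))
  rw [h1, rw_lintegral_walk hP 1 (fun g => ENNReal.ofReal (d g))]
  have h2 : piN p 1 = p := by
    funext g
    rw [← rw_walk hP 1 g]
    simp only [walk_one]
    exact rw_single hP g
  rw [h2]
  exact lt_top_iff_ne_top.2 hm

lemma momentSeq_nonneg {d : G → ℝ} (hd : IsLen d) (n : ℕ) : 0 ≤ momentSeq p d n :=
  tsum_nonneg fun g => mul_nonneg ENNReal.toReal_nonneg (hd.1 g)

lemma piN_ne_top (hP : IsRWMeasure p P) (n : ℕ) (g : G) : piN p n g ≠ ∞ :=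
  ne_top_of_le_ne_top ENNReal.one_ne_top (piN_le_one hP n g)

lemma tsum_moment (hP : IsRWMeasure p P) {d : G → ℝ} (hd : IsLen d) (hm : FiniteFirstMoment p d)
    (n : ℕ) : ∑' g, piN p n g * ENNReal.ofReal (d g) = ENNReal.ofReal (momentSeq p d n) := by
  have h1 := len_moment hP hd hm n
  have h2 : ∀ g, (piN p n g * ENNReal.ofReal (d g)).toReal = (piN p n g).toReal * d g := fun g => by
    rw [ENNReal.toReal_mul, ENNReal.toReal_ofReal (hd.1 g)]
  rw [momentSeq, ← tsum_congr h2, ← ENNReal.tsum_toReal_eq, ENNReal.ofReal_toReal h1]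
  exact fun g => ne_top_of_le_ne_top h1 (ENNReal.le_tsum g)

lemma summable_moment (hP : IsRWMeasure p P) {d : G → ℝ} (hd : IsLen d)
    (hm : FiniteFirstMoment p d) (n : ℕ) : Summable fun g => (piN p n g).toReal * d g := by
  have h1 := ENNReal.summable_toReal (len_moment hP hd hm n)
  refine h1.congr fun g => ?_
  rw [ENNReal.toReal_mul, ENNReal.toReal_ofReal (hd.1 g)]

lemma sum_exp_ne_top {d : G → ℝ} (hd : IsLen d) {A : ℝ} (hA : LenGrowth d A) :
    ∑' g, ENNReal.ofReal (Real.exp (-((A + 1) * d g))) ≠ ∞ := by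
  have h1 : ∀ g, ENNReal.ofReal (Real.exp (-((A + 1) * d g))) =
      ∑' k : ℕ, if k = ⌊d g⌋₊ then ENNReal.ofReal (Real.exp (-((A + 1) * d g))) else 0 := fun g => by
    rw [tsum_ite_eq]
  rw [tsum_congr h1, ENNReal.tsum_comm]
  have h2 : ∀ k : ℕ, (∑' g, if k = ⌊d g⌋₊ then ENNReal.ofReal (Real.exp (-((A + 1) * d g))) else 0)
      ≤ ENNReal.ofReal (Real.exp (2 * A) * Real.exp (-k)) := by
    intro k
    obtain ⟨F, hF, hc⟩ := hA.2 (k + 1) (by positivity)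
    rw [tsum_eq_sum (s := F)]
    · calc _ ≤ ∑ g ∈ F, ENNReal.ofReal (Real.exp (-((A + 1) * k))) := by
            refine Finset.sum_le_sum fun g _ => ?_
            split_ifs with h
            · refine ENNReal.ofReal_le_ofReal (Real.exp_le_exp.2 ?_)
              have : (k : ℝ) ≤ d g := by rw [h]; exact Nat.floor_le (hd.1 g)
              have := mul_le_mul_of_nonneg_left this (show 0 ≤ A + 1 by linarith [hA.1])
              linarith
            · exact bot_le
        _ = ENNReal.ofReal (F.card * Real.exp (-((A + 1) * k))) := by
            rw [Finset.sum_const, nsmul_eq_mul, ENNReal.ofReal_mul (by positivity),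
              ENNReal.ofReal_natCast]
        _ ≤ _ := by
            refine ENNReal.ofReal_le_ofReal ?_
            refine (mul_le_mul_of_nonneg_right hc (Real.exp_pos _).le).trans ?_
            rw [← Real.exp_add, ← Real.exp_add]
            exact Real.exp_le_exp.2 (by linarith)
    · intro g hg
      rw [if_neg]
      rintro rfl
      exact hg (hF g (Nat.lt_floor_add_one _).le)
  refine ne_top_of_le_ne_top ?_ (ENNReal.tsum_le_tsum h2)
  rw [← ENNReal.ofReal_tsum_of_nonneg (fun k => by positivity)
    (Real.summable_exp_neg_nat.mul_left _)]
  exact ENNReal.ofReal_ne_top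

lemma negMulLog_le_aux {q t : ℝ} (hq : 0 ≤ q) : Real.negMulLog q ≤ q * t + Real.exp (-t) := by
  rcases hq.eq_or_lt with rfl | hq
  · simp; positivity
  have h1 := Real.add_one_le_exp (-t - Real.log q)
  have h2 : Real.exp (-t) = q * Real.exp (-t - Real.log q) := by
    rw [Real.exp_sub, Real.exp_log hq]; field_simp
  rw [h2, Real.negMulLog]
  nlinarith

/-- Minus the logarithm of the `n`-step transition probability. -/
def entF (p : G → ℝ≥0∞) (n : ℕ) (g : G) : ℝ≥0∞ :=
  if piN p n g = 0 then ∞ else ENNReal.ofReal (-Real.log (piN p n g).toReal)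

lemma entF_zero : entF p 0 (1 : G) = 0 := by simp [entF, piN]

lemma piN_toReal_le (hP : IsRWMeasure p P) (n : ℕ) (g : G) : (piN p n g).toReal ≤ 1 :=
  ENNReal.toReal_le_of_le_ofReal zero_le_one (by simpa using piN_le_one hP n g)

lemma piN_mul_entF (hP : IsRWMeasure p P) (n : ℕ) (g : G) :
    piN p n g * entF p n g = ENNReal.ofReal (Real.negMulLog (piN p n g).toReal) := by
  unfold entF
  split_ifs with h
  · simp [h]
  · conv_lhs => rw [← ENNReal.ofReal_toReal (piN_ne_top hP n g)]
    rw [← ENNReal.ofReal_mul ENNReal.toReal_nonneg, Real.negMulLog]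
    congr 1; rw [ENNReal.toReal_ofReal ENNReal.toReal_nonneg]; ring

lemma piN_mul_le (hP : IsRWMeasure p P) (m n : ℕ) (g h : G) :
    piN p m g * piN p n h ≤ piN p (m + n) (g * h) := by
  haveI := hP.1
  rw [← rw_walk hP m g, ← rw_walk hP n h, ← rw_walk hP (m + n),
    rw_cat_apply hP m (measurableSet_walk (m + n) (g * h)), ← Measure.prod_prod]
  refine measure_mono ?_
  rintro ⟨a, b⟩ ⟨h1, h2⟩
  simp only [Set.mem_setOf_eq] at h1 h2
  simp only [Set.mem_preimage, Set.mem_setOf_eq, walk_cat_add, h1, h2]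

lemma entF_sub (hP : IsRWMeasure p P) (m n : ℕ) (g h : G) :
    entF p (m + n) (g * h) ≤ entF p m g + entF p n h := by
  by_cases h1 : piN p m g = 0
  · simp [entF, h1]
  by_cases h2 : piN p n h = 0
  · simp [entF, h2]
  have h3 := piN_mul_le hP m n g h
  have h4 : piN p (m + n) (g * h) ≠ 0 := fun h0 => by
    rw [h0] at h3
    exact (mul_ne_zero h1 h2) (le_antisymm h3 bot_le)
  have p1 := ENNReal.toReal_pos h1 (piN_ne_top hP m g)
  have p2 := ENNReal.toReal_pos h2 (piN_ne_top hP n h)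
  simp only [entF, h1, h2, h4, if_false]
  rw [← ENNReal.ofReal_add (neg_nonneg.2 (Real.log_nonpos p1.le (piN_toReal_le hP _ _)))
    (neg_nonneg.2 (Real.log_nonpos p2.le (piN_toReal_le hP _ _)))]
  refine ENNReal.ofReal_le_ofReal ?_
  have h5 := ENNReal.toReal_mono (piN_ne_top hP _ _) h3
  rw [ENNReal.toReal_mul] at h5
  have := Real.log_le_log (mul_pos p1 p2) h5
  rw [Real.log_mul p1.ne' p2.ne'] at this
  linarith

lemma negMulLog_piN_nonneg (hP : IsRWMeasure p P) (n : ℕ) (g : G) :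
    0 ≤ Real.negMulLog (piN p n g).toReal :=
  Real.negMulLog_nonneg ENNReal.toReal_nonneg (piN_toReal_le hP n g)

lemma entropySeq_nonneg (hP : IsRWMeasure p P) (n : ℕ) : 0 ≤ entropySeq p n :=
  tsum_nonneg fun g => negMulLog_piN_nonneg hP n g

lemma tsum_entF (hP : IsRWMeasure p P) {d : G → ℝ} (hd : IsLen d) (hm : FiniteFirstMoment p d)
    {A : ℝ} (hA : LenGrowth d A) (n : ℕ) :
    ∑' g, piN p n g * entF p n g = ENNReal.ofReal (entropySeq p n) := by
  have h0 : ∑' g, ENNReal.ofReal (Real.negMulLog (piN p n g).toReal) ≠ ∞ := by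
    have hb : ∀ g, ENNReal.ofReal (Real.negMulLog (piN p n g).toReal) ≤
        ENNReal.ofReal (A + 1) * (piN p n g * ENNReal.ofReal (d g)) +
          ENNReal.ofReal (Real.exp (-((A + 1) * d g))) := by
      intro g
      refine (ENNReal.ofReal_le_ofReal (negMulLog_le_aux (t := (A + 1) * d g)
        ENNReal.toReal_nonneg)).trans ?_
      refine ENNReal.ofReal_add_le.trans (add_le_add (le_of_eq ?_) le_rfl)
      rw [ENNReal.ofReal_mul ENNReal.toReal_nonneg, ENNReal.ofReal_toReal (piN_ne_top hP n g),
        ENNReal.ofReal_mul (by linarith [hA.1])]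
      ring
    refine ne_top_of_le_ne_top ?_ (ENNReal.tsum_le_tsum hb)
    rw [ENNReal.tsum_add, ENNReal.tsum_mul_left]
    exact ENNReal.add_ne_top.2 ⟨ENNReal.mul_ne_top ENNReal.ofReal_ne_top (len_moment hP hd hm n),
      sum_exp_ne_top hd hA⟩
  rw [tsum_congr (piN_mul_entF hP n), entropySeq]
  have h2 : ∀ g, (ENNReal.ofReal (Real.negMulLog (piN p n g).toReal)).toReal =
      Real.negMulLog (piN p n g).toReal := fun g =>
    ENNReal.toReal_ofReal (negMulLog_piN_nonneg hP n g)
  rw [← tsum_congr h2, ← ENNReal.tsum_toReal_eq, ENNReal.ofReal_toReal h0]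
  exact fun g => ENNReal.ofReal_ne_top

/-- Transition probabilities decay along the walk at the entropy rate. -/
lemma entropy_upper (hP : IsRWMeasure p P) {d : G → ℝ} (hd : IsLen d) (hm : FiniteFirstMoment p d)
    {A : ℝ} (hA : LenGrowth d A) {h : ℝ} (hh : HasEntropy p h) {ε : ℝ} (hε : 0 < ε) :
    ∃ K0 : ℕ, ∀ K, K0 ≤ K → ∀ᵐ ω ∂P, ∀ᶠ j : ℕ in atTop,
      Real.exp (-((h + ε) * (j * K : ℕ))) ≤ (piN p (j * K) (walk ω (j * K))).toReal := by
  have hh0 : 0 ≤ h := ge_of_tendsto' hh fun n =>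
    div_nonneg (entropySeq_nonneg hP n) (Nat.cast_nonneg n)
  obtain ⟨K0, hK0⟩ := walk_upper hP entF_zero (entF_sub hP) (entropySeq_nonneg hP)
    (tsum_entF hP hd hm hA) hh hε
  refine ⟨K0, fun K hK => ?_⟩
  filter_upwards [hK0 K hK] with ω hω
  filter_upwards [hω] with j hj
  unfold entF at hj
  split_ifs at hj with h0
  · exact absurd (top_le_iff.1 hj) ENNReal.ofReal_ne_top
  · have hp := ENNReal.toReal_pos h0 (piN_ne_top hP _ _)
    rw [ENNReal.ofReal_le_ofReal_iff (by positivity)] at hj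
    rw [← Real.le_log_iff_exp_le hp]
    linarith

lemma entropy_lower (hP : IsRWMeasure p P) {d : G → ℝ} (hd : IsLen d) (hm : FiniteFirstMoment p d)
    {A : ℝ} (hA : LenGrowth d A) {h : ℝ} (hh : HasEntropy p h) :
    ∀ᵐ ω ∂P, ∀ ε : ℝ, 0 < ε → ∀ᶠ n : ℕ in atTop,
      (piN p n (walk ω n)).toReal ≤ Real.exp (-((h - ε) * n)) := by
  filter_upwards [walk_lower hP entF_zero (entF_sub hP) (entropySeq_nonneg hP)
    (tsum_entF hP hd hm hA) hh] with ω hω ε hε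
  filter_upwards [hω ε hε] with n hn
  unfold entF at hn
  split_ifs at hn with h0
  · rw [h0]; simp; positivity
  · have hp := ENNReal.toReal_pos h0 (piN_ne_top hP _ _)
    rw [ENNReal.ofReal_le_ofReal_iff
      (neg_nonneg.2 (Real.log_nonpos hp.le (piN_toReal_le hP _ _)))] at hn
    rw [← Real.log_le_iff_le_exp hp]
    linarith

lemma drift_upper (hP : IsRWMeasure p P) {d : G → ℝ} (hd : IsLen d) (hm : FiniteFirstMoment p d)
    {l : ℝ} (hl : HasDrift p d l) {ε : ℝ} (hε : 0 < ε) :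
    ∃ K0 : ℕ, ∀ K, K0 ≤ K → ∀ᵐ ω ∂P, ∀ᶠ j : ℕ in atTop,
      d (walk ω (j * K)) ≤ (l + ε) * (j * K : ℕ) := by
  have hl0 : 0 ≤ l := ge_of_tendsto' hl fun n =>
    div_nonneg (momentSeq_nonneg hd n) (Nat.cast_nonneg n)
  obtain ⟨K0, hK0⟩ := walk_upper hP (F := fun _ g => ENNReal.ofReal (d g)) (by simp [hd.2.1])
    (fun m n g h => by
        rw [← ENNReal.ofReal_add (hd.1 _) (hd.1 _)]
        exact ENNReal.ofReal_le_ofReal (hd.2.2 g h)) (momentSeq_nonneg hd)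
    (tsum_moment hP hd hm) hl hε
  refine ⟨K0, fun K hK => ?_⟩
  filter_upwards [hK0 K hK] with ω hω
  filter_upwards [hω] with j hj
  rwa [ENNReal.ofReal_le_ofReal_iff (by positivity)] at hj

lemma drift_lower (hP : IsRWMeasure p P) {d : G → ℝ} (hd : IsLen d) (hm : FiniteFirstMoment p d)
    {l : ℝ} (hl : HasDrift p d l) :
    ∀ᵐ ω ∂P, ∀ ε : ℝ, 0 < ε → ∀ᶠ n : ℕ in atTop, (l - ε) * n ≤ d (walk ω n) := by
  filter_upwards [walk_lower hP (F := fun _ g => ENNReal.ofReal (d g)) (by simp [hd.2.1])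
    (fun m n g h => by
        rw [← ENNReal.ofReal_add (hd.1 _) (hd.1 _)]
        exact ENNReal.ofReal_le_ofReal (hd.2.2 g h)) (momentSeq_nonneg hd)
    (tsum_moment hP hd hm) hl] with ω hω ε hε
  filter_upwards [hω ε hε] with n hn
  rwa [ENNReal.ofReal_le_ofReal_iff (hd.1 _)] at hn

end Fun

/-! ### Spectral gap -/

section Gap
variable {G : Type*} [Group G] {H : Type*} [NormedAddCommGroup H] [InnerProductSpace ℝ H]
  [CompleteSpace H]

lemma gap_inv (R : G →* (H →L[ℝ] H)) (hR : ∀ g f, ‖R g f‖ = ‖f‖) (g : G) (f : H) :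
    ‖R g⁻¹ f - f‖ = ‖R g f - f‖ := by
  have h1 : R g (R g⁻¹ f) = f := by
    rw [← mul_apply_eq_comp, ← map_mul]; simp
  rw [← hR g (R g⁻¹ f - f), map_sub, h1, norm_sub_rev]

/-- The Dirichlet form. -/
def dirF (R : G →* (H →L[ℝ] H)) (m : G → ℝ) (f : H) : ℝ := ∑' s, m s * ‖R s⁻¹ f - f‖ ^ 2

/-- The averaging operator. -/
def avg (R : G →* (H →L[ℝ] H)) (m : G → ℝ) : H →L[ℝ] H := ∑' s, m s • R s⁻¹

lemma norm_R_le (R : G →* (H →L[ℝ] H)) (hR : ∀ g f, ‖R g f‖ = ‖f‖) (g : G) : ‖R g‖ ≤ 1 :=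
  ContinuousLinearMap.opNorm_le_bound _ zero_le_one fun f => by rw [hR, one_mul]

lemma hasSum_avg (R : G →* (H →L[ℝ] H)) (hR : ∀ g f, ‖R g f‖ = ‖f‖) {m : G → ℝ}
    (hm0 : ∀ g, 0 ≤ m g) (hm : HasSum m 1) : HasSum (fun s => m s • R s⁻¹) (avg R m) := by
  refine Summable.hasSum (Summable.of_norm_bounded hm.summable fun s => ?_)
  rw [norm_smul, Real.norm_of_nonneg (hm0 s)]
  exact mul_le_of_le_one_right (hm0 s) (norm_R_le R hR _)

lemma norm_avg_le (R : G →* (H →L[ℝ] H)) (hR : ∀ g f, ‖R g f‖ = ‖f‖) {m : G → ℝ}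
    (hm0 : ∀ g, 0 ≤ m g) (hm : HasSum m 1) : ‖avg R m‖ ≤ 1 := by
  refine tsum_of_norm_bounded hm fun s => ?_
  rw [norm_smul, Real.norm_of_nonneg (hm0 s)]
  exact mul_le_of_le_one_right (hm0 s) (norm_R_le R hR _)

lemma hasSum_avg_apply (R : G →* (H →L[ℝ] H)) (hR : ∀ g f, ‖R g f‖ = ‖f‖) {m : G → ℝ}
    (hm0 : ∀ g, 0 ≤ m g) (hm : HasSum m 1) (f : H) :
    HasSum (fun s => m s • R s⁻¹ f) (avg R m f) := by
  have := (hasSum_avg R hR hm0 hm).mapL (ContinuousLinearMap.apply ℝ H f)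
  simpa using this

lemma hasSum_dirF (R : G →* (H →L[ℝ] H)) (hR : ∀ g f, ‖R g f‖ = ‖f‖) {m : G → ℝ}
    (hm0 : ∀ g, 0 ≤ m g) (hm : HasSum m 1) (f : H) :
    HasSum (fun s => m s * ‖R s⁻¹ f - f‖ ^ 2)
      (2 * ‖f‖ ^ 2 - 2 * inner ℝ f (avg R m f)) := by
  have h1 := (hasSum_avg_apply R hR hm0 hm f).mapL (innerSL ℝ f)
  simp only [innerSL_apply_apply] at h1
  have h2 := (hm.mul_left (2 * ‖f‖ ^ 2)).sub (h1.mul_left 2)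
  rw [mul_one] at h2
  refine h2.congr_fun ?_ |> fun h => h
  intro s
  rw [norm_sub_sq_real, hR, inner_smul_right, real_inner_comm]
  ring

lemma gap_closure (R : G →* (H →L[ℝ] H)) (hR : ∀ g f, ‖R g f‖ = ‖f‖) {m : G → ℝ}
    (hm0 : ∀ g, 0 ≤ m g) (hm : HasSum m 1) {g : G}
    (hg : g ∈ Subgroup.closure {x | m x ≠ 0}) :
    ∃ C : ℝ, 0 ≤ C ∧ ∀ f, ‖R g f - f‖ ≤ C * √(dirF R m f) := by
  induction hg using Subgroup.closure_induction with
  | mem s hs =>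
    have hs' : 0 < m s := lt_of_le_of_ne (hm0 s) (Ne.symm hs)
    refine ⟨√(1 / m s), by positivity, fun f => ?_⟩
    rw [← Real.sqrt_mul (by positivity)]
    apply Real.le_sqrt_of_sq_le
    rw [← gap_inv R hR, one_div, ← div_eq_inv_mul, le_div_iff₀ hs', mul_comm]
    have hS := hasSum_dirF R hR hm0 hm f
    exact hS.summable.le_tsum s (fun t _ => mul_nonneg (hm0 t) (by positivity))
  | one => exact ⟨0, le_rfl, fun f => by simp⟩
  | mul a b _ _ ha hb =>
    obtain ⟨C, hC, h1⟩ := ha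
    obtain ⟨D, hD, h2⟩ := hb
    refine ⟨D + C, by positivity, fun f => ?_⟩
    have e : R (a * b) f - f = R a (R b f - f) + (R a f - f) := by
      rw [map_mul, mul_apply_eq_comp, map_sub]; abel
    rw [e, add_mul]
    refine (norm_add_le _ _).trans (add_le_add ?_ (h1 f))
    rw [hR]; exact h2 f
  | inv a _ ha =>
    obtain ⟨C, hC, h1⟩ := ha
    exact ⟨C, hC, fun f => by rw [gap_inv R hR]; exact h1 f⟩

lemma dirF_nonneg (R : G →* (H →L[ℝ] H)) {m : G → ℝ}
    (hm0 : ∀ g, 0 ≤ m g) (f : H) : 0 ≤ dirF R m f :=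
  tsum_nonneg fun s => mul_nonneg (hm0 s) (by positivity)

lemma gap_main (R : G →* (H →L[ℝ] H)) (hR : ∀ g f, ‖R g f‖ = ‖f‖) {m : G → ℝ}
    (hm0 : ∀ g, 0 ≤ m g) (hm : HasSum m 1) {a b : G}
    (ha : a ∈ Subgroup.closure {x | m x ≠ 0}) (hb : b ∈ Subgroup.closure {x | m x ≠ 0})
    {C : ℝ} (hab : ∀ f, ‖f‖ ^ 2 ≤ C * (‖R a f - f‖ ^ 2 + ‖R b f - f‖ ^ 2)) :
    ∃ ρ : ℝ, 0 ≤ ρ ∧ ρ < 1 ∧ ‖(1 / 2 : ℝ) • (1 + avg R m)‖ ≤ ρ := by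
  obtain ⟨A, hA, h1⟩ := gap_closure R hR hm0 hm ha
  obtain ⟨B, hB, h2⟩ := gap_closure R hR hm0 hm hb
  set D := max C 0 * (A ^ 2 + B ^ 2) + 1 with hD
  have hD1 : 1 ≤ D := by rw [hD]; have := le_max_right C 0; nlinarith [mul_nonneg this (by positivity : 0 ≤ A ^ 2 + B ^ 2)]
  have h3 : ∀ f, ‖f‖ ^ 2 ≤ D * dirF R m f := by
    intro f
    have hq := dirF_nonneg R hm0 f
    have e1 : ‖R a f - f‖ ^ 2 ≤ A ^ 2 * dirF R m f := by
      have := pow_le_pow_left₀ (norm_nonneg _) (h1 f) 2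
      rwa [mul_pow, Real.sq_sqrt hq] at this
    have e2 : ‖R b f - f‖ ^ 2 ≤ B ^ 2 * dirF R m f := by
      have := pow_le_pow_left₀ (norm_nonneg _) (h2 f) 2
      rwa [mul_pow, Real.sq_sqrt hq] at this
    calc ‖f‖ ^ 2 ≤ C * (‖R a f - f‖ ^ 2 + ‖R b f - f‖ ^ 2) := hab f
      _ ≤ max C 0 * (‖R a f - f‖ ^ 2 + ‖R b f - f‖ ^ 2) := by
        gcongr; exact le_max_left _ _
      _ ≤ max C 0 * (A ^ 2 * dirF R m f + B ^ 2 * dirF R m f) := by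
        gcongr
      _ ≤ _ := by rw [hD]; nlinarith
  have hc : 1 / D ≤ 1 := (div_le_one (by linarith)).2 hD1
  have hc0 : 0 < 1 / D := by positivity
  refine ⟨√(1 - 1 / (4 * D)), Real.sqrt_nonneg _, ?_, ?_⟩
  · rw [Real.sqrt_lt' one_pos]
    have : 0 < 1 / (4 * D) := by positivity
    linarith
  refine ContinuousLinearMap.opNorm_le_bound _ (Real.sqrt_nonneg _) fun f => ?_
  have h4 : dirF R m f = 2 * ‖f‖ ^ 2 - 2 * inner ℝ f (avg R m f) :=
    (hasSum_dirF R hR hm0 hm f).tsum_eq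
  have h5 : ‖avg R m f‖ ≤ ‖f‖ := by
    have := (avg R m).le_of_opNorm_le (norm_avg_le R hR hm0 hm) f
    simpa using this
  have h6 : ‖f‖ ^ 2 / D ≤ dirF R m f := by
    rw [div_le_iff₀ (by linarith)]; linarith [h3 f]
  have h7 := norm_add_sq_real f (avg R m f)
  have h8 := pow_le_pow_left₀ (norm_nonneg _) h5 2
  have h9 : 1 / (4 * D) = (1 / D) / 4 := by field_simp
  have h10 : ‖f‖ ^ 2 / D = (1 / D) * ‖f‖ ^ 2 := by ring
  have h11 : 0 ≤ 1 - 1 / (4 * D) := by rw [h9]; linarith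
  have e : ((1 / 2 : ℝ) • (1 + avg R m)) f = (1 / 2 : ℝ) • (f + avg R m f) := by simp
  rw [e, norm_smul, Real.norm_of_nonneg (by norm_num)]
  rw [← Real.sqrt_sq (norm_nonneg f), ← Real.sqrt_mul h11]
  apply Real.le_sqrt_of_sq_le
  rw [mul_pow, h7, h9]
  rw [h10] at h6
  nlinarith [sq_nonneg ‖f‖]

end Gap

/-! ### The regular representation -/

section Reg
variable {G : Type*} [Group G]

/-- Square summable functions. -/
abbrev L2 (G : Type*) := lp (fun _ : G => ℝ) 2

lemma L2_hasSum (f : L2 G) : HasSum (fun x => f x ^ 2) (‖f‖ ^ 2) := by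
  have := lp.hasSum_inner (𝕜 := ℝ) f f
  rw [real_inner_self_eq_norm_sq] at this
  refine this.congr_fun ?_
  intro x
  rw [real_inner_self_eq_norm_sq, Real.norm_eq_abs, sq_abs]

lemma memL2_iff (f : G → ℝ) : Memℓp f 2 ↔ Summable fun x => f x ^ 2 := by
  rw [memℓp_gen_iff (by norm_num)]
  simp

/-- Right translation. -/
def regFun (g : G) (f : L2 G) : L2 G :=
  ⟨fun x => f (x * g), (memL2_iff _).2
    ((Equiv.mulRight g).summable_iff (f := fun x => f x ^ 2) |>.2 (L2_hasSum f).summable)⟩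

lemma regFun_apply (g : G) (f : L2 G) (x : G) : regFun g f x = f (x * g) := rfl

lemma norm_regFun (g : G) (f : L2 G) : ‖regFun g f‖ = ‖f‖ := by
  have h1 := L2_hasSum (regFun g f)
  have h2 := ((Equiv.mulRight g).hasSum_iff (f := fun x => f x ^ 2)).2 (L2_hasSum f)
  have := h1.unique h2
  exact (pow_left_inj₀ (norm_nonneg _) (norm_nonneg _) two_ne_zero).1 this

/-- The right regular representation. -/
def reg : G →* (L2 G →L[ℝ] L2 G) where
  toFun g := LinearMap.mkContinuous
    { toFun := regFun g
      map_add' := fun f h => by ext x; simp [regFun_apply]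
      map_smul' := fun c f => by ext x; simp [regFun_apply] } 1
    (fun f => by
      change ‖regFun g f‖ ≤ 1 * ‖f‖
      rw [norm_regFun, one_mul])
  map_one' := by
    ext f x
    change f (x * 1) = f x
    rw [mul_one]
  map_mul' a b := by
    ext f x
    change f (x * (a * b)) = f (x * a * b)
    rw [mul_assoc]

lemma reg_apply (g : G) (f : L2 G) (x : G) : reg g f x = f (x * g) := rfl

lemma norm_reg (g : G) (f : L2 G) : ‖reg g f‖ = ‖f‖ := norm_regFun g f

/-- The word coordinate along cosets of a free subgroup. -/
lemma exists_wordCoord (φ : FreeGroup (Fin 2) →* G) (hφ : Function.Injective φ) :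
    ∃ V : G → FreeGroup (Fin 2), ∀ x u, V (x * (φ u)⁻¹) = u * V x := by
  have h : ∀ x : G, ∃ u, φ u = x⁻¹ * (Quotient.out (x : G ⧸ φ.range)) := by
    intro x
    obtain ⟨⟨h, u, hu⟩, hh⟩ := QuotientGroup.mk_out_eq_mul φ.range x
    refine ⟨u, ?_⟩
    rw [hh, hu]; simp
  choose V hV using h
  refine ⟨V, fun x u => hφ ?_⟩
  have e : ((x * (φ u)⁻¹ : G) : G ⧸ φ.range) = x := by
    rw [QuotientGroup.eq]
    exact ⟨u, by simp⟩
  rw [hV, e, map_mul, hV]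
  simp [mul_assoc]

lemma nonamenable_key {f : G → ℝ} (hf : Summable fun x => f x ^ 2) (a : G) {E E' : Set G}
    (h1 : ∀ x, x ∉ E' → x * a⁻¹ ∈ E) (hg : Summable fun x => (f (x * a) - f x) ^ 2) :
    ∑' x, f x ^ 2 ≤ ∑' x, E'.indicator (fun x => f x ^ 2) x +
      ∑' x, E.indicator (fun x => f x ^ 2) x +
      5 * ∑' x, (f (x * a) - f x) ^ 2 + 1 / 4 * ∑' x, f x ^ 2 := by
  have hs : ∀ S : Set G, Summable (S.indicator fun x => f x ^ 2) := fun S => hf.indicator S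
  have hr : Summable fun x => f (x * a) ^ 2 :=
    (Equiv.mulRight a).summable_iff (f := fun x => f x ^ 2) |>.2 hf
  have hra := hr.indicator E
  have h2 : ∑' x, E.indicator (fun x => f (x * a) ^ 2) x =
      ∑' x, E.indicator (fun x => f (x * a) ^ 2) (x * a⁻¹) :=
    ((Equiv.mulRight a⁻¹).tsum_eq (E.indicator (fun x => f (x * a) ^ 2))).symm
  have hra' : Summable fun x => E.indicator (fun x => f (x * a) ^ 2) (x * a⁻¹) :=
    (Equiv.mulRight a⁻¹).summable_iff (f := E.indicator (fun x => f (x * a) ^ 2)) |>.2 hra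
  have h3 : ∑' x, f x ^ 2 ≤ ∑' x, E'.indicator (fun x => f x ^ 2) x +
      ∑' x, E.indicator (fun x => f (x * a) ^ 2) x := by
    rw [h2, ← (hs E').tsum_add hra']
    refine hf.tsum_le_tsum (fun x => ?_) ((hs _).add hra')
    by_cases hx : x ∈ E'
    · rw [Set.indicator_of_mem hx]
      have : 0 ≤ E.indicator (fun x => f (x * a) ^ 2) (x * a⁻¹) :=
        Set.indicator_nonneg (fun _ _ => sq_nonneg _) _
      linarith
    · rw [Set.indicator_of_notMem hx, Set.indicator_of_mem (h1 x hx)]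
      simp
  have h4 : ∑' x, E.indicator (fun x => f (x * a) ^ 2) x ≤
      ∑' x, E.indicator (fun x => f x ^ 2) x + 5 * ∑' x, (f (x * a) - f x) ^ 2 +
        1 / 4 * ∑' x, f x ^ 2 := by
    rw [← tsum_mul_left, ← tsum_mul_left,
      ← (hs E).tsum_add (hg.mul_left 5),
      ← ((hs E).add (hg.mul_left 5)).tsum_add (hf.mul_left (1 / 4))]
    refine hra.tsum_le_tsum (fun x => ?_)
      (((hs _).add (hg.mul_left 5)).add (hf.mul_left (1 / 4)))
    by_cases hx : x ∈ E
    · rw [Set.indicator_of_mem hx, Set.indicator_of_mem hx]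
      nlinarith [sq_nonneg (2 * (f (x * a) - f x) - (1 / 2) * f x)]
    · rw [Set.indicator_of_notMem hx, Set.indicator_of_notMem hx]
      positivity
  linarith

lemma nonamenable_tot {f : G → ℝ} (hf : Summable fun x => f x ^ 2) (E : Fin 2 × Bool → Set G)
    (hd : ∀ x w w', x ∈ E w → x ∈ E w' → w = w') :
    ∑' x, (E (0, false)).indicator (fun x => f x ^ 2) x +
      ∑' x, (E (0, true)).indicator (fun x => f x ^ 2) x +
      ∑' x, (E (1, false)).indicator (fun x => f x ^ 2) x +
      ∑' x, (E (1, true)).indicator (fun x => f x ^ 2) x ≤ ∑' x, f x ^ 2 := by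
  have hs : ∀ S : Set G, Summable (S.indicator fun x => f x ^ 2) := fun S => hf.indicator S
  rw [← (hs _).tsum_add (hs _), ← ((hs _).add (hs _)).tsum_add (hs _),
    ← (((hs _).add (hs _)).add (hs _)).tsum_add (hs _)]
  refine Summable.tsum_le_tsum (fun x => ?_) ((((hs _).add (hs _)).add (hs _)).add (hs _)) hf
  by_cases hex : ∃ w, x ∈ E w
  · obtain ⟨w, hw⟩ := hex
    have hi : ∀ w', (E w').indicator (fun x => f x ^ 2) x = if w = w' then f x ^ 2 else 0 := by
      intro w'
      split_ifs with h
      · rw [← h, Set.indicator_of_mem hw]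
      · exact Set.indicator_of_notMem (fun h' => h (hd _ _ _ hw h')) _
    simp only [hi]
    rcases w with ⟨i, b⟩
    fin_cases i <;> cases b <;> simp
  · push Not at hex
    simp only [Set.indicator_of_notMem (hex _)]
    simp; positivity

lemma nonamenable (φ : FreeGroup (Fin 2) →* G) (hφ : Function.Injective φ) (f : L2 G) :
    ‖f‖ ^ 2 ≤ 10 * (‖reg (φ (FreeGroup.mk [(0, true)])) f - f‖ ^ 2 +
      ‖reg (φ (FreeGroup.mk [(1, true)])) f - f‖ ^ 2) := by
  obtain ⟨V, hV⟩ := exists_wordCoord φ hφ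
  set E : Fin 2 × Bool → Set G := fun w => {x | V x ∈ FreeGroup.startsWith w} with hE
  have hf := L2_hasSum f
  have hd : ∀ x w w', x ∈ E w → x ∈ E w' → w = w' := by
    intro x w w' h h'
    by_contra hne
    exact (Set.disjoint_left.1 (FreeGroup.startsWith.disjoint_iff_ne.2 hne)) h h'
  have h1 : ∀ (i : Fin 2) x, x ∉ E (i, false) →
      x * (φ (FreeGroup.mk [(i, true)]))⁻¹ ∈ E (i, true) := by
    intro i x hx
    have := FreeGroup.startsWith_mk_mul (w := (i, true)) (V x) hx
    rw [← hV] at this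
    exact this
  have hg : ∀ a, HasSum (fun x => (f (x * a) - f x) ^ 2) (‖reg a f - f‖ ^ 2) := fun a =>
    L2_hasSum (reg a f - f)
  have k0 := nonamenable_key hf.summable _ (h1 0) (hg _).summable
  have k1 := nonamenable_key hf.summable _ (h1 1) (hg _).summable
  have k2 := nonamenable_tot hf.summable E hd
  rw [hf.tsum_eq, (hg _).tsum_eq] at k0 k1
  rw [hf.tsum_eq] at k2
  linarith

end Reg

/-! ### Positivity of the drift -/

section DriftPos
variable {G : Type*} [Group G] [Countable G] [MeasurableSpace G] [DiscreteMeasurableSpace G]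
variable {p : G → ℝ≥0∞} {P : Measure (ℕ → G)}

lemma hasSum_piN (hP : IsRWMeasure p P) (n : ℕ) : HasSum (fun g => (piN p n g).toReal) 1 := by
  have h := ENNReal.hasSum_toReal (f := piN p n) (by rw [piN_tsum hP n]; exact ENNReal.one_ne_top)
  rw [← ENNReal.tsum_toReal_eq (piN_ne_top hP n), piN_tsum hP n] at h
  exact h

lemma p_ne_top (hP : IsRWMeasure p P) (g : G) : p g ≠ ∞ :=
  ne_top_of_le_ne_top ENNReal.one_ne_top ((ENNReal.le_tsum g).trans (rw_isProb hP).le)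

lemma hasSum_p (hP : IsRWMeasure p P) : HasSum (fun g => (p g).toReal) 1 := by
  have hp : ∑' g, p g = 1 := rw_isProb hP
  have h := ENNReal.hasSum_toReal (f := p) (by rw [hp]; exact ENNReal.one_ne_top)
  rw [← ENNReal.tsum_toReal_eq (p_ne_top hP), hp] at h
  exact h

lemma avg_pow_apply (hP : IsRWMeasure p P) (k : ℕ) (x : G) :
    ((avg reg (fun g => (p g).toReal)) ^ k) (lp.single 2 (1 : G) (1 : ℝ) : L2 G) x =
      (piN p k x).toReal := by
  induction k generalizing x with
  | zero =>
    simp only [pow_zero, one_apply_eq_self, lp.single_apply, piN, Pi.single_apply]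
    split_ifs <;> simp
  | succ k ih =>
    rw [pow_succ', mul_apply_eq_comp]
    set v := ((avg reg (fun g => (p g).toReal)) ^ k) (lp.single 2 (1 : G) (1 : ℝ) : L2 G)
    have h1 := hasSum_avg_apply (reg (G := G)) norm_reg (fun g => ENNReal.toReal_nonneg)
      (hasSum_p hP) v
    have h2 := h1.mapL (lp.evalCLM ℝ (fun _ : G => ℝ) 2 x)
    have h3 : ∀ s, ((p s).toReal • (reg s⁻¹ v) : L2 G) x =
        (piN p k (x * s⁻¹) * p s).toReal := by
      intro s
      change (p s).toReal * v (x * s⁻¹) = _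
      rw [ih, ENNReal.toReal_mul, mul_comm]
    have h2' : HasSum (fun s => (piN p k (x * s⁻¹) * p s).toReal)
        (avg reg (fun g => (p g).toReal) v x) := h2.congr_fun fun s => (h3 s).symm
    rw [← h2'.tsum_eq, ← ENNReal.tsum_toReal_eq fun s => ENNReal.mul_ne_top (piN_ne_top hP _ _)
      (p_ne_top hP _)]
    congr 1
    change _ = ∑' y, piN p k y * p (y⁻¹ * x)
    let e : G ≃ G := (Equiv.inv G).trans (Equiv.mulLeft x)
    rw [← e.tsum_eq (fun y => piN p k y * p (y⁻¹ * x))]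
    refine tsum_congr fun s => ?_
    simp [e]

lemma lazy_le (hP : IsRWMeasure p P) (hne : IsNonElemMeasure p) :
    ∃ ρ : ℝ, 0 < ρ ∧ ρ < 1 ∧ ∀ (n : ℕ) (x : G),
      ∑ k ∈ Finset.range (n + 1), (1 / 2 : ℝ) ^ n * (n.choose k) * (piN p k x).toReal ≤ ρ ^ n := by
  obtain ⟨φ, hφ, hr⟩ := hne
  have hset : {x : G | p x ≠ 0} = {x : G | (p x).toReal ≠ 0} := by
    ext x
    simp [ENNReal.toReal_eq_zero_iff, p_ne_top hP x]
  rw [hset] at hr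
  have hmem : ∀ u, φ u ∈ Subgroup.closure {x : G | (p x).toReal ≠ 0} := fun u => hr ⟨u, rfl⟩
  obtain ⟨ρ, h0, h1, hρ⟩ := gap_main (reg (G := G)) norm_reg
    (fun g => ENNReal.toReal_nonneg) (hasSum_p hP) (hmem _) (hmem _) (nonamenable φ hφ)
  refine ⟨max ρ (1 / 2), by positivity, max_lt h1 (by norm_num), fun n x => ?_⟩
  set T := avg (reg (G := G)) (fun g => (p g).toReal)
  set δ := (lp.single 2 (1 : G) (1 : ℝ) : L2 G) with hδ
  have e : (((1 / 2 : ℝ) • (1 + T)) ^ n) δ x =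
      ∑ k ∈ Finset.range (n + 1), (1 / 2 : ℝ) ^ n * (n.choose k) * (piN p k x).toReal := by
    rw [smul_pow, add_comm, (Commute.one_right T).add_pow]
    have : ∀ v : L2 G, v x = lp.evalCLM ℝ (fun _ : G => ℝ) 2 x v := fun v => rfl
    rw [this, smul_apply, map_smul, sum_apply, map_sum,
      Finset.smul_sum]
    refine Finset.sum_congr rfl fun k _ => ?_
    rw [one_pow, mul_one, ← nsmul_eq_mul', smul_apply, map_nsmul, ← this,
      avg_pow_apply hP]
    simp [mul_assoc]
  rw [← e]
  calc _ ≤ ‖(((1 / 2 : ℝ) • (1 + T)) ^ n) δ x‖ := Real.le_norm_self _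
    _ ≤ ‖(((1 / 2 : ℝ) • (1 + T)) ^ n) δ‖ := lp.norm_apply_le_norm two_ne_zero _ _
    _ ≤ ‖((1 / 2 : ℝ) • (1 + T)) ^ n‖ * ‖δ‖ := ContinuousLinearMap.le_opNorm _ _
    _ = ‖((1 / 2 : ℝ) • (1 + T)) ^ n‖ := by rw [hδ, lp.norm_single (by norm_num)]; simp
    _ ≤ ‖(1 / 2 : ℝ) • (1 + T)‖ ^ n := by
      rcases n.eq_zero_or_pos with rfl | hn
      · simp only [pow_zero]
        exact ContinuousLinearMap.norm_id_le
      · exact norm_pow_le' _ hn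
    _ ≤ _ := pow_le_pow_left₀ (norm_nonneg _) (hρ.trans (le_max_left _ _)) n

lemma markov_ball (hP : IsRWMeasure p P) {d : G → ℝ} (hd : IsLen d) (hm : FiniteFirstMoment p d)
    {R : ℝ} (hR : 0 ≤ R) {F : Finset G} (hF : ∀ x, d x ≤ R → x ∈ F) (k : ℕ) :
    R - momentSeq p d k ≤ R * ∑ x ∈ F, (piN p k x).toReal := by
  have h1 := (hasSum_piN hP k).mul_left R
  have h2 : HasSum (fun x => if x ∈ F then R * (piN p k x).toReal else 0)
      (∑ x ∈ F, R * (piN p k x).toReal) := by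
    have := hasSum_sum_of_ne_finset_zero (L := SummationFilter.unconditional G) (f := fun x => if x ∈ F then R * (piN p k x).toReal else 0)
      (s := F) (fun x hx => by simp [hx])
    rwa [Finset.sum_congr rfl (fun x hx => if_pos hx)] at this
  have h3 := (summable_moment hP hd hm k).hasSum
  have h4 := hasSum_le (fun x => ?_) (h1.sub h2) h3
  · rw [← Finset.mul_sum, mul_one] at h4
    unfold momentSeq
    linarith
  · have h0 : 0 ≤ (piN p k x).toReal := ENNReal.toReal_nonneg
    split_ifs with h
    · rw [sub_self]; exact mul_nonneg h0 (hd.1 x)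
    · rw [sub_zero, mul_comm]
      refine mul_le_mul_of_nonneg_left ?_ h0
      by_contra hlt
      exact h (hF x (le_of_lt (not_le.1 hlt)))

theorem drift_pos (hP : IsRWMeasure p P) {d : G → ℝ} (hd : IsLen d) (hm : FiniteFirstMoment p d)
    {A : ℝ} (hA : LenGrowth d A) (hne : IsNonElemMeasure p) {l : ℝ} (hl : HasDrift p d l) :
    0 < l := by
  by_contra hneg
  obtain ⟨ρ, h0, h1, hρ⟩ := lazy_le hP hne
  have hlog : Real.log ρ < 0 := Real.log_neg h0 h1
  have hA0 := hA.1
  set ε := -Real.log ρ / (2 * (A + 1)) with hε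
  have hε0 : 0 < ε := div_pos (by linarith) (by linarith)
  have hAε : A * ε + Real.log ρ < 0 := by
    have : (A + 1) * ε = -Real.log ρ / 2 := by rw [hε]; field_simp
    nlinarith
  obtain ⟨N, hN⟩ := eventually_atTop.1 (hl.eventually_lt_const (show l < ε / 4 by linarith))
  set C := ∑ k ∈ Finset.range (N + 1), momentSeq p d k with hC
  have hmk : ∀ k, momentSeq p d k ≤ ε / 4 * k + C := by
    intro k
    have hC0 : 0 ≤ C := Finset.sum_nonneg fun k _ => momentSeq_nonneg hd k
    rcases lt_or_ge k (N + 1) with hk | hk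
    · have := Finset.single_le_sum (fun k _ => momentSeq_nonneg (p := p) hd k)
        (Finset.mem_range.2 hk)
      have : 0 ≤ ε / 4 * k := by positivity
      linarith
    · have h2 := hN k (by omega)
      have hk0 : (0 : ℝ) < k := by exact_mod_cast (by omega : 0 < k)
      rw [div_lt_iff₀ hk0] at h2
      linarith
  have hlim : Tendsto (fun n : ℕ => Real.exp A * Real.exp (A * ε + Real.log ρ) ^ n) atTop (𝓝 0) := by
    have := (tendsto_pow_atTop_nhds_zero_of_lt_one (Real.exp_pos _).le
      (Real.exp_lt_one_iff.2 hAε)).const_mul (Real.exp A)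
    rwa [mul_zero] at this
  have hlim2 : Tendsto (fun n : ℕ => ε * (n : ℝ)) atTop atTop :=
    tendsto_natCast_atTop_atTop.const_mul_atTop hε0
  obtain ⟨n, hn1, hn2⟩ := ((hlim.eventually_lt_const (show (0 : ℝ) < 1 / 4 by norm_num)).and
    (hlim2.eventually_gt_atTop (4 * C + 1))).exists
  have hC0 : 0 ≤ C := Finset.sum_nonneg fun k _ => momentSeq_nonneg hd k
  obtain ⟨F, hF, hcard⟩ := hA.2 (ε * n) (by positivity)
  have hup : ∑ x ∈ F, ∑ k ∈ Finset.range (n + 1), (1 / 2 : ℝ) ^ n * (n.choose k) *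
      (piN p k x).toReal < 1 / 4 := by
    calc _ ≤ ∑ x ∈ F, ρ ^ n := Finset.sum_le_sum fun x _ => hρ n x
      _ = F.card * ρ ^ n := by rw [Finset.sum_const, nsmul_eq_mul]
      _ ≤ Real.exp (A * (ε * n + 1)) * ρ ^ n := by gcongr
      _ = Real.exp A * Real.exp (A * ε + Real.log ρ) ^ n := by
        rw [Real.exp_add, Real.exp_log h0, mul_pow, ← Real.exp_nat_mul, ← mul_assoc,
          ← Real.exp_add]
        congr 2; ring
      _ < _ := hn1
  have hlo : (1 / 2 : ℝ) ≤ ∑ x ∈ F, ∑ k ∈ Finset.range (n + 1), (1 / 2 : ℝ) ^ n * (n.choose k) *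
      (piN p k x).toReal := by
    rw [Finset.sum_comm]
    have hb : ∀ k ∈ Finset.range (n + 1), (1 / 2 : ℝ) ^ n * (n.choose k) * (1 / 2) ≤
        ∑ x ∈ F, (1 / 2 : ℝ) ^ n * (n.choose k) * (piN p k x).toReal := by
      intro k hk
      rw [← Finset.mul_sum]
      refine mul_le_mul_of_nonneg_left ?_ (by positivity)
      have h5 := markov_ball hP hd hm (by positivity : 0 ≤ ε * n) hF k
      have h6 := hmk k
      have hkn : (k : ℝ) ≤ n := by exact_mod_cast (Nat.lt_succ_iff.1 (Finset.mem_range.1 hk))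
      have h7 : ε / 4 * k ≤ ε / 4 * n := by gcongr
      have h8 : 0 < ε * n := by linarith
      by_contra hlt
      push Not at hlt
      have h9 := mul_lt_mul_of_pos_left hlt h8
      linarith
    refine le_trans (le_of_eq ?_) (Finset.sum_le_sum hb)
    rw [← Finset.sum_mul, ← Finset.mul_sum, ← Nat.cast_sum, Nat.sum_range_choose]
    push_cast
    rw [← mul_pow]; norm_num
  linarith

end DriftPos

/-! ### Typical behaviour of sample paths -/

section Typ
variable {G : Type*} [Group G] [Countable G] [MeasurableSpace G] [DiscreteMeasurableSpace G]
variable {p : G → ℝ≥0∞} {P : Measure (ℕ → G)}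

lemma incr_small {x : ℕ → ℝ} {c : ℝ}
    (h : Tendsto (fun n : ℕ => (∑ i ∈ Finset.range n, x i) / n) atTop (𝓝 c)) {η : ℝ} (hη : 0 < η) :
    ∀ᶠ n : ℕ in atTop, x n ≤ η * n := by
  have h1 := h.eventually_lt_const (show c < c + η / 4 by linarith)
  have h2 := h.eventually_const_lt (show c - η / 4 < c by linarith)
  have h3 := (tendsto_add_atTop_nat 1).eventually h1
  have h4 : Tendsto (fun n : ℕ => η / 2 * (n : ℝ)) atTop atTop :=
    tendsto_natCast_atTop_atTop.const_mul_atTop (by linarith)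
  filter_upwards [h2, h3, h4.eventually_gt_atTop (c + η / 4), eventually_gt_atTop 0]
    with n a1 a2 a3 a4
  have hn : (0 : ℝ) < n := by exact_mod_cast a4
  rw [lt_div_iff₀ hn] at a1
  rw [div_lt_iff₀ (by positivity), Finset.sum_range_succ] at a2
  push_cast at a2
  nlinarith

theorem typical [MetricSpace G] (hP : IsRWMeasure p P) (hG : IsHypGroupMetric G)
    (hm : FiniteFirstMoment p (fun g => dist (1 : G) g)) {l : ℝ}
    (hl : HasDrift p (fun g => dist (1 : G) g) l) {ε : ℝ} (hε : 0 < ε) (hεl : ε < l) :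
    ∃ K0 : ℕ, ∀ K, K0 ≤ K → ∀ᵐ ω ∂P, ∀ᶠ j : ℕ in atTop,
      dist 1 (walk ω (j * K)) ≤ (l + ε) * (j * K : ℕ) ∧
      ∀ h : IsDivergent (1 : G) (fun n => walk ω n),
        nearX 1 ((l - ε) * (j * K : ℕ)) (walk ω (j * K)) (mkB 1 ⟨fun n => walk ω n, h⟩) := by
  obtain ⟨hinv, ⟨δ, hδ0, hδ⟩, hqi⟩ := hG
  have hd := isLen_dist hinv
  obtain ⟨K0, hK0⟩ := drift_upper hP hd hm hl hε
  obtain ⟨K1, hK1⟩ := exists_nat_gt (δ / (l - ε / 2))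
  refine ⟨max K0 (K1 + 1), fun K hK => ?_⟩
  have hKpos : 0 < K := lt_of_lt_of_le (Nat.succ_pos K1) ((le_max_right _ _).trans hK)
  have hKr : (0 : ℝ) < K := by exact_mod_cast hKpos
  have hKK : δ ≤ (l - ε / 2) * K := by
    rw [div_lt_iff₀ (by linarith)] at hK1
    have : (K1 : ℝ) ≤ K := by
      exact_mod_cast (Nat.le_succ K1).trans ((le_max_right _ _).trans hK)
    nlinarith
  have hfin : ∑' g, piN p K g * ENNReal.ofReal (dist 1 g) ≠ ∞ := len_moment hP hd hm K
  filter_upwards [hK0 K ((le_max_left _ _).trans hK), drift_lower hP hd hm hl,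
    block_integrable hP K (fun g => ENNReal.ofReal (dist 1 g)) hfin] with ω h1 h2 h3
  have h4 := incr_small h3.2 (show 0 < ε / 4 * K by positivity)
  have htj : Tendsto (fun j : ℕ => j * K) atTop atTop :=
    Filter.tendsto_atTop_mono (fun j => Nat.le_mul_of_pos_right j hKpos) tendsto_id
  have h5 := htj.eventually (h2 (ε / 4) (by linarith))
  set z : ℕ → G := fun i => walk ω (i * K) with hz
  have hdz : ∀ i, dist (z i) (z (i + 1)) = dist 1 (walk (sh (i * K) ω) K) := by
    intro i
    simp only [hz]
    rw [add_mul, one_mul, walk_add]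
    conv_lhs => rw [← mul_one (walk ω (i * K))]
    rw [mul_assoc, one_mul, hinv]
  obtain ⟨N, hN⟩ := eventually_atTop.1 (h4.and h5)
  have hg : ∀ i, N ≤ i → ((l - ε / 2) * K) * i - 0 ≤ gp 1 (z i) (z (i + 1)) := by
    intro i hi
    obtain ⟨a1, a2⟩ := hN i hi
    have a3 := gp_lower 1 (z i) (z (i + 1))
    rw [hdz] at a3
    rw [ENNReal.toReal_ofReal dist_nonneg] at a1
    push_cast at a2
    simp only [hz] at a3 ⊢
    nlinarith
  have h6 : Tendsto (fun j : ℕ => ε / 2 * K * (j : ℝ)) atTop atTop :=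
    tendsto_natCast_atTop_atTop.const_mul_atTop (by positivity)
  filter_upwards [h1, eventually_ge_atTop N, h6.eventually_gt_atTop (2 * δ + 1)] with j b1 b2 b3
  refine ⟨b1, fun h => ?_⟩
  have hfr : ∃ᶠ n in atTop, ((l - ε / 2) * K) * j - δ - 1 < gp 1 (z j) (walk ω n) := by
    rw [frequently_atTop]
    intro n0
    refine ⟨(j + 1 + n0) * K, ?_, ?_⟩
    · calc n0 ≤ j + 1 + n0 := by omega
        _ ≤ _ := Nat.le_mul_of_pos_right _ hKpos
    · have := chain_gp (o := (1 : G)) hδ hδ0 z _ 0 hKK N (j + 1 + n0) (fun i hi _ => hg i hi)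
        n0 j b2 le_rfl
      simp only [hz] at this ⊢
      linarith
  refine (nearX_of_frequently hδ ⟨fun n => walk ω n, h⟩ hfr).mono ?_
  push_cast
  nlinarith

end Typ

/-! ### Densities over a factor and the one-step estimate -/

section Den
variable {Ω B : Type*} [MeasurableSpace Ω] [MeasurableSpace B] {P : Measure Ω}

/-- Density of `A ↦ P (S ∩ η ∈ A)` with respect to the law of `η`. -/
def dens (P : Measure Ω) (η : Ω → B) (S : Set Ω) : B → ℝ≥0∞ :=
  ((P.restrict S).map η).rnDeriv (P.map η)

lemma measurable_dens (η : Ω → B) (S : Set Ω) : Measurable (dens P η S) :=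
  Measure.measurable_rnDeriv _ _

lemma dens_withDensity [IsProbabilityMeasure P] {η : Ω → B} (hη : Measurable η) (S : Set Ω) :
    (P.map η).withDensity (dens P η S) = (P.restrict S).map η := by
  haveI : IsFiniteMeasure (P.map η) := inferInstance
  haveI : IsFiniteMeasure ((P.restrict S).map η) := inferInstance
  refine Measure.withDensity_rnDeriv_eq _ _ ?_
  exact Measure.absolutelyContinuous_of_le (Measure.map_mono Measure.restrict_le_self hη)

lemma dens_lintegral [IsProbabilityMeasure P] {η : Ω → B} (hη : Measurable η) (S : Set Ω)
    {f : B → ℝ≥0∞} (hf : Measurable f) :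
    ∫⁻ ω in S, f (η ω) ∂P = ∫⁻ b, dens P η S b * f b ∂(P.map η) := by
  rw [← lintegral_map hf hη, ← dens_withDensity hη S,
    lintegral_withDensity_eq_lintegral_mul _ (measurable_dens η S) hf]
  rfl

lemma dens_set [IsProbabilityMeasure P] {η : Ω → B} (hη : Measurable η) {S : Set Ω}
    {A : Set B} (hA : MeasurableSet A) :
    P (η ⁻¹' A ∩ S) = ∫⁻ b in A, dens P η S b ∂(P.map η) := by
  rw [← withDensity_apply _ hA, dens_withDensity hη, Measure.map_apply hη hA,
    Measure.restrict_apply (hη hA)]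

lemma dens_le_one [IsProbabilityMeasure P] {η : Ω → B} (hη : Measurable η) (S : Set Ω) :
    ∀ᵐ b ∂(P.map η), dens P η S b ≤ 1 := by
  haveI : IsProbabilityMeasure (P.map η) := Measure.isProbabilityMeasure_map hη.aemeasurable
  refine ae_le_of_forall_setLIntegral_le_of_sigmaFinite (measurable_dens η S) ?_
  intro A hA _
  rw [← dens_set hη hA]
  simp only [lintegral_one, Measure.restrict_apply MeasurableSet.univ, univ_inter]
  rw [Measure.map_apply hη hA]
  exact measure_mono inter_subset_left

lemma dens_int_one [IsProbabilityMeasure P] {η : Ω → B} (hη : Measurable η) (S : Set Ω) :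
    ∫⁻ b, dens P η S b ∂(P.map η) = P S := by
  have := dens_set (P := P) hη (S := S) MeasurableSet.univ
  simpa using this.symm

lemma dens_ratio [IsProbabilityMeasure P] {η : Ω → B} (hη : Measurable η) {S T : Set Ω}
    {a b : ℝ≥0∞} 
    (h : ∀ A : Set B, MeasurableSet A → P (η ⁻¹' A ∩ S) * a = b * P (η ⁻¹' A ∩ T)) :
    ∀ᵐ z ∂(P.map η), dens P η S z * a = b * dens P η T z := by
  haveI : IsProbabilityMeasure (P.map η) := Measure.isProbabilityMeasure_map hη.aemeasurable
  refine ae_eq_of_forall_setLIntegral_eq_of_sigmaFinite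
    ((measurable_dens η S).mul_const a) ((measurable_dens η T).const_mul b) ?_
  intro A hA _
  rw [lintegral_mul_const _ (measurable_dens η S), lintegral_const_mul _ (measurable_dens η T),
    ← dens_set hη hA, ← dens_set hη hA, h A hA]

/-- A countable union bound. -/
lemma meas_le_tsum {ι : Type*} [Countable ι] {w : Ω → ι} {E : Set Ω} {c : ι → ℝ≥0∞}
    (h : ∀ g, P ({ω | w ω = g} ∩ E) ≤ c g) : P E ≤ ∑' g, c g := by
  calc P E ≤ P (⋃ g, {ω | w ω = g} ∩ E) := measure_mono fun ω hω => mem_iUnion.2 ⟨w ω, rfl, hω⟩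
    _ ≤ ∑' g, P ({ω | w ω = g} ∩ E) := measure_iUnion_le _
    _ ≤ _ := ENNReal.tsum_le_tsum h

variable {Γ Γs : Type*} [Countable Γ] [Countable Γs]
  [MeasurableSpace Γ] [DiscreteMeasurableSpace Γ]
  [MeasurableSpace Γs] [DiscreteMeasurableSpace Γs]

theorem oneStep [IsProbabilityMeasure P] {η : Ω → B} (hη : Measurable η)
    {w : Ω → Γ × Γs} (hw : Measurable w)
    {O : Γ → Set Ω} (hO : ∀ x, MeasurableSet (O x))
    {Y : Γs → Set B} (hY : ∀ y, MeasurableSet (Y y))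
    {TX : Set Γ} {TY : Set Γs} {M1 M2 t : ℝ≥0∞}
    (hM1 : ∀ ω, ∑' x : Γ, (if x ∈ TX ∧ ω ∈ O x then (1 : ℝ≥0∞) else 0) ≤ M1)
    (hM2 : ∀ b, ∑' y : Γs, (if y ∈ TY ∧ b ∈ Y y then (1 : ℝ≥0∞) else 0) ≤ M2)
    {pn : Γ × Γs → ℝ≥0∞} {mn : Γs → ℝ≥0∞}
    (hr : ∀ g, ∀ A : Set B, MeasurableSet A →
      P (η ⁻¹' A ∩ {ω | w ω = g}) * mn g.2 = pn g * P (η ⁻¹' A ∩ {ω | (w ω).2 = g.2})) :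
    P {ω | ω ∈ O (w ω).1 ∧ (w ω).1 ∈ TX ∧ (w ω).2 ∈ TY ∧ η ω ∈ Y (w ω).2 ∧
      ¬ (t * t * pn (w ω) ≤ dens P η (O (w ω).1) (η ω) * mn (w ω).2 ∧
        t * (dens P η (O (w ω).1) (η ω) * mn (w ω).2) ≤ pn (w ω))} ≤
      t + t * (M1 * M2) + t * M2 := by
  set a : Γ → B → ℝ≥0∞ := fun x => dens P η (O x) with ha
  set b : Γs → B → ℝ≥0∞ := fun y => dens P η {ω | (w ω).2 = y} with hb
  set c : Γ × Γs → B → ℝ≥0∞ := fun g => dens P η {ω | w ω = g} with hc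
  have hma : ∀ x, Measurable (a x) := fun x => measurable_dens _ _
  have hmb : ∀ x, Measurable (b x) := fun x => measurable_dens _ _
  have hmc : ∀ x, Measurable (c x) := fun x => measurable_dens _ _
  have hwg : ∀ g, MeasurableSet {ω | w ω = g} := fun g =>
    hw (MeasurableSet.of_discrete (s := {g}))
  have hwy : ∀ y, MeasurableSet {ω | (w ω).2 = y} := fun y =>
    (measurable_snd.comp hw) (MeasurableSet.of_discrete (s := {y}))
  have hpr : ∑' g, P {ω | w ω = g} = 1 := by
    rw [← measure_iUnion ?_ hwg]
    · have : (⋃ g, {ω | w ω = g}) = univ := by ext; simp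
      rw [this]; simp
    · intro g g' hgg
      exact Set.disjoint_left.2 fun ω h1 h2 => hgg ((show w ω = g from h1).symm.trans h2)
  -- first estimate
  have h1 : P {ω | ω ∈ O (w ω).1 ∧ a (w ω).1 (η ω) < t * c (w ω) (η ω)} ≤ t := by
    refine (meas_le_tsum (w := w) (c := fun g => t * P {ω | w ω = g}) fun g => ?_).trans ?_
    · set A : Set B := {z | a g.1 z < t * c g z} with hA
      have hAm : MeasurableSet A := measurableSet_lt (hma _) ((hmc g).const_mul t)
      calc _ ≤ P (η ⁻¹' A ∩ O g.1) := by
              refine measure_mono ?_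
              rintro ω ⟨h1, h2, h3⟩
              have h1' : w ω = g := h1
              rw [h1'] at h2 h3
              exact ⟨h3, h2⟩
        _ = ∫⁻ z in A, a g.1 z ∂(P.map η) := dens_set hη hAm
        _ ≤ ∫⁻ z in A, t * c g z ∂(P.map η) := setLIntegral_mono' hAm fun z hz => hz.le
        _ ≤ ∫⁻ z, t * c g z ∂(P.map η) := setLIntegral_le_lintegral _ _
        _ = _ := by rw [lintegral_const_mul _ (hmc g), hc, dens_int_one hη]
    · rw [ENNReal.tsum_mul_left, hpr, mul_one]
  -- second estimate
  have h2 : P {ω | (w ω).1 ∈ TX ∧ (w ω).2 ∈ TY ∧ η ω ∈ Y (w ω).2 ∧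
      c (w ω) (η ω) < t * a (w ω).1 (η ω)} ≤ t * (M1 * M2) := by
    refine (meas_le_tsum (w := w) (c := fun g => if g.1 ∈ TX then
      ∫⁻ z, (if g.2 ∈ TY ∧ z ∈ Y g.2 then (1 : ℝ≥0∞) else 0) * (t * a g.1 z) ∂(P.map η) else 0)
      fun g => ?_).trans ?_
    · by_cases hg : g.1 ∈ TX
      swap
      · have : {ω | w ω = g} ∩ {ω | (w ω).1 ∈ TX ∧ (w ω).2 ∈ TY ∧ η ω ∈ Y (w ω).2 ∧
            c (w ω) (η ω) < t * a (w ω).1 (η ω)} = ∅ := by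
          ext ω
          simp only [mem_inter_iff, mem_empty_iff_false, iff_false]
          rintro ⟨e, e1, -⟩
          have e' : w ω = g := e
          rw [e'] at e1
          exact hg e1
        rw [this]; simp
      rw [if_pos hg]
      set A : Set B := {z | (g.2 ∈ TY ∧ z ∈ Y g.2) ∧ c g z < t * a g.1 z} with hA
      have hAm : MeasurableSet A := by
        refine MeasurableSet.inter ?_ (measurableSet_lt (hmc g) ((hma _).const_mul t))
        exact (MeasurableSet.const (g.2 ∈ TY)).inter (hY g.2)
      calc _ ≤ P (η ⁻¹' A ∩ {ω | w ω = g}) := by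
              refine measure_mono ?_
              rintro ω ⟨h1, h2, h3, h4, h5⟩
              have h1' : w ω = g := h1
              rw [h1'] at h2 h3 h4 h5
              exact ⟨⟨⟨h3, h4⟩, h5⟩, h1⟩
        _ = ∫⁻ z in A, c g z ∂(P.map η) := dens_set hη hAm
        _ ≤ ∫⁻ z in A, (if g.2 ∈ TY ∧ z ∈ Y g.2 then (1 : ℝ≥0∞) else 0) * (t * a g.1 z)
              ∂(P.map η) := setLIntegral_mono' hAm fun z hz => by
              rw [if_pos hz.1, one_mul]; exact hz.2.le
        _ ≤ _ := setLIntegral_le_lintegral _ _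
    · have hmi : ∀ y : Γs, Measurable fun z => (if y ∈ TY ∧ z ∈ Y y then (1 : ℝ≥0∞) else 0) := by
        intro y
        refine Measurable.ite ?_ measurable_const measurable_const
        exact (MeasurableSet.const (y ∈ TY)).inter (hY y)
      rw [ENNReal.tsum_prod']
      calc _ ≤ ∑' x : Γ, if x ∈ TX then M2 * (t * P (O x)) else 0 := by
              refine ENNReal.tsum_le_tsum fun x => ?_
              split_ifs with hx
              · rw [← lintegral_tsum (f := fun (y : Γs) z => (if y ∈ TY ∧ z ∈ Y y then (1 : ℝ≥0∞) else 0) *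
                  (t * a x z)) fun y => ((hmi y).mul ((hma x).const_mul t)).aemeasurable]
                calc _ ≤ ∫⁻ z, M2 * (t * a x z) ∂(P.map η) := by
                        refine lintegral_mono fun z => ?_
                        simp only
                        rw [ENNReal.tsum_mul_right]
                        gcongr
                        exact hM2 z
                  _ = _ := by
                        rw [lintegral_const_mul _ ((hma x).const_mul t),
                          lintegral_const_mul _ (hma x), ha, dens_int_one hη]
              · simp
        _ = t * M2 * ∑' x : Γ, if x ∈ TX then P (O x) else 0 := by
              rw [← ENNReal.tsum_mul_left]
              refine tsum_congr fun x => ?_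
              split_ifs
              · ring
              · simp
        _ ≤ t * M2 * M1 := by
              gcongr
              have e : ∀ x : Γ, (if x ∈ TX then P (O x) else 0) =
                  ∫⁻ ω, (if x ∈ TX ∧ ω ∈ O x then (1 : ℝ≥0∞) else 0) ∂P := by
                intro x
                split_ifs with hx
                · rw [← lintegral_indicator_one (hO x)]
                  refine lintegral_congr fun ω => ?_
                  simp [Set.indicator, hx]
                · simp [hx]
              simp_rw [e]
              rw [← lintegral_tsum]
              · calc _ ≤ ∫⁻ ω, M1 ∂P := lintegral_mono hM1
                  _ = M1 := by simp
              · intro x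
                refine (Measurable.ite ?_ measurable_const measurable_const).aemeasurable
                exact (MeasurableSet.const (x ∈ TX)).inter (hO x)
        _ = _ := by ring
  -- third estimate
  have h3 : P {ω | (w ω).2 ∈ TY ∧ η ω ∈ Y (w ω).2 ∧ b (w ω).2 (η ω) < t} ≤ t * M2 := by
    refine (meas_le_tsum (w := fun ω => (w ω).2) (c := fun y =>
      ∫⁻ z, (if y ∈ TY ∧ z ∈ Y y then (1 : ℝ≥0∞) else 0) * t ∂(P.map η)) fun y => ?_).trans ?_
    · set A : Set B := {z | (y ∈ TY ∧ z ∈ Y y) ∧ b y z < t} with hA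
      have hAm : MeasurableSet A := by
        refine MeasurableSet.inter ?_ (measurableSet_lt (hmb y) measurable_const)
        exact (MeasurableSet.const (y ∈ TY)).inter (hY y)
      calc _ ≤ P (η ⁻¹' A ∩ {ω | (w ω).2 = y}) := by
              refine measure_mono ?_
              rintro ω ⟨h1, h3, h4, h5⟩
              have h1' : (w ω).2 = y := h1
              rw [h1'] at h3 h4 h5
              exact ⟨⟨⟨h3, h4⟩, h5⟩, h1⟩
        _ = ∫⁻ z in A, b y z ∂(P.map η) := dens_set hη hAm
        _ ≤ ∫⁻ z in A, (if y ∈ TY ∧ z ∈ Y y then (1 : ℝ≥0∞) else 0) * t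
              ∂(P.map η) := setLIntegral_mono' hAm fun z hz => by
              rw [if_pos hz.1, one_mul]; exact hz.2.le
        _ ≤ _ := setLIntegral_le_lintegral _ _
    · have hmi : ∀ y : Γs, Measurable fun z => (if y ∈ TY ∧ z ∈ Y y then (1 : ℝ≥0∞) else 0) := by
        intro y
        refine Measurable.ite ?_ measurable_const measurable_const
        exact (MeasurableSet.const (y ∈ TY)).inter (hY y)
      haveI : IsProbabilityMeasure (P.map η) := Measure.isProbabilityMeasure_map hη.aemeasurable
      rw [← lintegral_tsum fun y => ((hmi y).mul_const t).aemeasurable]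
      calc _ ≤ ∫⁻ z, M2 * t ∂(P.map η) := by
              refine lintegral_mono fun z => ?_
              simp only
              rw [ENNReal.tsum_mul_right]
              gcongr
              exact hM2 z
        _ = _ := by simp [mul_comm]
  -- almost sure relations
  have h4 : ∀ᵐ ω ∂P, ∀ y, b y (η ω) ≤ 1 := by
    rw [ae_all_iff]
    exact fun y => ae_of_ae_map hη.aemeasurable (dens_le_one hη _)
  have h5 : ∀ᵐ ω ∂P, ∀ g : Γ × Γs, c g (η ω) * mn g.2 = pn g * b g.2 (η ω) := by
    rw [ae_all_iff]
    exact fun g => ae_of_ae_map hη.aemeasurable (dens_ratio hη (hr g))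
  refine le_trans (measure_mono_ae ?_) ((measure_union_le _ _).trans
    (add_le_add ((measure_union_le _ _).trans (add_le_add h1 h2)) h3))
  filter_upwards [h4, h5] with ω g4 g5
  rintro ⟨k1, k2, k3, k4, k5⟩
  by_contra hcon
  apply k5
  have hcon' : ¬ ((ω ∈ O (w ω).1 ∧ a (w ω).1 (η ω) < t * c (w ω) (η ω)) ∨
    ((w ω).1 ∈ TX ∧ (w ω).2 ∈ TY ∧ η ω ∈ Y (w ω).2 ∧
      c (w ω) (η ω) < t * a (w ω).1 (η ω)) ∨
    ((w ω).2 ∈ TY ∧ η ω ∈ Y (w ω).2 ∧ b (w ω).2 (η ω) < t)) := fun h => hcon (by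
      rcases h with h | h | h
      · exact Or.inl (Or.inl h)
      · exact Or.inl (Or.inr h)
      · exact Or.inr h)
  have e1 : t * c (w ω) (η ω) ≤ a (w ω).1 (η ω) := by
    by_contra h; exact hcon' (Or.inl ⟨k1, not_le.1 h⟩)
  have e2 : t * a (w ω).1 (η ω) ≤ c (w ω) (η ω) := by
    by_contra h; exact hcon' (Or.inr (Or.inl ⟨k2, k3, k4, not_le.1 h⟩))
  have e3 : t ≤ b (w ω).2 (η ω) := by
    by_contra h; exact hcon' (Or.inr (Or.inr ⟨k3, k4, not_le.1 h⟩))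
  change t * t * pn (w ω) ≤ a (w ω).1 (η ω) * mn (w ω).2 ∧
    t * (a (w ω).1 (η ω) * mn (w ω).2) ≤ pn (w ω)
  constructor
  · calc t * t * pn (w ω) ≤ t * (pn (w ω) * b (w ω).2 (η ω)) := by
            rw [mul_assoc, mul_comm t (pn _)]; gcongr
      _ = t * c (w ω) (η ω) * mn (w ω).2 := by rw [← g5, mul_assoc]
      _ ≤ _ := by gcongr
  · calc _ = t * a (w ω).1 (η ω) * mn (w ω).2 := by rw [mul_assoc]
      _ ≤ c (w ω) (η ω) * mn (w ω).2 := by gcongr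
      _ = pn (w ω) * b (w ω).2 (η ω) := g5 _
      _ ≤ pn (w ω) * 1 := by gcongr; exact g4 _
      _ = _ := mul_one _

end Den

/-! ### Marginals, multiplicity and the ratio formula -/

section Mar

lemma mult_bound {G : Type*} [Group G] [MetricSpace G] {δ : ℝ} (hδ0 : 0 ≤ δ)
    (hδ : IsHyperbolicWith G δ) (hinv : LeftInvariantMetric G) (hqi : IsQIToWordMetric G) :
    ∃ A : ℝ, 0 ≤ A ∧ ∀ R s : ℝ, s ≤ R → ∀ ξ : Boundary G (1 : G),
      ∑' x : G, (if dist 1 x ≤ R ∧ nearX 1 s x ξ then (1 : ℝ≥0∞) else 0) ≤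
        ENNReal.ofReal (Real.exp (A * (2 * (R - s) + 2 * δ + 1))) := by
  obtain ⟨A, hA, hgr⟩ := growth hqi
  refine ⟨A, hA, fun R s hs ξ => ?_⟩
  by_cases hx : ∃ x0 : G, dist 1 x0 ≤ R ∧ nearX 1 s x0 ξ
  swap
  · push Not at hx
    have : ∀ x : G, (if dist 1 x ≤ R ∧ nearX 1 s x ξ then (1 : ℝ≥0∞) else 0) = 0 := by
      intro x
      rw [if_neg]
      rintro ⟨h1, h2⟩
      exact hx x h1 h2
    simp [this]
  obtain ⟨x0, h01, h02⟩ := hx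
  obtain ⟨F, hF, hcard⟩ := hgr (2 * (R - s) + 2 * δ) (by linarith)
  have key : ∀ x : G, (if dist 1 x ≤ R ∧ nearX 1 s x ξ then (1 : ℝ≥0∞) else 0) ≤
      (fun z => if z ∈ F then (1 : ℝ≥0∞) else 0) ((Equiv.mulLeft x0⁻¹) x) := by
    intro x
    split_ifs with h
    · have hmem : (Equiv.mulLeft x0⁻¹) x ∈ F := by
        apply hF
        have h3 := nearX.gp_lt hδ h02 h.2
        unfold gp at h3
        have h4 : dist 1 ((Equiv.mulLeft x0⁻¹) x) = dist x0 x := by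
          rw [← hinv x0 1 _]; simp
        rw [h4]
        rw [dist_comm x0 1] at h3
        linarith [h.1]
      simp only [if_pos hmem, le_refl]
    · exact bot_le
  calc _ ≤ ∑' x : G, (fun z => if z ∈ F then (1 : ℝ≥0∞) else 0) ((Equiv.mulLeft x0⁻¹) x) :=
        ENNReal.tsum_le_tsum key
    _ = ∑' z : G, (if z ∈ F then (1 : ℝ≥0∞) else 0) :=
        (Equiv.mulLeft x0⁻¹).tsum_eq (fun z => if z ∈ F then (1 : ℝ≥0∞) else 0)
    _ = (F.card : ℝ≥0∞) := by
        rw [tsum_eq_sum (s := F) (fun z hz => if_neg hz)]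
        rw [Finset.sum_congr rfl (fun z hz => if_pos hz)]
        simp
    _ = ENNReal.ofReal (F.card : ℝ) := by simp
    _ ≤ _ := ENNReal.ofReal_le_ofReal hcard

variable {Γ Γs : Type*} [Group Γ] [Group Γs] [Countable Γ] [Countable Γs]
  [MeasurableSpace Γ] [DiscreteMeasurableSpace Γ]
  [MeasurableSpace Γs] [DiscreteMeasurableSpace Γs]
  {p : Γ × Γs → ℝ≥0∞} {P : Measure (ℕ → Γ × Γs)}

lemma marg_snd (hP : IsRWMeasure p P) :
    IsRWMeasure (fun y => ∑' x, p (x, y)) (P.map (fun ω i => (ω i).2)) := by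
  have h := rw_map hP (Prod.snd : Γ × Γs → Γs)
  convert h using 2 with y
  have e : {ω : ℕ → Γ × Γs | (ω 0).2 = y} = ⋃ x : Γ, {ω | ω 0 = (x, y)} := by
    ext ω; simp [Prod.ext_iff]
  rw [e, measure_iUnion]
  · exact tsum_congr fun x => (rw_single hP (x, y)).symm
  · intro a b hab
    refine Set.disjoint_left.2 fun ω h1 h2 => hab ?_
    exact (Prod.ext_iff.1 ((show ω 0 = (a, y) from h1).symm.trans h2)).1
  · intro x; exact measurable_coord_set 0 {(x, y)}

lemma marg_fst (hP : IsRWMeasure p P) :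
    IsRWMeasure (fun x => ∑' y, p (x, y)) (P.map (fun ω i => (ω i).1)) := by
  have h := rw_map hP (Prod.fst : Γ × Γs → Γ)
  convert h using 2 with x
  have e : {ω : ℕ → Γ × Γs | (ω 0).1 = x} = ⋃ y : Γs, {ω | ω 0 = (x, y)} := by
    ext ω; simp [Prod.ext_iff]
  rw [e, measure_iUnion]
  · exact tsum_congr fun y => (rw_single hP (x, y)).symm
  · intro a b hab
    refine Set.disjoint_left.2 fun ω h1 h2 => hab ?_
    exact (Prod.ext_iff.1 ((show ω 0 = (x, a) from h1).symm.trans h2)).2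
  · intro y; exact measurable_coord_set 0 {(x, y)}

lemma walk_fst (ω : ℕ → Γ × Γs) (n : ℕ) : walk (fun i => (ω i).1) n = (walk ω n).1 :=
  walk_map (MonoidHom.fst Γ Γs) ω n

lemma walk_snd (ω : ℕ → Γ × Γs) (n : ℕ) : walk (fun i => (ω i).2) n = (walk ω n).2 :=
  walk_map (MonoidHom.snd Γ Γs) ω n

lemma meas_fst : Measurable (fun (ω : ℕ → Γ × Γs) (i : ℕ) => (ω i).1) :=
  measurable_pi_lambda _ fun i => measurable_fst.comp (measurable_pi_apply i)

lemma meas_snd : Measurable (fun (ω : ℕ → Γ × Γs) (i : ℕ) => (ω i).2) :=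
  measurable_pi_lambda _ fun i => measurable_snd.comp (measurable_pi_apply i)

lemma rw_walk_snd (hP : IsRWMeasure p P) (n : ℕ) (y : Γs) :
    P {ω | (walk ω n).2 = y} = piN (fun y => ∑' x, p (x, y)) n y := by
  rw [← rw_walk (marg_snd hP) n y, Measure.map_apply meas_snd (measurableSet_walk n y)]
  congr 1
  ext ω
  simp [walk_snd]

lemma mom_fst [MetricSpace Γ] [MetricSpace Γs]
    (hm : FiniteFirstMoment p fun g => dist (1 : Γ × Γs) g) :
    FiniteFirstMoment (fun x : Γ => ∑' y : Γs, p (x, y)) fun x => dist 1 x := by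
  refine ne_top_of_le_ne_top hm ?_
  rw [ENNReal.tsum_prod']
  refine ENNReal.tsum_le_tsum fun x => ?_
  simp only
  rw [← ENNReal.tsum_mul_right]
  refine ENNReal.tsum_le_tsum fun y => ?_
  gcongr
  exact le_max_left (dist (1 : Γ) x) (dist (1 : Γs) y)

lemma mom_snd [MetricSpace Γ] [MetricSpace Γs]
    (hm : FiniteFirstMoment p fun g => dist (1 : Γ × Γs) g) :
    FiniteFirstMoment (fun y : Γs => ∑' x : Γ, p (x, y)) fun y => dist 1 y := by
  refine ne_top_of_le_ne_top hm ?_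
  rw [ENNReal.tsum_prod', ENNReal.tsum_comm]
  refine ENNReal.tsum_le_tsum fun y => ?_
  simp only
  rw [← ENNReal.tsum_mul_right]
  refine ENNReal.tsum_le_tsum fun x => ?_
  gcongr
  exact le_max_right (dist (1 : Γ) x) (dist (1 : Γs) y)

lemma isLen_prod [MetricSpace Γ] [MetricSpace Γs] (h1 : LeftInvariantMetric Γ)
    (h2 : LeftInvariantMetric Γs) : IsLen (fun g : Γ × Γs => dist 1 g) := by
  apply isLen_dist
  intro g x y
  simp only [Prod.dist_eq, Prod.fst_mul, Prod.snd_mul, h1 g.1, h2 g.2]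

lemma lenGrowth_prod [MetricSpace Γ] [MetricSpace Γs] (h1 : IsQIToWordMetric Γ)
    (h2 : IsQIToWordMetric Γs) : ∃ A, LenGrowth (fun g : Γ × Γs => dist 1 g) A := by
  obtain ⟨A, hA, hF⟩ := growth h1
  obtain ⟨A', hA', hF'⟩ := growth h2
  refine ⟨A + A', by positivity, fun R hR => ?_⟩
  obtain ⟨F, f1, f2⟩ := hF R hR
  obtain ⟨F', f1', f2'⟩ := hF' R hR
  refine ⟨F ×ˢ F', fun x hx => ?_, ?_⟩
  · rw [Finset.mem_product]
    exact ⟨f1 _ ((le_max_left _ _).trans hx), f1' _ ((le_max_right _ _).trans hx)⟩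
  · rw [Finset.card_product, add_mul, Real.exp_add]
    push_cast
    gcongr

lemma future_indep [MetricSpace Γs] (hP : IsRWMeasure p P)
    {η : (ℕ → Γ × Γs) → Boundary Γs (1 : Γs)} (hη : Measurable η)
    (n : ℕ) (y : Γs) {A : Set (Boundary Γs (1 : Γs))} (hA : MeasurableSet A)
    (hb2 : ∀ᵐ z : (ℕ → Γ × Γs) × (ℕ → Γ × Γs) ∂(P.prod P), ∃ h : IsDivergent (1 : Γs) (fun k => (walk (cat n z) k).2),
      η (cat n z) = mkB 1 ⟨fun k => (walk (cat n z) k).2, h⟩)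
    (ω0 : ℕ → Γ × Γs) (hω0 : ∀ᵐ ω' : ℕ → Γ × Γs ∂P, ∃ h : IsDivergent (1 : Γs)
      (fun k => (walk (cat n (ω0, ω')) k).2),
        η (cat n (ω0, ω')) = mkB 1 ⟨fun k => (walk (cat n (ω0, ω')) k).2, h⟩)
    (hω0y : (walk ω0 n).2 = y) (S : Set (Γ × Γs)) (hS : ∀ x ∈ S, x.2 = y) :
    P (η ⁻¹' A ∩ {ω | walk ω n ∈ S}) =
      P {ω | walk ω n ∈ S} * P {ω' | η (cat n (ω0, ω')) ∈ A} := by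
  haveI := hP.1
  have hΦ2 : ∀ᵐ z : (ℕ → Γ × Γs) × (ℕ → Γ × Γs) ∂(P.prod P), ∃ h : IsDivergent (1 : Γs)
      (fun k => (walk (cat n (ω0, z.2)) k).2),
      η (cat n (ω0, z.2)) = mkB 1 ⟨fun k => (walk (cat n (ω0, z.2)) k).2, h⟩ :=
    Measure.quasiMeasurePreserving_snd.ae hω0
  have hSm : MeasurableSet {ω : ℕ → Γ × Γs | walk ω n ∈ S} :=
    measurable_walk n (MeasurableSet.of_discrete (s := S))
  rw [rw_cat_apply hP n ((hη hA).inter hSm), ← Measure.prod_prod]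
  refine measure_congr ?_
  filter_upwards [hb2, hΦ2] with z h1 h2
  apply propext
  change (η (cat n z) ∈ A ∧ walk (cat n z) n ∈ S) ↔ (walk z.1 n ∈ S ∧ η (cat n (ω0, z.2)) ∈ A)
  rw [walk_cat, and_comm]
  refine and_congr_right fun hzS => ?_
  obtain ⟨h1, e1⟩ := h1
  obtain ⟨h2, e2⟩ := h2
  have : η (cat n z) = η (cat n (ω0, z.2)) := by
    rw [e1, e2]
    refine mkB_eq_of_eventuallyEq n fun k hk => ?_
    obtain ⟨m, rfl⟩ := Nat.exists_eq_add_of_le hk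
    change (walk (cat n z) (n + m)).2 = (walk (cat n (ω0, z.2)) (n + m)).2
    rw [walk_cat_add, walk_cat_add]
    simp only [Prod.snd_mul, hω0y, hS _ hzS]
  rw [this]

/-- The future boundary point only depends on the second coordinate at time `n`. -/
lemma ratio_formula [MetricSpace Γs] (hP : IsRWMeasure p P)
    {η : (ℕ → Γ × Γs) → Boundary Γs (1 : Γs)} (hη : Measurable η)
    (hb : ∀ᵐ ω : ℕ → Γ × Γs ∂P, ∃ h : IsDivergent (1 : Γs) (fun n => (walk ω n).2),
      η ω = mkB 1 ⟨fun n => (walk ω n).2, h⟩)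
    (n : ℕ) (g : Γ × Γs) {A : Set (Boundary Γs (1 : Γs))} (hA : MeasurableSet A) :
    P (η ⁻¹' A ∩ {ω | walk ω n = g}) * piN (fun y => ∑' x, p (x, y)) n g.2 =
      piN p n g * P (η ⁻¹' A ∩ {ω | (walk ω n).2 = g.2}) := by
  haveI := hP.1
  have hsub : {ω : ℕ → Γ × Γs | walk ω n = g} ⊆ {ω | (walk ω n).2 = g.2} :=
    fun ω hω => congrArg Prod.snd (show walk ω n = g from hω)
  by_cases h0 : P {ω : ℕ → Γ × Γs | (walk ω n).2 = g.2} = 0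
  · rw [measure_mono_null (inter_subset_right.trans hsub) h0,
      measure_mono_null inter_subset_right h0]
    simp
  have hb2 : ∀ᵐ z : (ℕ → Γ × Γs) × (ℕ → Γ × Γs) ∂(P.prod P), ∃ h : IsDivergent (1 : Γs) (fun k => (walk (cat n z) k).2),
      η (cat n z) = mkB 1 ⟨fun k => (walk (cat n z) k).2, h⟩ := by
    rw [← rw_cat hP n] at hb
    exact ae_of_ae_map (measurable_cat n).aemeasurable hb
  have hb3 := Measure.ae_ae_of_ae_prod hb2
  obtain ⟨ω0, hω0, hω0y⟩ : ∃ ω0, (∀ᵐ ω' : ℕ → Γ × Γs ∂P, ∃ h : IsDivergent (1 : Γs)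
      (fun k => (walk (cat n (ω0, ω')) k).2),
        η (cat n (ω0, ω')) = mkB 1 ⟨fun k => (walk (cat n (ω0, ω')) k).2, h⟩) ∧
      (walk ω0 n).2 = g.2 := by
    by_contra hcon
    push Not at hcon
    apply h0
    have : ∀ᵐ ω ∂P, ¬ (walk ω n).2 = g.2 := by
      filter_upwards [hb3] with ω hω
      exact hcon ω hω
    rw [ae_iff] at this
    simpa only [not_not] using this
  have k1 := future_indep hP hη n g.2 hA hb2 ω0 hω0 hω0y {x | x = g}
    (fun x hx => congrArg Prod.snd (show x = g from hx))
  have k2 := future_indep hP hη n g.2 hA hb2 ω0 hω0 hω0y {x | x.2 = g.2} (fun x hx => hx)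
  have e1 := rw_walk hP n g
  have e2 := rw_walk_snd hP n g.2
  rw [← e1, ← e2]
  refine Eq.trans (congrArg (· * P {ω | (walk ω n).2 = g.2}) k1) ?_
  refine Eq.trans ?_ (congrArg (P {ω | walk ω n = g} * ·) k2).symm
  change P {ω | walk ω n = g} * _ * P {ω | (walk ω n).2 = g.2} =
    P {ω | walk ω n = g} * (P {ω | (walk ω n).2 = g.2} * _)
  ring

end Mar

/-! ### The core almost sure estimate -/

section Core

lemma ae_of_exp_bound {Ω : Type*} [MeasurableSpace Ω] {P : Measure Ω} {E : ℕ → Set Ω}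
    {C r : ℝ} (hr : 0 < r)
    (h : ∀ j, P (E j) ≤ ENNReal.ofReal (C * Real.exp (-(r * j)))) :
    ∀ᵐ ω ∂P, ∀ᶠ j in atTop, ω ∉ E j := by
  apply ae_eventually_notMem
  have hs : Summable fun j : ℕ => |C| * Real.exp (-(r * j)) := by
    apply Summable.mul_left
    have : (fun j : ℕ => Real.exp (-(r * j))) = fun j : ℕ => (Real.exp (-r)) ^ j := by
      funext j; rw [← Real.exp_nat_mul]; congr 1; ring
    rw [this]
    exact summable_geometric_of_lt_one (Real.exp_pos _).le (by rw [Real.exp_lt_one_iff]; linarith)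
  refine ne_top_of_le_ne_top ?_ (ENNReal.tsum_le_tsum fun j => (h j).trans
    (ENNReal.ofReal_le_ofReal (mul_le_mul_of_nonneg_right (le_abs_self C) (Real.exp_pos _).le)))
  exact hs.tsum_ofReal_ne_top

lemma real_bounds {t pn mn a : ℝ≥0∞} {th hπ hs ε n : ℝ} (ht : t = ENNReal.ofReal (Real.exp (-th)))
    (hth : 0 ≤ th)
    (hpt : pn ≠ ∞) (hmt : mn ≠ ∞)
    (h1 : t * t * pn ≤ a * mn) (h2 : t * (a * mn) ≤ pn)
    (e1 : Real.exp (-((hπ + ε) * n)) ≤ pn.toReal) (e2 : pn.toReal ≤ Real.exp (-((hπ - ε) * n)))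
    (e3 : Real.exp (-((hs + ε) * n)) ≤ mn.toReal) (e4 : mn.toReal ≤ Real.exp (-((hs - ε) * n))) :
    a ≠ ∞ ∧ Real.exp (-(n * (hπ - hs) + (2 * ε * n + 2 * th))) ≤ a.toReal ∧
      a.toReal ≤ Real.exp (-(n * (hπ - hs) - (2 * ε * n + 2 * th))) := by
  have hm0 : 0 < mn.toReal := (Real.exp_pos _).trans_le e3
  have hm0' : mn ≠ 0 := by rintro rfl; simp at hm0
  have ht0 : t ≠ 0 := by
    rw [ht]; simp [Real.exp_pos]
  have htt : t ≠ ∞ := by rw [ht]; exact ENNReal.ofReal_ne_top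
  have htr : t.toReal = Real.exp (-th) := by
    rw [ht, ENNReal.toReal_ofReal (Real.exp_pos _).le]
  have hat : a ≠ ∞ := by
    rintro rfl
    rw [ENNReal.top_mul hm0', ENNReal.mul_top ht0] at h2
    exact hpt (top_le_iff.1 h2)
  have g1 := ENNReal.toReal_mono (ENNReal.mul_ne_top hat hmt) h1
  have g2 := ENNReal.toReal_mono hpt h2
  simp only [ENNReal.toReal_mul, htr] at g1 g2
  refine ⟨hat, ?_, ?_⟩
  · have : Real.exp (-(n * (hπ - hs) + (2 * ε * n + 2 * th))) * Real.exp (-((hs - ε) * n)) ≤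
        a.toReal * Real.exp (-((hs - ε) * n)) := by
      calc _ = Real.exp (-th) * Real.exp (-th) * Real.exp (-((hπ + ε) * n)) := by
            rw [← Real.exp_add, ← Real.exp_add, ← Real.exp_add]; congr 1; ring
        _ ≤ Real.exp (-th) * Real.exp (-th) * pn.toReal := by gcongr
        _ ≤ a.toReal * mn.toReal := g1
        _ ≤ _ := by gcongr
    exact le_of_mul_le_mul_right this (Real.exp_pos _)
  · have : a.toReal * (Real.exp (-th) * Real.exp (-((hs + ε) * n))) ≤
        Real.exp (-(n * (hπ - hs) - (2 * ε * n + 2 * th))) *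
          (Real.exp (-th) * Real.exp (-((hs + ε) * n))) := by
      calc _ ≤ a.toReal * (Real.exp (-th) * mn.toReal) := by gcongr
        _ = Real.exp (-th) * (a.toReal * mn.toReal) := by ring
        _ ≤ pn.toReal := g2
        _ ≤ _ := e2
        _ ≤ Real.exp (-((hπ - ε) * n) + th) := by gcongr; linarith
        _ = _ := by rw [← Real.exp_add, ← Real.exp_add]; congr 1; ring
    exact le_of_mul_le_mul_right this (by positivity)

variable {Γ Γs : Type*} [Group Γ] [Group Γs] [MetricSpace Γ] [MetricSpace Γs]
  [Countable Γ] [Countable Γs]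
  [MeasurableSpace Γ] [DiscreteMeasurableSpace Γ]
  [MeasurableSpace Γs] [DiscreteMeasurableSpace Γs]
  {p : Γ × Γs → ℝ≥0∞} {P : Measure (ℕ → Γ × Γs)}

theorem core (hΓ : IsHypGroupMetric Γ) (hΓs : IsHypGroupMetric Γs)
    (hP : IsRWMeasure p P)
    (hmom : FiniteFirstMoment p fun g => dist (1 : Γ × Γs) g)
    {hπ hs l ls : ℝ}
    (hhπ : HasEntropy p hπ)
    (hhs : HasEntropy (fun y : Γs => ∑' x : Γ, p (x, y)) hs)
    (hl : HasDrift (fun x : Γ => ∑' y : Γs, p (x, y)) (fun x => dist (1 : Γ) x) l)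
    (hls : HasDrift (fun y : Γs => ∑' x : Γ, p (x, y)) (fun y => dist (1 : Γs) y) ls)
    {ξ : (ℕ → Γ × Γs) → Boundary Γ (1 : Γ)} (hξ : Measurable ξ)
    (hbξ : ∀ᵐ ω : ℕ → Γ × Γs ∂P, ∃ h : IsDivergent (1 : Γ) (fun n => (walk ω n).1),
      ξ ω = mkB 1 ⟨fun n => (walk ω n).1, h⟩)
    {η : (ℕ → Γ × Γs) → Boundary Γs (1 : Γs)} (hη : Measurable η)
    (hbη : ∀ᵐ ω : ℕ → Γ × Γs ∂P, ∃ h : IsDivergent (1 : Γs) (fun n => (walk ω n).2),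
      η ω = mkB 1 ⟨fun n => (walk ω n).2, h⟩)
    {Ksh Osh : ℝ → Γ → Set (Boundary Γ (1 : Γ))} {C0 : ℝ} (hC0 : 0 ≤ C0)
    (hOm : ∀ s x, MeasurableSet (Osh s x)) (hKO : ∀ s x, Ksh s x ⊆ Osh s x)
    (hKn : ∀ s x z, nearX 1 s x z → z ∈ Ksh s x)
    (hOn : ∀ s x, ∀ z ∈ Osh s x, nearX 1 (s - C0) x z) :
    ∃ c : ℝ, 0 ≤ c ∧ ∀ ε : ℝ, 0 < ε → ε < l → ε < ls → ∃ K : ℕ, 1 ≤ K ∧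
      ∀ᵐ ω ∂P, ∀ᶠ j : ℕ in atTop, ∃ x : Γ, ξ ω ∈ Ksh ((l - ε) * (j * K : ℕ)) x ∧
        dens P η (ξ ⁻¹' Osh ((l - ε) * (j * K : ℕ)) x) (η ω) ≠ ∞ ∧
        Real.exp (-((j * K : ℕ) * ((hπ - hs) + c * ε))) ≤
          (dens P η (ξ ⁻¹' Osh ((l - ε) * (j * K : ℕ)) x) (η ω)).toReal ∧
        (dens P η (ξ ⁻¹' Osh ((l - ε) * (j * K : ℕ)) x) (η ω)).toReal ≤
          Real.exp (-((j * K : ℕ) * ((hπ - hs) - c * ε))) := by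
  haveI := hP.1
  obtain ⟨hinv, ⟨δ, hδ0, hδ⟩, hqi⟩ := id hΓ
  obtain ⟨hinvs, ⟨δs, hδs0, hδs⟩, hqis⟩ := id hΓs
  obtain ⟨A1, hA1, hm1⟩ := mult_bound hδ0 hδ hinv hqi
  obtain ⟨A2, hA2, hm2⟩ := mult_bound hδs0 hδs hinvs hqis
  obtain ⟨Ap, hAp⟩ := lenGrowth_prod hqi hqis
  obtain ⟨As, hAs⟩ : ∃ A, LenGrowth (fun y : Γs => dist 1 y) A := growth hqis
  choose Ys Yo hYsm hYom hYso hYn hYq hYon using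
    fun (s : ℝ) (y : Γs) => exists_shadow hδs hδs0 (1 : Γs) s y
  have hPf := marg_fst hP
  have hPs := marg_snd hP
  refine ⟨2 + 2 * (4 * A1 + 4 * A2 + 1), by positivity, fun ε hε hεl hεls => ?_⟩
  obtain ⟨K1, hK1⟩ := typical hPf hΓ (mom_fst hmom) hl hε hεl
  obtain ⟨K2, hK2⟩ := typical hPs hΓs (mom_snd hmom) hls hε hεls
  obtain ⟨K3, hK3⟩ := entropy_upper hP (isLen_prod hinv hinvs) hmom hAp hhπ hε
  obtain ⟨K4, hK4⟩ := entropy_upper hPs (isLen_dist hinvs) (mom_snd hmom) hAs hhs hε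
  obtain ⟨K, hKa, hKb, hKc, hKd, hKe⟩ : ∃ K, K1 ≤ K ∧ K2 ≤ K ∧ K3 ≤ K ∧ K4 ≤ K ∧ 1 ≤ K :=
    ⟨K1 + K2 + K3 + K4 + 1, by omega, by omega, by omega, by omega, by omega⟩
  refine ⟨K, hKe, ?_⟩
  have T1 := ae_of_ae_map meas_fst.aemeasurable (hK1 K hKa)
  have T2 := ae_of_ae_map meas_snd.aemeasurable (hK2 K hKb)
  have E1 := hK3 K hKc
  have E2 := entropy_lower hP (isLen_prod hinv hinvs) hmom hAp hhπ
  have E3 := ae_of_ae_map meas_snd.aemeasurable (hK4 K hKd)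
  have E4 := ae_of_ae_map meas_snd.aemeasurable
    (entropy_lower hPs (isLen_dist hinvs) (mom_snd hmom) hAs hhs)
  have hKr : (1 : ℝ) ≤ K := by exact_mod_cast hKe
  set θ : ℝ := (4 * A1 + 4 * A2 + 1) * ε with hθ
  have hθ0 : 0 ≤ θ := by positivity
  set O : ℕ → Γ → Set (ℕ → Γ × Γs) := fun j x => ξ ⁻¹' Osh ((l - ε) * (j * K : ℕ)) x with hO
  set Y : ℕ → Γs → Set (Boundary Γs (1 : Γs)) := fun j y => Yo ((ls - ε) * (j * K : ℕ)) y with hY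
  set TX : ℕ → Set Γ := fun j => {x | dist 1 x ≤ (l + ε) * (j * K : ℕ)} with hTX
  set TY : ℕ → Set Γs := fun j => {y | dist 1 y ≤ (ls + ε) * (j * K : ℕ)} with hTY
  set t : ℕ → ℝ≥0∞ := fun j => ENNReal.ofReal (Real.exp (-(θ * (j * K : ℕ)))) with ht
  set mu : Γs → ℝ≥0∞ := fun y => ∑' x, p (x, y) with hmu
  set E : ℕ → Set (ℕ → Γ × Γs) := fun j => {ω | ω ∈ O j (walk ω (j * K)).1 ∧
      (walk ω (j * K)).1 ∈ TX j ∧ (walk ω (j * K)).2 ∈ TY j ∧ η ω ∈ Y j (walk ω (j * K)).2 ∧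
      ¬ (t j * t j * piN p (j * K) (walk ω (j * K)) ≤
          dens P η (O j (walk ω (j * K)).1) (η ω) * piN mu (j * K) (walk ω (j * K)).2 ∧
        t j * (dens P η (O j (walk ω (j * K)).1) (η ω) * piN mu (j * K) (walk ω (j * K)).2) ≤
          piN p (j * K) (walk ω (j * K)))} with hE
  set C1 : ℝ := A1 * (2 * C0 + 2 * δ + 1) with hC1
  set C2 : ℝ := A2 * (2 * (3 * δs + 3) + 2 * δs + 1) with hC2
  have hC10 : 0 ≤ C1 := by positivity
  have hC20 : 0 ≤ C2 := by positivity
  have hBC : ∀ᵐ ω ∂P, ∀ᶠ j in atTop, ω ∉ E j := by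
    refine ae_of_exp_bound (C := 3 * Real.exp (C1 + C2)) (r := ε * K) (by positivity) fun j => ?_
    set n : ℝ := ((j * K : ℕ) : ℝ) with hn
    have hn0 : 0 ≤ n := Nat.cast_nonneg _
    have hM1 : ∀ ω, ∑' x : Γ, (if x ∈ TX j ∧ ω ∈ O j x then (1 : ℝ≥0∞) else 0) ≤
        ENNReal.ofReal (Real.exp (A1 * (4 * ε * n) + C1)) := by
      intro ω
      have := hm1 ((l + ε) * n) ((l - ε) * n - C0) (by nlinarith) (ξ ω)
      refine le_trans (ENNReal.tsum_le_tsum fun x => ?_) (this.trans (le_of_eq ?_))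
      · split_ifs with h1 h2 h2
        · exact le_rfl
        · exact absurd ⟨h1.1, hOn _ _ _ h1.2⟩ h2
        · exact bot_le
        · exact le_rfl
      · congr 2; rw [hC1]; ring
    have hM2 : ∀ b, ∑' y : Γs, (if y ∈ TY j ∧ b ∈ Y j y then (1 : ℝ≥0∞) else 0) ≤
        ENNReal.ofReal (Real.exp (A2 * (4 * ε * n) + C2)) := by
      intro b
      have := hm2 ((ls + ε) * n) ((ls - ε) * n - (3 * δs + 3)) (by nlinarith) b
      refine le_trans (ENNReal.tsum_le_tsum fun x => ?_) (this.trans (le_of_eq ?_))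
      · split_ifs with h1 h2 h2
        · exact le_rfl
        · exact absurd ⟨h1.1, hYon _ _ _ h1.2⟩ h2
        · exact bot_le
        · exact le_rfl
      · congr 2; rw [hC2]; ring
    have hst := oneStep (P := P) hη (measurable_walk (j * K)) (O := O j)
      (fun x => hξ (hOm _ x)) (Y := Y j) (fun y => hYom _ y) (t := t j) hM1 hM2
      (pn := piN p (j * K)) (mn := piN mu (j * K))
      (fun g A hA => ratio_formula hP hη hbη (j * K) g hA)
    refine hst.trans ?_
    simp only [ht]
    rw [← hn, ← ENNReal.ofReal_mul (Real.exp_pos _).le, ← ENNReal.ofReal_mul (Real.exp_pos _).le,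
      ← ENNReal.ofReal_mul (Real.exp_pos _).le, ← ENNReal.ofReal_add (by positivity) (by positivity),
      ← ENNReal.ofReal_add (by positivity) (by positivity)]
    apply ENNReal.ofReal_le_ofReal
    simp only [← Real.exp_add]
    rw [mul_assoc (3 : ℝ), ← Real.exp_add]
    have hnj : ε * K * j = ε * n := by rw [hn]; push_cast; ring
    rw [hnj]
    have hA1n : 0 ≤ A1 * (ε * n) := by positivity
    have hA2n : 0 ≤ A2 * (ε * n) := by positivity
    have b1 : Real.exp (-(θ * n)) ≤ Real.exp (C1 + C2 + -(ε * n)) := by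
      apply Real.exp_le_exp.2; rw [hθ]; nlinarith
    have b2 : Real.exp (-(θ * n) + (A1 * (4 * ε * n) + C1 + (A2 * (4 * ε * n) + C2))) ≤
        Real.exp (C1 + C2 + -(ε * n)) := by
      apply Real.exp_le_exp.2; rw [hθ]; nlinarith
    have b3 : Real.exp (-(θ * n) + (A2 * (4 * ε * n) + C2)) ≤ Real.exp (C1 + C2 + -(ε * n)) := by
      apply Real.exp_le_exp.2; rw [hθ]; nlinarith
    linarith
  have htj : Tendsto (fun j : ℕ => j * K) atTop atTop :=
    Filter.tendsto_atTop_mono (fun j => Nat.le_mul_of_pos_right j hKe) tendsto_id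
  filter_upwards [hBC, T1, T2, E1, E2, E3, E4, hbξ, hbη] with ω g0 g1 g2 g3 g4 g5 g6 g7 g8
  obtain ⟨d1, r1⟩ := g7
  obtain ⟨d2, r2⟩ := g8
  simp only [walk_fst] at g1
  simp only [walk_snd] at g2 g5 g6
  filter_upwards [g0, g1, g2, g3, htj.eventually (g4 ε hε), g5, htj.eventually (g6 ε hε)]
    with j k0 k1 k2 k3 k4 k5 k6
  set n : ℝ := ((j * K : ℕ) : ℝ) with hn
  have hξK : ξ ω ∈ Ksh ((l - ε) * n) (walk ω (j * K)).1 := by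
    apply hKn; rw [r1]; exact k1.2 d1
  have hηY : η ω ∈ Yo ((ls - ε) * n) (walk ω (j * K)).2 := by
    apply hYso; apply hYn; rw [r2]; exact k2.2 d2
  refine ⟨(walk ω (j * K)).1, hξK, ?_⟩
  have hcl : t j * t j * piN p (j * K) (walk ω (j * K)) ≤
          dens P η (O j (walk ω (j * K)).1) (η ω) * piN mu (j * K) (walk ω (j * K)).2 ∧
        t j * (dens P η (O j (walk ω (j * K)).1) (η ω) * piN mu (j * K) (walk ω (j * K)).2) ≤
          piN p (j * K) (walk ω (j * K)) := by
    by_contra hcon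
    exact k0 ⟨hKO _ _ hξK, k1.1, k2.1, hηY, hcon⟩
  have := real_bounds (n := n) (ε := ε) (hπ := hπ) (hs := hs) (th := θ * n) rfl
    (mul_nonneg hθ0 (Nat.cast_nonneg _)) (piN_ne_top hP _ _) (piN_ne_top hPs _ _) hcl.1 hcl.2
    k3 k4 k5 k6
  obtain ⟨w1, w2, w3⟩ := this
  refine ⟨w1, le_trans (le_of_eq ?_) w2, w3.trans (le_of_eq ?_)⟩
  · congr 1; rw [hθ]; ring
  · congr 1; rw [hθ]; ring

end Core

/-! ### Interpolation between scales -/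

section Scales

lemma scales_pos {F : ℝ → ℝ} (hmono : ∀ r r', 0 < r → r ≤ r' → F r ≤ F r') {a b C : ℝ} {K : ℕ}
    (ha : 0 < a) (hK : 1 ≤ K)
    (hlo : ∀ᶠ j : ℕ in atTop, Real.exp (-((j * K : ℕ) * b)) ≤
      F (Real.exp (-(a * (j * K : ℕ) - C)))) : ∀ r, 0 < r → 0 < F r := by
  intro r hr
  have htj : Tendsto (fun j : ℕ => ((j * K : ℕ) : ℝ)) atTop atTop :=
    tendsto_natCast_atTop_atTop.comp
      (Filter.tendsto_atTop_mono (fun j => Nat.le_mul_of_pos_right j hK) tendsto_id)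
  have h2 : Tendsto (fun j : ℕ => a * ((j * K : ℕ) : ℝ)) atTop atTop :=
    htj.const_mul_atTop ha
  obtain ⟨j, h3, h4⟩ := (hlo.and (h2.eventually_ge_atTop (C - Real.log r))).exists
  refine lt_of_lt_of_le (Real.exp_pos _) (h3.trans (hmono _ _ (Real.exp_pos _) ?_))
  calc _ ≤ Real.exp (Real.log r) := by apply Real.exp_le_exp.2; linarith
    _ = r := Real.exp_log hr

lemma scales_bounds {F : ℝ → ℝ} (hmono : ∀ r r', 0 < r → r ≤ r' → F r ≤ F r')
    {a b b' C : ℝ} {K : ℕ}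
    (ha : 0 < a) (hC : 0 ≤ C) (hK : 1 ≤ K)
    (hup : ∀ᶠ j : ℕ in atTop, F (Real.exp (-(a * (j * K : ℕ)))) ≤ Real.exp (-((j * K : ℕ) * b')))
    (hlo : ∀ᶠ j : ℕ in atTop, Real.exp (-((j * K : ℕ) * b)) ≤
      F (Real.exp (-(a * (j * K : ℕ) - C)))) :
    ∃ C' : ℝ, ∀ᶠ u : ℝ in atTop,
      b' / a * u - C' ≤ - Real.log (F (Real.exp (-u))) ∧
      - Real.log (F (Real.exp (-u))) ≤ b / a * u + C' := by
  have hpos := scales_pos hmono ha hK hlo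
  have hKr : (1 : ℝ) ≤ K := by exact_mod_cast hK
  have hKr0 : (0 : ℝ) < K := by linarith
  refine ⟨K * |b'| + (C / a + K) * |b|, ?_⟩
  have haK : 0 < a * K := by positivity
  have f1 : Tendsto (fun u : ℝ => ⌊u / (a * K)⌋₊) atTop atTop :=
    tendsto_nat_floor_atTop.comp (tendsto_id.atTop_div_const haK)
  have f2 : Tendsto (fun u : ℝ => ⌈(u + C) / (a * K)⌉₊) atTop atTop :=
    tendsto_nat_ceil_atTop.comp ((tendsto_atTop_add_const_right _ C tendsto_id).atTop_div_const haK)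
  filter_upwards [f1.eventually hup, f2.eventually hlo, eventually_ge_atTop 0] with u h1 h2 hu
  have hb0 : 0 ≤ (C / a + K) * |b| := by positivity
  have hb1 : 0 ≤ K * |b'| := by positivity
  constructor
  · set j := ⌊u / (a * K)⌋₊ with hj
    have j1 : (j : ℝ) ≤ u / (a * K) := Nat.floor_le (by positivity)
    have j2 : u / (a * K) < j + 1 := Nat.lt_floor_add_one _
    push_cast at h1
    have j3 : (j * K : ℝ) ≤ u / a := by
      calc (j * K : ℝ) ≤ u / (a * K) * K := by gcongr
        _ = u / a := by field_simp
    have j4 : u / a - K ≤ j * K := by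
      have : u / (a * K) * K ≤ (j + 1) * K := by gcongr
      have e : u / (a * K) * K = u / a := by field_simp
      rw [e] at this; linarith
    have k1 : F (Real.exp (-u)) ≤ Real.exp (-(j * K * b')) := by
      refine (hmono _ _ (Real.exp_pos _) (Real.exp_le_exp.2 ?_)).trans h1
      have : a * (j * K) ≤ a * (u / a) := by gcongr
      have e : a * (u / a) = u := by field_simp
      linarith
    have k2 := Real.log_le_log (hpos _ (Real.exp_pos _)) k1
    rw [Real.log_exp] at k2
    have k3 : |(u / a - j * K) * b'| ≤ K * |b'| := by
      rw [abs_mul]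
      gcongr
      rw [abs_le]; constructor <;> linarith
    have k4 := (abs_le.1 k3).2
    have : b' / a * u = (u / a) * b' := by ring
    rw [this]
    nlinarith
  · set j := ⌈(u + C) / (a * K)⌉₊ with hj
    have j1 : (u + C) / (a * K) ≤ j := Nat.le_ceil _
    have j2 : (j : ℝ) < (u + C) / (a * K) + 1 := Nat.ceil_lt_add_one (by positivity)
    push_cast at h2
    have e : (u + C) / (a * K) * K = u / a + C / a := by field_simp
    have j3 : u / a + C / a ≤ j * K := by
      rw [← e]; gcongr
    have j4 : (j * K : ℝ) ≤ u / a + C / a + K := by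
      have : (j : ℝ) * K ≤ ((u + C) / (a * K) + 1) * K := by gcongr
      rw [add_mul, e] at this; linarith
    have hCa : 0 ≤ C / a := by positivity
    have k1 : Real.exp (-(j * K * b)) ≤ F (Real.exp (-u)) := by
      refine h2.trans (hmono _ _ (Real.exp_pos _) (Real.exp_le_exp.2 ?_))
      have : a * (u / a + C / a) ≤ a * (j * K) := by gcongr
      have e : a * (u / a + C / a) = u + C := by field_simp
      linarith
    have k2 := Real.log_le_log (Real.exp_pos _) k1
    rw [Real.log_exp] at k2
    have k3 : |(j * K - u / a) * b| ≤ (C / a + K) * |b| := by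
      rw [abs_mul]
      gcongr
      rw [abs_le]; constructor <;> linarith
    have k4 := (abs_le.1 k3).2
    have : b / a * u = (u / a) * b := by ring
    rw [this]
    nlinarith

lemma exact_of_scales {F : ℝ → ℝ} (hmono : ∀ r r', 0 < r → r ≤ r' → F r ≤ F r') {D l c C : ℝ}
    (hl : 0 < l) (hC : 0 ≤ C) {e : ℕ → ℝ} {K : ℕ → ℕ} (he : Tendsto e atTop (𝓝 0))
    (he1 : ∀ m, e m < l) (hK : ∀ m, 1 ≤ K m)
    (hup : ∀ m, ∀ᶠ j : ℕ in atTop, F (Real.exp (-((l - e m) * (j * K m : ℕ)))) ≤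
      Real.exp (-((j * K m : ℕ) * (D - c * e m))))
    (hlo : ∀ m, ∀ᶠ j : ℕ in atTop, Real.exp (-((j * K m : ℕ) * (D + c * e m))) ≤
      F (Real.exp (-((l - e m) * (j * K m : ℕ) - C)))) :
    (∀ r, 0 < r → 0 < F r) ∧
      Tendsto (fun r => Real.log (F r) / Real.log r) (𝓝[>] 0) (𝓝 (D / l)) := by
  refine ⟨scales_pos hmono (sub_pos.2 (he1 0)) (hK 0) (hlo 0), ?_⟩
  have hu : Tendsto (fun u : ℝ => - Real.log (F (Real.exp (-u))) / u) atTop (𝓝 (D / l)) := by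
    have t1 : Tendsto (fun m => (D - c * e m) / (l - e m)) atTop (𝓝 (D / l)) := by
      have : Tendsto (fun m => (D - c * e m) / (l - e m)) atTop (𝓝 ((D - c * 0) / (l - 0))) :=
        (tendsto_const_nhds.sub (he.const_mul c)).div (tendsto_const_nhds.sub he)
          (by simpa using hl.ne')
      simpa using this
    have t2 : Tendsto (fun m => (D + c * e m) / (l - e m)) atTop (𝓝 (D / l)) := by
      have : Tendsto (fun m => (D + c * e m) / (l - e m)) atTop (𝓝 ((D + c * 0) / (l - 0))) :=
        (tendsto_const_nhds.add (he.const_mul c)).div (tendsto_const_nhds.sub he)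
          (by simpa using hl.ne')
      simpa using this
    rw [tendsto_order]
    constructor
    · intro x hx
      obtain ⟨m, hm⟩ := (t1.eventually_const_lt hx).exists
      obtain ⟨C', hC'⟩ := scales_bounds hmono (sub_pos.2 (he1 m)) hC (hK m) (hup m) (hlo m)
      have : Tendsto (fun u : ℝ => ((D - c * e m) / (l - e m) - x) * u) atTop atTop :=
        tendsto_id.const_mul_atTop (sub_pos.2 hm)
      filter_upwards [hC', this.eventually_gt_atTop C', eventually_gt_atTop 0] with u h1 h2 h3
      rw [lt_div_iff₀ h3]
      nlinarith [h1.1]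
    · intro x hx
      obtain ⟨m, hm⟩ := (t2.eventually_lt_const hx).exists
      obtain ⟨C', hC'⟩ := scales_bounds hmono (sub_pos.2 (he1 m)) hC (hK m) (hup m) (hlo m)
      have : Tendsto (fun u : ℝ => (x - (D + c * e m) / (l - e m)) * u) atTop atTop :=
        tendsto_id.const_mul_atTop (sub_pos.2 hm)
      filter_upwards [hC', this.eventually_gt_atTop C', eventually_gt_atTop 0] with u h1 h2 h3
      rw [div_lt_iff₀ h3]
      nlinarith [h1.2]
  have hlog : Tendsto (fun r : ℝ => - Real.log r) (𝓝[>] 0) atTop :=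
    tendsto_neg_atBot_atTop.comp Real.tendsto_log_nhdsGT_zero
  refine (hu.comp hlog).congr' ?_
  filter_upwards [self_mem_nhdsWithin] with r hr
  have hr' : 0 < r := hr
  simp only [Function.comp_apply, neg_neg, Real.exp_log hr', neg_div_neg_eq]

end Scales

/-! ### Disintegrations -/

section Dis
variable {A B : Type*} [MeasurableSpace A] [MeasurableSpace B] {ν : Measure A} {f : A → B}
  {νB : Measure B} {cond : B → Measure A}

lemma dis_aemeasurable [IsProbabilityMeasure ν] (hf : Measurable f)
    (h : IsDisintegration ν f νB cond) {s : Set A} (hs : MeasurableSet s) :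
    AEMeasurable (fun b => cond b s) νB := by
  obtain ⟨h1, h2, h3, h4⟩ := h
  haveI : IsProbabilityMeasure νB := h1 ▸ Measure.isProbabilityMeasure_map hf.aemeasurable
  obtain ⟨g1, m1, l1, i1⟩ := exists_measurable_le_lintegral_eq νB (fun b => cond b s)
  obtain ⟨g2, m2, l2, i2⟩ := exists_measurable_le_lintegral_eq νB (fun b => cond b sᶜ)
  have hsum : ∫⁻ b, (g1 b + g2 b) ∂νB = 1 := by
    rw [lintegral_add_left m1, ← i1, ← i2, ← h4 s hs, ← h4 sᶜ hs.compl, prob_add_prob_compl hs]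
  have hle : (fun b => g1 b + g2 b) ≤ᵐ[νB] fun _ => (1 : ℝ≥0∞) := by
    filter_upwards [h2] with b hb
    calc g1 b + g2 b ≤ cond b s + cond b sᶜ := add_le_add (l1 b) (l2 b)
      _ = 1 := prob_add_prob_compl hs
  have heq : (fun b => g1 b + g2 b) =ᵐ[νB] fun _ => (1 : ℝ≥0∞) :=
    ae_eq_of_ae_le_of_lintegral_le hle (by rw [hsum]; simp) aemeasurable_const
      (by rw [hsum]; simp)
  refine ⟨g1, m1, ?_⟩
  filter_upwards [h2, heq] with b hb hb2
  apply le_antisymm _ (l1 b)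
  have e : cond b s + cond b sᶜ = 1 := prob_add_prob_compl hs
  have hfin : cond b sᶜ ≠ ∞ := measure_ne_top _ _
  have : cond b s + cond b sᶜ ≤ g1 b + cond b sᶜ := by
    rw [e, ← hb2]; gcongr; exact l2 b
  exact (ENNReal.add_le_add_iff_right hfin).1 this

lemma dis_ae [IsProbabilityMeasure ν] (hf : Measurable f)
    (h : IsDisintegration ν f νB cond) {Q : A → Prop} (hQ : ∀ᵐ z ∂ν, Q z) :
    ∀ᵐ b ∂νB, ∀ᵐ z ∂(cond b), Q z := by
  have h0 : ν (toMeasurable ν {z | ¬ Q z}) = 0 := by rw [measure_toMeasurable]; exact hQ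
  have hm := measurableSet_toMeasurable ν {z | ¬ Q z}
  rw [h.2.2.2 _ hm, lintegral_eq_zero_iff' (dis_aemeasurable hf h hm)] at h0
  filter_upwards [h0] with b hb
  exact measure_mono_null (subset_toMeasurable ν {z | ¬ Q z}) hb

lemma dis_conc (hfib : ∀ b, MeasurableSet (f ⁻¹' {b}))
    (h : IsDisintegration ν f νB cond) : ∀ᵐ b ∂νB, ∀ᵐ z ∂(cond b), f z = b := by
  filter_upwards [h.2.1, h.2.2.1] with b h1 h2
  exact (prob_compl_eq_zero_iff (hfib b)).2 h2

lemma dis_dens [IsProbabilityMeasure ν] (hf : Measurable f)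
    (hfib : ∀ b, MeasurableSet (f ⁻¹' {b}))
    (h : IsDisintegration ν f νB cond) {s : Set A} (hs : MeasurableSet s) {g : B → ℝ≥0∞}
    (hg : Measurable g)
    (hgi : ∀ T : Set B, MeasurableSet T → ν (f ⁻¹' T ∩ s) = ∫⁻ b in T, g b ∂νB) :
    ∀ᵐ b ∂νB, cond b s = g b := by
  haveI : IsProbabilityMeasure νB := h.1 ▸ Measure.isProbabilityMeasure_map hf.aemeasurable
  have hae := dis_aemeasurable hf h hs
  have key : (hae.mk _) =ᵐ[νB] g := by
    refine ae_eq_of_forall_setLIntegral_eq_of_sigmaFinite hae.measurable_mk hg ?_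
    intro T hT _
    rw [← hgi T hT, h.2.2.2 _ ((hf hT).inter hs), ← lintegral_indicator hT]
    refine lintegral_congr_ae ?_
    filter_upwards [hae.ae_eq_mk, dis_conc hfib h] with b h1 h2
    by_cases hb : b ∈ T
    · rw [Set.indicator_of_mem hb, ← h1]
      refine measure_congr ?_
      filter_upwards [h2] with z hz
      apply propext
      change z ∈ s ↔ (f z ∈ T ∧ z ∈ s)
      rw [hz]; simp [hb]
    · rw [Set.indicator_of_notMem hb]
      symm
      refine measure_mono_null (t := {z | ¬ f z = b}) ?_ h2
      rintro z ⟨hz, -⟩ hzb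
      apply hb
      rw [← hzb]; exact hz
  filter_upwards [hae.ae_eq_mk, key] with b h1 h2
  exact h1.trans h2

end Dis

/-! ### Conclusion -/

section Fin

lemma qB_quasi {X : Type*} [MetricSpace X] {o : X} {δ : ℝ} (hδ : IsHyperbolicWith X δ)
    {x y z : Boundary X o} {r : ℝ} (hr : 0 < r) (h1 : qB o x z < r) (h2 : qB o y z < r) :
    qB o x y ≤ Real.exp δ * r := by
  have e : r = Real.exp (-(-Real.log r)) := by rw [neg_neg, Real.exp_log hr]
  rw [e] at h1 h2
  have h := qB_le_of_near hδ ((near_of_qB_lt hδ h1).trans hδ (near_of_qB_lt hδ h2).symm)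
  refine h.trans (le_of_eq ?_)
  rw [neg_sub, sub_neg_eq_add, Real.exp_add, Real.exp_log hr]

variable {Γ Γs : Type*} [MetricSpace Γ] [MetricSpace Γs]

lemma measurableSet_qbball {o : Γ} {os : Γs} (z : Boundary Γ o × Boundary Γs os) (r : ℝ) :
    MeasurableSet (qball (qbb o os) z r) := by
  have : qball (qbb o os) z r = qball (qB o) z.1 r ×ˢ qball (qB os) z.2 r := by
    ext w
    simp [qball, qbb]
  rw [this]
  exact (measurableSet_qball _ _).prod (measurableSet_qball _ _)

lemma qbball_fiber {o : Γ} {os : Γs} {m : Measure (Boundary Γ o × Boundary Γs os)}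
    {b : Boundary Γs os} (hm : ∀ᵐ w ∂m, w.2 = b) {z : Boundary Γ o × Boundary Γs os}
    (hz : z.2 = b) {r : ℝ} (hr : 0 < r) :
    m (qball (qbb o os) z r) = m (Prod.fst ⁻¹' qball (qB o) z.1 r) := by
  apply measure_congr
  filter_upwards [hm] with w hw
  apply propext
  change max (qB o z.1 w.1) (qB os z.2 w.2) < r ↔ qB o z.1 w.1 < r
  rw [hz, hw, qB_self, max_lt_iff]
  exact ⟨fun h => h.1, fun h => ⟨h, hr⟩⟩

/-- Exact dimensionality (with positivity of the measures of balls) at a single point. -/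
lemma exact_point {o : Γ} {os : Γs} {m : Measure (Boundary Γ o × Boundary Γs os)}
    [IsProbabilityMeasure m]
    {b : Boundary Γs os} (hm : ∀ᵐ w ∂m, w.2 = b) {z : Boundary Γ o × Boundary Γs os}
    (hz : z.2 = b) {Ksh Osh : ℝ → Γ → Set (Boundary Γ o)} {C0 : ℝ} (hC0 : 0 ≤ C0)
    (hball : ∀ s x, ∀ ξ ∈ Ksh s x, qball (qB o) ξ (Real.exp (-s)) ⊆ Osh s x ∧
        Osh s x ⊆ qball (qB o) ξ (Real.exp (-(s - C0))))
    {D l c : ℝ} (hl : 0 < l) {e : ℕ → ℝ} {K : ℕ → ℕ} (he : Tendsto e atTop (𝓝 0))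
    (he1 : ∀ i, e i < l) (hK : ∀ i, 1 ≤ K i)
    (h : ∀ i, ∀ᶠ j : ℕ in atTop, ∃ x : Γ, z.1 ∈ Ksh ((l - e i) * (j * K i : ℕ)) x ∧
        Real.exp (-((j * K i : ℕ) * (D + c * e i))) ≤
          (m (Prod.fst ⁻¹' Osh ((l - e i) * (j * K i : ℕ)) x)).toReal ∧
        (m (Prod.fst ⁻¹' Osh ((l - e i) * (j * K i : ℕ)) x)).toReal ≤
          Real.exp (-((j * K i : ℕ) * (D - c * e i)))) :
    (∀ r, 0 < r → 0 < m (qball (qbb o os) z r)) ∧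
      Tendsto (fun r : ℝ => Real.log (m (qball (qbb o os) z r)).toReal / Real.log r)
        (𝓝[>] 0) (𝓝 (D / l)) := by
  have key := exact_of_scales (F := fun r => (m (qball (qbb o os) z r)).toReal) (D := D) (c := c)
    (C := C0) ?_ hl hC0 he he1 hK ?_ ?_
  · refine ⟨fun r hr => (ENNReal.toReal_pos_iff.1 (key.1 r hr)).1, key.2⟩
  · intro r r' _ hrr
    exact ENNReal.toReal_mono (measure_ne_top _ _)
      (measure_mono fun w hw => lt_of_lt_of_le (show qbb o os z w < r from hw) hrr)
  · intro i
    filter_upwards [h i] with j hj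
    obtain ⟨x, hx, _, h2⟩ := hj
    refine le_trans ?_ h2
    rw [qbball_fiber hm hz (Real.exp_pos _)]
    exact ENNReal.toReal_mono (measure_ne_top _ _)
      (measure_mono (preimage_mono (hball _ _ _ hx).1))
  · intro i
    filter_upwards [h i] with j hj
    obtain ⟨x, hx, h1, _⟩ := hj
    refine le_trans h1 ?_
    rw [qbball_fiber hm hz (Real.exp_pos _)]
    exact ENNReal.toReal_mono (measure_ne_top _ _)
      (measure_mono (preimage_mono (hball _ _ _ hx).2))

end Fin

/-- Theorem 1.2: exact dimensionality and the dimension formula for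
the conditional measures `ν_π^η` of the harmonic measure over the projection to `∂Γ*`. -/
theorem statement1
    (Γ Γs : Type*) [Group Γ] [Group Γs] [MetricSpace Γ] [MetricSpace Γs]
    [Countable Γ] [Countable Γs]
    [MeasurableSpace Γ] [DiscreteMeasurableSpace Γ]
    [MeasurableSpace Γs] [DiscreteMeasurableSpace Γs]
    (hΓ : IsHypGroupMetric Γ) (hΓs : IsHypGroupMetric Γs)
    (hneΓ : HasFreeSubgroup Γ) (hneΓs : HasFreeSubgroup Γs)
    (p : Γ × Γs → ℝ≥0∞) (hp : IsProb p)
    (hmom : FiniteFirstMoment p fun g => dist (1 : Γ × Γs) g)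
    (hμne : IsNonElemMeasure fun x : Γ => ∑' y : Γs, p (x, y))
    (hμsne : IsNonElemMeasure fun y : Γs => ∑' x : Γ, p (x, y))
    (hπ hs l ls : ℝ)
    (hhπ : HasEntropy p hπ)
    (hhs : HasEntropy (fun y : Γs => ∑' x : Γ, p (x, y)) hs)
    (hl : HasDrift (fun x : Γ => ∑' y : Γs, p (x, y)) (fun x => dist (1 : Γ) x) l)
    (hls : HasDrift (fun y : Γs => ∑' x : Γ, p (x, y)) (fun y => dist (1 : Γs) y) ls)
    (P : Measure (ℕ → Γ × Γs)) (hP : IsRWMeasure p P)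
    (ν : Measure (Boundary Γ (1 : Γ) × Boundary Γs (1 : Γs)))
    (hν : IsJointHarmonic (1 : Γ) (1 : Γs) P (fun ω n => (walk ω n).1)
      (fun ω n => (walk ω n).2) ν)
    (νs : Measure (Boundary Γs (1 : Γs)))
    (condν : Boundary Γs (1 : Γs) → Measure (Boundary Γ (1 : Γ) × Boundary Γs (1 : Γs)))
    (hdis : IsDisintegration ν Prod.snd νs condν)
 :
    (∀ᵐ η ∂νs, ExactDim (qbb (1 : Γ) (1 : Γs)) (condν η) ((hπ - hs) / l)) ∧
      ∀ᵐ η ∂νs, HasDim (qbb (1 : Γ) (1 : Γs)) (condν η) ((hπ - hs) / l) := by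
  haveI := hP.1
  obtain ⟨hinv, ⟨δ, hδ0, hδ⟩, hqi⟩ := id hΓ
  obtain ⟨hinvs, ⟨δs, hδs0, hδs⟩, hqis⟩ := id hΓs
  obtain ⟨bnd, hbm, rfl, hb⟩ := hν
  have hξ : Measurable fun ω => (bnd ω).1 := measurable_fst.comp hbm
  have hη : Measurable fun ω => (bnd ω).2 := measurable_snd.comp hbm
  haveI : IsProbabilityMeasure (P.map bnd) := Measure.isProbabilityMeasure_map hbm.aemeasurable
  have hνs : νs = P.map fun ω => (bnd ω).2 := by
    rw [hdis.1, Measure.map_map measurable_snd hbm]; rfl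
  have hbξ : ∀ᵐ ω : ℕ → Γ × Γs ∂P, ∃ h : IsDivergent (1 : Γ) (fun n => (walk ω n).1),
      (bnd ω).1 = mkB 1 ⟨fun n => (walk ω n).1, h⟩ := by
    filter_upwards [hb] with ω hω
    obtain ⟨h1, h2, e⟩ := hω
    exact ⟨h1, congrArg Prod.fst e⟩
  have hbη : ∀ᵐ ω : ℕ → Γ × Γs ∂P, ∃ h : IsDivergent (1 : Γs) (fun n => (walk ω n).2),
      (bnd ω).2 = mkB 1 ⟨fun n => (walk ω n).2, h⟩ := by
    filter_upwards [hb] with ω hω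
    obtain ⟨h1, h2, e⟩ := hω
    exact ⟨h2, congrArg Prod.snd e⟩
  obtain ⟨A, hA⟩ : ∃ A, LenGrowth (fun x : Γ => dist 1 x) A := growth hqi
  obtain ⟨As, hAs⟩ : ∃ A, LenGrowth (fun y : Γs => dist 1 y) A := growth hqis
  have hl0 : 0 < l := drift_pos (marg_fst hP) (isLen_dist hinv) (mom_fst hmom) hA hμne hl
  have hls0 : 0 < ls := drift_pos (marg_snd hP) (isLen_dist hinvs) (mom_snd hmom) hAs hμsne hls
  choose Ksh Osh hKm hOm hKO hKn hball hOn using fun s x => exists_shadow hδ hδ0 (1 : Γ) s x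
  have hC0 : 0 ≤ 3 * δ + 3 := by linarith
  obtain ⟨c, hc0, hcore⟩ := core hΓ hΓs hP hmom hhπ hhs hl hls hξ hbξ hη hbη hC0 hOm hKO
    hKn hOn
  set e : ℕ → ℝ := fun i => min l ls / ((i : ℝ) + 2) with he
  have hmin : 0 < min l ls := lt_min hl0 hls0
  have he0 : ∀ i, 0 < e i := fun i => by simp only [he]; positivity
  have helt : ∀ i, e i < min l ls := fun i =>
    div_lt_self hmin (by have : (0 : ℝ) ≤ i := i.cast_nonneg; linarith)
  have helim : Tendsto e atTop (𝓝 0) :=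
    tendsto_const_nhds.div_atTop
      (tendsto_atTop_add_const_right _ _ tendsto_natCast_atTop_atTop)
  choose K hK hKae using fun i => hcore (e i) (he0 i) ((helt i).trans_le (min_le_left _ _))
    ((helt i).trans_le (min_le_right _ _))
  set dn : ℝ → Γ → Boundary Γs (1 : Γs) → ℝ≥0∞ := fun s x =>
    dens P (fun ω => (bnd ω).2) ((fun ω => (bnd ω).1) ⁻¹' Osh s x) with hdn
  have hdnm : ∀ s x, Measurable (dn s x) := fun s x => measurable_dens _ _
  -- the almost sure estimate on the boundary
  have hQ : ∀ i, ∀ᵐ z ∂(P.map bnd), ∃ N : ℕ, ∀ j, N ≤ j → ∃ x : Γ,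
      z.1 ∈ Ksh ((l - e i) * (j * K i : ℕ)) x ∧
        Real.exp (-((j * K i : ℕ) * ((hπ - hs) + c * e i))) ≤
          (dn ((l - e i) * (j * K i : ℕ)) x z.2).toReal ∧
        (dn ((l - e i) * (j * K i : ℕ)) x z.2).toReal ≤
          Real.exp (-((j * K i : ℕ) * ((hπ - hs) - c * e i))) := by
    intro i
    refine (ae_map_iff hbm.aemeasurable ?_).2 ?_
    · simp only [setOf_exists, setOf_forall]
      refine MeasurableSet.iUnion fun N => MeasurableSet.iInter fun j =>
        MeasurableSet.iInter fun _ => MeasurableSet.iUnion fun x => ?_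
      refine (measurable_fst (hKm _ _)).inter (MeasurableSet.inter ?_ ?_)
      · exact measurableSet_le measurable_const
          (((hdnm _ _).comp measurable_snd).ennreal_toReal)
      · exact measurableSet_le
          (((hdnm _ _).comp measurable_snd).ennreal_toReal) measurable_const
    · filter_upwards [hKae i] with ω hω
      obtain ⟨N, hN⟩ := eventually_atTop.1 hω
      refine ⟨N, fun j hj => ?_⟩
      obtain ⟨x, h1, _, h3, h4⟩ := hN j hj
      exact ⟨x, h1, h3, h4⟩
  have hfib : ∀ b : Boundary Γs (1 : Γs), MeasurableSet
      ((Prod.snd : Boundary Γ (1 : Γ) × Boundary Γs (1 : Γs) → _) ⁻¹' {b}) :=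
    fun b => measurable_snd (measurableSet_single b)
  have hcd : ∀ s x, ∀ᵐ b ∂νs, condν b (Prod.fst ⁻¹' Osh s x) = dn s x b := by
    intro s x
    refine dis_dens measurable_snd hfib hdis (measurable_fst (hOm s x)) (hdnm s x) ?_
    intro T hT
    rw [Measure.map_apply hbm ((measurable_snd hT).inter (measurable_fst (hOm s x))), hνs,
      hdn, ← dens_set hη hT]
    rfl
  have hcd' : ∀ᵐ b ∂νs, ∀ (i j : ℕ) (x : Γ),
      condν b (Prod.fst ⁻¹' Osh ((l - e i) * (j * K i : ℕ)) x) =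
        dn ((l - e i) * (j * K i : ℕ)) x b :=
    ae_all_iff.2 fun i => ae_all_iff.2 fun j => ae_all_iff.2 fun x => hcd _ _
  have hQ' := dis_ae measurable_snd hdis (ae_all_iff.2 hQ)
  have main : ∀ᵐ b ∂νs, ∀ᵐ z ∂(condν b),
      (∀ r, 0 < r → 0 < condν b (qball (qbb (1 : Γ) (1 : Γs)) z r)) ∧
      Tendsto (fun r : ℝ => Real.log (condν b (qball (qbb (1 : Γ) (1 : Γs)) z r)).toReal /
        Real.log r) (𝓝[>] 0) (𝓝 ((hπ - hs) / l)) := by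
    filter_upwards [hcd', hQ', dis_conc hfib hdis, hdis.2.1] with b h1 h2 h3 h4
    filter_upwards [h2, h3] with z hz1 hz2
    refine exact_point h3 hz2 hC0 hball hl0 helim
      (fun i => (helt i).trans_le (min_le_left _ _)) hK (c := c) fun i => ?_
    obtain ⟨N, hN⟩ := hz1 i
    filter_upwards [eventually_ge_atTop N] with j hj
    obtain ⟨x, hx1, hx2, hx3⟩ := hN j hj
    rw [hz2] at hx2 hx3
    refine ⟨x, hx1, ?_, ?_⟩
    · rw [h1 i j x]; exact hx2
    · rw [h1 i j x]; exact hx3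
  have hex : ∀ᵐ η ∂νs, ExactDim (qbb (1 : Γ) (1 : Γs)) (condν η) ((hπ - hs) / l) := by
    filter_upwards [main] with b hb
    exact hb.mono fun z hz => hz.2
  refine ⟨hex, ?_⟩
  filter_upwards [main, hex, hdis.2.1] with b h1 h2 h3
  refine hasDim_of_exactDim (qbb (1 : Γ) (1 : Γs)) (condν b) measurableSet_qbball ?_
    (C := Real.exp (max δ δs)) ?_ ?_ (finite_dim hΓ hΓs) (h1.mono fun z hz => hz.1) h2
  · intro x
    simp [qbb, qB_self]
  · exact Real.one_le_exp (hδ0.trans (le_max_left _ _))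
  · intro x y z r hr hx hy
    have hx' := max_lt_iff.1 hx
    have hy' := max_lt_iff.1 hy
    refine max_le ((qB_quasi hδ hr hx'.1 hy'.1).trans ?_)
      ((qB_quasi hδs hr hx'.2 hy'.2).trans ?_)
    · gcongr; exact le_max_left _ _
    · gcongr; exact le_max_right _ _

end HMDim
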